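/- (Proposition 3.2: the degenerate perturbed sequence) In the Setup, for q_N sufficiently large there exist K, C > 0 and functions φ_n (satisfying the conclusions of Proposition 3.1) and 2π-periodic functions φ̃_n ∈ C^∞(𝕊¹), n ≥ N, such that, writing Ã_n = Λ·R_{π/2 − φ̃_n}, s̃_n(x) = s((Ã_n)_{r_n^+}(x)) and s̃_n′(x) = s((Ã_n)_{−r_n^−}(x)) for x ∈ I_n: (1) |φ_n − φ̃_n|_{1+1/ν', K} ≤ C q_n^{−2} for every n > N (for an exponent 1 + 1/ν' > 1 + 1/ν, i.e. in a Gevrey class with larger exponent s' = 1+1/ν' > 2); (2) for every x ∈ I_n the block Ã_n(x), Ã_n(Tx), …, Ã_n(T^{r_n^+(x)−1}x) is λ_n-hyperbolic; (3) s̃_n(x) = s̃_n′(x) for every x ∈ (1/10)I_n. -/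

import Mathlib

open Real
open scoped ENNReal

noncomputable section

/-- The Gevrey `(s,K)` weighted sup-norm of `f` on the set `I` (valued in `ℝ≥0∞`). -/
def gevreyNormOn (s K : ℝ) (I : Set ℝ) (f : ℝ → ℝ) : ℝ≥0∞ :=
  ⨆ k : ℕ,
    ENNReal.ofReal (4 * π ^ 2 / 3 * ((1 + (k : ℝ)) ^ 2 / (K ^ k * ((k.factorial : ℝ)) ^ s))) *
      ⨆ x ∈ I, ENNReal.ofReal |iteratedDeriv k f x|

/-- The Gevrey `(s,K)` norm of a (`2π`-periodic) function on the circle `𝕊¹ = ℝ/2πℤ`. -/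
def gevreyNorm (s K : ℝ) (f : ℝ → ℝ) : ℝ≥0∞ := gevreyNormOn s K Set.univ f

/-- The operator norm of a `2×2` real matrix acting on Euclidean `ℝ²`. -/
def mnorm (A : Matrix (Fin 2) (Fin 2) ℝ) : ℝ :=
  ‖Matrix.toEuclideanCLM (𝕜 := ℝ) A‖

/-- The denominator `q_n` of the `n`-th continued fraction convergent of `α`. -/
def cfDen (α : ℝ) (n : ℕ) : ℝ := (GenContFract.of α).dens n

/-- `α` is of bounded type with constant `M`: `q_{n+1} ≤ M q_n` for all `n`. -/
def BoundedType (α M : ℝ) : Prop := ∀ n : ℕ, cfDen α (n + 1) ≤ M * cfDen α n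

/-- `x`, viewed as a point of the circle `ℝ/2πℤ`, lies in the set `S ⊆ ℝ`. -/
def InCircle (S : Set ℝ) (x : ℝ) : Prop := ∃ k : ℤ, x - 2 * π * k ∈ S

/-- The rotation matrix `R_θ`. -/
def rotM (θ : ℝ) : Matrix (Fin 2) (Fin 2) ℝ :=
  !![Real.cos θ, -Real.sin θ; Real.sin θ, Real.cos θ]

/-- The unit vector of `ℝ²` in the direction `t ∈ ℝ` (representing `t mod π ∈ ℝP¹`). -/
def unitDir (t : ℝ) : EuclideanSpace ℝ (Fin 2) :=
  (WithLp.equiv 2 (Fin 2 → ℝ)).symm ![Real.cos t, Real.sin t]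

/-- `t ∈ ℝ` is (a determination of) the most contracted direction `s(A)` of `A`:
the unit vector in direction `t` satisfies `‖A v‖ = ‖A‖⁻¹`. -/
def IsContrDir (A : Matrix (Fin 2) (Fin 2) ℝ) (t : ℝ) : Prop :=
  ‖Matrix.toEuclideanCLM (𝕜 := ℝ) A (unitDir t)‖ = (mnorm A)⁻¹

/-- The iterates of the quasiperiodic cocycle `(α, A)`:
`A_n(x) = A(x + 2π(n-1)α) ⋯ A(x + 2πα) A(x)`. -/
def cocycleIter (α : ℝ) (A : ℝ → Matrix (Fin 2) (Fin 2) ℝ) : ℕ → ℝ → Matrix (Fin 2) (Fin 2) ℝ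
  | 0, _ => 1
  | n + 1, x => A (x + 2 * π * n * α) * cocycleIter α A n x

/-- The backward iterates `A_{-n}(x) = A_n(T^{-n} x)⁻¹`. -/
def cocycleIterNeg (α : ℝ) (A : ℝ → Matrix (Fin 2) (Fin 2) ℝ) (n : ℕ) (x : ℝ) :
    Matrix (Fin 2) (Fin 2) ℝ :=
  (cocycleIter α A n (x - 2 * π * n * α))⁻¹

/-- Partial products of a sequence of matrices: `blockProd A i = A_{i-1} ⋯ A_1 A_0`. -/
def blockProd (A : ℕ → Matrix (Fin 2) (Fin 2) ℝ) : ℕ → Matrix (Fin 2) (Fin 2) ℝ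
  | 0 => 1
  | i + 1 => A i * blockProd A i

/-- The block `A_0, …, A_{n-1}` is `μ`-hyperbolic (with bound `λ` and exponent `ε`). -/
def IsHypBlock (lam mu eps : ℝ) (n : ℕ) (A : ℕ → Matrix (Fin 2) (Fin 2) ℝ) : Prop :=
  (∀ i < n, mnorm (A i) ≤ lam) ∧
  (∀ i : ℕ, 1 ≤ i → i ≤ n → mu ^ ((i : ℝ) * (1 - eps)) ≤ mnorm (blockProd A i)) ∧
  (∀ i < n, mnorm ((A i)⁻¹) ≤ lam) ∧
  (∀ i : ℕ, 1 ≤ i → i ≤ n →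
    mu ^ ((i : ℝ) * (1 - eps)) ≤ mnorm (blockProd (fun j => (A (n - 1 - j))⁻¹) i))

/-- The critical set: the two intervals of radius `r` around `c₁` and `c₂ = c₁ + π`. -/
def critSet (c₁ r : ℝ) : Set ℝ :=
  Set.Icc (c₁ - r) (c₁ + r) ∪ Set.Icc (c₁ + π - r) (c₁ + π + r)

/-- The critical interval `I_n` (radius `q_n^{-β}` around `c₁` and `c₁ + π`). -/
def critI (α β c₁ : ℝ) (n : ℕ) : Set ℝ := critSet c₁ (cfDen α n ^ (-β))

/-- The shrunk critical interval `(1/10)I_n`. -/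
def critI10 (α β c₁ : ℝ) (n : ℕ) : Set ℝ := critSet c₁ (cfDen α n ^ (-β) / 10)

/-- The forward first return time `r⁺(x)` of `x` to `S` under `T x = x + 2πα`. -/
def fwdRet (α : ℝ) (S : Set ℝ) (x : ℝ) : ℕ :=
  sInf {i : ℕ | 0 < i ∧ InCircle S (x + 2 * π * i * α)}

/-- The backward first return time `r⁻(x)` of `x` to `S` under `T x = x + 2πα`. -/
def bwdRet (α : ℝ) (S : Set ℝ) (x : ℝ) : ℕ :=
  sInf {i : ℕ | 0 < i ∧ InCircle S (x - 2 * π * i * α)}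

/-- `r⁺ = min_{x ∈ S} r⁺(x)`. -/
def minFwdRet (α : ℝ) (S : Set ℝ) : ℕ := sInf {m : ℕ | ∃ x ∈ S, m = fwdRet α S x}

/-- `r⁻ = min_{x ∈ S} r⁻(x)`. -/
def minBwdRet (α : ℝ) (S : Set ℝ) : ℕ := sInf {m : ℕ | ∃ x ∈ S, m = bwdRet α S x}

/-- The π-periodic sample bump: on `(c₁ + kπ, c₁ + (k+1)π)` it equals
`c · exp(−(x − c₁ − kπ)^{−ν} − (c₁ + (k+1)π − x)^{−ν})`, and `0` at the endpoints. -/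
def sampleBump (ν c c₁ : ℝ) (x : ℝ) : ℝ :=
  if x - c₁ - (⌊(x - c₁) / π⌋ : ℝ) * π = 0 then 0
  else
    c * Real.exp (-((x - c₁ - (⌊(x - c₁) / π⌋ : ℝ) * π) ^ (-ν)) -
      (π - (x - c₁ - (⌊(x - c₁) / π⌋ : ℝ) * π)) ^ (-ν))

/-- The sample function `φ₀`, defined by `sin φ₀ = sampleBump`. -/
def phi0 (ν c c₁ : ℝ) (x : ℝ) : ℝ := Real.arcsin (sampleBump ν c c₁ x)

/-- `λ = e^{q_N^{q_N}}`. -/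
def lam0 (α : ℝ) (N : ℕ) : ℝ := Real.exp (cfDen α N ^ cfDen α N)

/-- `λ_n`, defined by `ln λ_N = (1−ε) ln λ`, `ln λ_{n+1} = ln λ_n − 10⁴ q_{n+1}^{γ−1}`,
where `ε = M^{−100}`. -/
def lamSeq (α M γ : ℝ) (N n : ℕ) : ℝ :=
  Real.exp ((1 - (M ^ (100 : ℕ))⁻¹) * (cfDen α N ^ cfDen α N) -
    10 ^ 4 * ∑ k ∈ Finset.Icc (N + 1) n, cfDen α k ^ (γ - 1))

/-- `λ̃_n`, defined by `ln λ̃_N = (1+ε) ln λ`, `ln λ̃_{n+1} = ln λ̃_n + 10⁴ q_{n+1}^{γ−1}`. -/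
def tlamSeq (α M γ : ℝ) (N n : ℕ) : ℝ :=
  Real.exp ((1 + (M ^ (100 : ℕ))⁻¹) * (cfDen α N ^ cfDen α N) +
    10 ^ 4 * ∑ k ∈ Finset.Icc (N + 1) n, cfDen α k ^ (γ - 1))

/-- The cocycle map `A = Λ · R_{π/2 − φ}` with `Λ = diag(λ, λ⁻¹)`. -/
def Amat (lam : ℝ) (φ : ℝ → ℝ) (x : ℝ) : Matrix (Fin 2) (Fin 2) ℝ :=
  !![lam, 0; 0, lam⁻¹] * rotM (π / 2 - φ x)

section

/-- Weights making the weighted sum of the derivatives of a function submultiplicative. -/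
structure JetWeight (W : ℕ → ℝ) : Prop where
  pos : ∀ k, 0 < W k
  zero : W 0 = 1
  submul : ∀ i j, ((i + j).choose i : ℝ) * W (i + j) ≤ W i * W j

/-- Weighted sum of the derivatives of order `< K` of `f` at `x`. -/
def jetSum (W : ℕ → ℝ) (K : ℕ) (f : ℝ → ℝ) (x : ℝ) : ℝ :=
  ∑ k ∈ Finset.range K, |iteratedDeriv k f x| * W k

/-- Weighted sum of the derivatives of order `1, …, K` of `f` at `x`. -/
def jetTail (W : ℕ → ℝ) (K : ℕ) (f : ℝ → ℝ) (x : ℝ) : ℝ :=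
  ∑ k ∈ Finset.range K, |iteratedDeriv (k + 1) f x| * W (k + 1)

/-- `f` is smooth at `x` with full jet norm at most `B`. -/
structure JetBound (W : ℕ → ℝ) (x : ℝ) (f : ℝ → ℝ) (B : ℝ) : Prop where
  smooth : ContDiffAt ℝ (⊤ : ℕ∞) f x
  bound : ∀ K, jetSum W K f x ≤ B

/-- `f` is smooth at `x` and the derivatives of positive order have jet norm at most `B`. -/
structure JetTail (W : ℕ → ℝ) (x : ℝ) (f : ℝ → ℝ) (B : ℝ) : Prop where
  smooth : ContDiffAt ℝ (⊤ : ℕ∞) f x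
  bound : ∀ K, jetTail W K f x ≤ B

theorem ContDiffAt.deriv_top {f : ℝ → ℝ} {x : ℝ} (hf : ContDiffAt ℝ (⊤ : ℕ∞) f x) :
    ContDiffAt ℝ (⊤ : ℕ∞) (deriv f) x := by
  have h := hf.fderiv_right (m := (⊤ : ℕ∞)) (by simp)
  exact h.clm_apply contDiffAt_const

theorem ContDiffAt.of_top {f : ℝ → ℝ} {x : ℝ} (hf : ContDiffAt ℝ (⊤ : ℕ∞) f x) (n : ℕ) :
    ContDiffAt ℝ n f x := hf.of_le (by exact_mod_cast le_top)

theorem ContDiffAt.eventually_differentiableAt_top {f : ℝ → ℝ} {x : ℝ}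
    (hf : ContDiffAt ℝ (⊤ : ℕ∞) f x) : ∀ᶠ y in nhds x, DifferentiableAt ℝ f y := by
  have h := (hf.of_top 1).eventually (by simp)
  exact h.mono fun y hy => hy.differentiableAt (by simp)

variable {W : ℕ → ℝ} {x : ℝ} {f g h y w : ℝ → ℝ}

namespace JetWeight

theorem term_nonneg (hW : JetWeight W) (k : ℕ) (f : ℝ → ℝ) (x : ℝ) :
    0 ≤ |iteratedDeriv k f x| * W k := mul_nonneg (abs_nonneg _) (hW.pos k).le

theorem jetSum_mono (hW : JetWeight W) {K K' : ℕ} (h : K ≤ K') : jetSum W K f x ≤ jetSum W K' f x :=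
  Finset.sum_le_sum_of_subset_of_nonneg (Finset.range_mono h) fun k _ _ => hW.term_nonneg k f x

theorem jetSum_nonneg (hW : JetWeight W) (K : ℕ) : 0 ≤ jetSum W K f x :=
  Finset.sum_nonneg fun k _ => hW.term_nonneg k f x

theorem jetTail_nonneg (hW : JetWeight W) (K : ℕ) : 0 ≤ jetTail W K f x :=
  Finset.sum_nonneg fun k _ => hW.term_nonneg _ f x

theorem jetSum_succ (hW : JetWeight W) (K : ℕ) :
    jetSum W (K + 1) f x = |f x| + jetTail W K f x := by
  simp [jetSum, jetTail, Finset.sum_range_succ', hW.zero, add_comm]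

theorem jetSum_le (hW : JetWeight W) (K : ℕ) : jetSum W K f x ≤ |f x| + jetTail W K f x := by
  rw [← hW.jetSum_succ]; exact hW.jetSum_mono (Nat.le_succ K)

end JetWeight

/-- Truncated Cauchy products. -/
theorem sum_range_antidiagonal_le {a b : ℕ → ℝ} (ha : ∀ i, 0 ≤ a i) (hb : ∀ i, 0 ≤ b i) (K : ℕ) :
    ∑ k ∈ Finset.range K, ∑ i ∈ Finset.range (k + 1), a i * b (k - i) ≤
      (∑ i ∈ Finset.range K, a i) * ∑ i ∈ Finset.range K, b i := by
  rw [Finset.sum_mul_sum, Finset.sum_sigma', ← Finset.sum_product']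
  refine le_trans (le_of_eq ?_) (Finset.sum_le_sum_of_subset_of_nonneg
    (s := (Finset.range K ×ˢ Finset.range K).filter fun p => p.1 + p.2 < K)
    (Finset.filter_subset _ _) fun p _ _ => mul_nonneg (ha _) (hb _))
  refine Finset.sum_nbij' (fun p => (p.2, p.1 - p.2)) (fun p => ⟨p.1 + p.2, p.1⟩) ?_ ?_ ?_ ?_ ?_
  · rintro ⟨k, i⟩ h
    simp at h ⊢; omega
  · rintro ⟨k, i⟩ h
    simp at h ⊢; omega
  · rintro ⟨k, i⟩ h
    simp at h ⊢; omega
  · rintro ⟨k, i⟩ h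
    simp
  · rintro ⟨k, i⟩ h
    rfl

theorem jetSum_mul_le (hW : JetWeight W) (hf : ContDiffAt ℝ (⊤ : ℕ∞) f x)
    (hg : ContDiffAt ℝ (⊤ : ℕ∞) g x) (K : ℕ) :
    jetSum W K (fun z => f z * g z) x ≤ jetSum W K f x * jetSum W K g x := by
  refine le_trans ?_ (sum_range_antidiagonal_le (fun k => hW.term_nonneg k f x)
    (fun k => hW.term_nonneg k g x) K)
  refine Finset.sum_le_sum fun k _ => ?_
  rw [show (fun z => f z * g z) = f * g from rfl, iteratedDeriv_mul (hf.of_top k) (hg.of_top k)]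
  refine (mul_le_mul_of_nonneg_right (Finset.abs_sum_le_sum_abs _ _) (hW.pos k).le).trans ?_
  rw [Finset.sum_mul]
  refine Finset.sum_le_sum fun i hi => ?_
  have hik : i + (k - i) = k := by simp at hi; omega
  have h1 := hW.submul i (k - i)
  rw [hik] at h1
  rw [abs_mul, abs_mul, Nat.abs_cast]
  calc _ = (|iteratedDeriv i f x| * |iteratedDeriv (k - i) g x|) * ((k.choose i : ℝ) * W k) := by ring
    _ ≤ (|iteratedDeriv i f x| * |iteratedDeriv (k - i) g x|) * (W i * W (k - i)) := by gcongr
    _ = _ := by ring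

/-- The chain rule in integrated form: a bound for `y` from `y' = w f'`. -/
theorem jetTail_chain (hW : JetWeight W) (hw : ContDiffAt ℝ (⊤ : ℕ∞) w x)
    (hf : ContDiffAt ℝ (⊤ : ℕ∞) f x) (h : deriv y =ᶠ[nhds x] fun z => w z * deriv f z) (K : ℕ) :
    jetTail W K y x ≤ jetSum W K w x * jetTail W K f x := by
  refine le_trans ?_ (sum_range_antidiagonal_le (fun k => hW.term_nonneg k w x)
    (fun k => hW.term_nonneg (k + 1) f x) K)
  refine Finset.sum_le_sum fun k _ => ?_
  rw [iteratedDeriv_succ', h.iteratedDeriv_eq,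
    show (fun z => w z * deriv f z) = w * deriv f from rfl,
    iteratedDeriv_mul (hw.of_top k) (hf.deriv_top.of_top k)]
  refine (mul_le_mul_of_nonneg_right (Finset.abs_sum_le_sum_abs _ _) (hW.pos _).le).trans ?_
  rw [Finset.sum_mul]
  refine Finset.sum_le_sum fun i hi => ?_
  have hik : i + (k - i + 1) = k + 1 := by simp at hi; omega
  have h1 := hW.submul i (k - i + 1)
  rw [hik] at h1
  have h2 : (k.choose i : ℝ) ≤ ((k + 1).choose i : ℝ) := by
    exact_mod_cast Nat.choose_le_choose i (Nat.le_succ k)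
  have h3 := (hW.pos (k + 1)).le
  rw [abs_mul, abs_mul, Nat.abs_cast, iteratedDeriv_succ' (n := k - i)]
  calc _ = (|iteratedDeriv i w x| * |iteratedDeriv (k - i) (deriv f) x|) *
        ((k.choose i : ℝ) * W (k + 1)) := by ring
    _ ≤ (|iteratedDeriv i w x| * |iteratedDeriv (k - i) (deriv f) x|) * (W i * W (k - i + 1)) := by
        exact mul_le_mul_of_nonneg_left ((mul_le_mul_of_nonneg_right h2 h3).trans h1) (by positivity)
    _ = _ := by ring

namespace JetBound

variable {B B' : ℝ}

theorem nonneg (hf : JetBound W x f B) : 0 ≤ B := by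
  simpa [jetSum] using hf.bound 0

theorem mono (hf : JetBound W x f B) (h : B ≤ B') : JetBound W x f B' :=
  ⟨hf.smooth, fun K => (hf.bound K).trans h⟩

theorem tail (hW : JetWeight W) (hf : JetBound W x f B) : JetTail W x f (B - |f x|) :=
  ⟨hf.smooth, fun K => by have := hf.bound (K + 1); rw [hW.jetSum_succ] at this; linarith⟩

theorem of_tail (hW : JetWeight W) (hf : JetTail W x f B) : JetBound W x f (|f x| + B) :=
  ⟨hf.smooth, fun K => (hW.jetSum_le K).trans (by linarith [hf.bound K])⟩

theorem abs_apply_le (hW : JetWeight W) (hf : JetBound W x f B) : |f x| ≤ B := by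
  have := hf.bound 1
  simpa [jetSum, hW.zero] using this

theorem tail' (hW : JetWeight W) (hf : JetBound W x f B) : JetTail W x f B :=
  ⟨hf.smooth, fun K => ((hf.tail hW).bound K).trans (by linarith [abs_nonneg (f x)])⟩

theorem congr (hf : JetBound W x f B) (h : g =ᶠ[nhds x] f) : JetBound W x g B :=
  ⟨hf.smooth.congr_of_eventuallyEq h, fun K => by
    have := hf.bound K
    simpa only [jetSum, h.iteratedDeriv_eq] using this⟩

theorem add (hW : JetWeight W) (hf : JetBound W x f B) (hg : JetBound W x g B') :
    JetBound W x (fun z => f z + g z) (B + B') := by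
  refine ⟨hf.smooth.add hg.smooth, fun K => le_trans ?_ (add_le_add (hf.bound K) (hg.bound K))⟩
  rw [jetSum, jetSum, jetSum, ← Finset.sum_add_distrib]
  refine Finset.sum_le_sum fun k _ => ?_
  rw [show (fun z => f z + g z) = f + g from rfl,
    iteratedDeriv_add (hf.smooth.of_top k) (hg.smooth.of_top k), ← add_mul]
  exact mul_le_mul_of_nonneg_right (abs_add_le _ _) (hW.pos k).le

theorem neg (hf : JetBound W x f B) : JetBound W x (fun z => -f z) B :=
  ⟨hf.smooth.neg, fun K => by simpa [jetSum, iteratedDeriv_fun_neg] using hf.bound K⟩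

theorem sub (hW : JetWeight W) (hf : JetBound W x f B) (hg : JetBound W x g B') :
    JetBound W x (fun z => f z - g z) (B + B') := by
  simpa [sub_eq_add_neg] using hf.add hW hg.neg

theorem mul (hW : JetWeight W) (hf : JetBound W x f B) (hg : JetBound W x g B') :
    JetBound W x (fun z => f z * g z) (B * B') :=
  ⟨hf.smooth.mul hg.smooth, fun K => (jetSum_mul_le hW hf.smooth hg.smooth K).trans
    (mul_le_mul (hf.bound K) (hg.bound K) (hW.jetSum_nonneg K) hf.nonneg)⟩

theorem const (hW : JetWeight W) (c : ℝ) : JetBound W x (fun _ => c) |c| := by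
  refine ⟨contDiffAt_const, fun K => (hW.jetSum_le K).trans (le_of_eq ?_)⟩
  simp [jetTail, iteratedDeriv_const]

theorem const_mul (hW : JetWeight W) (c : ℝ) (hf : JetBound W x f B) :
    JetBound W x (fun z => c * f z) (|c| * B) := (const hW c).mul hW hf

theorem sq (hW : JetWeight W) (hf : JetBound W x f B) :
    JetBound W x (fun z => f z ^ 2) (B ^ 2) := by
  simpa [pow_two] using hf.mul hW hf

theorem pow (hW : JetWeight W) (hf : JetBound W x f B) (m : ℕ) :
    JetBound W x (fun z => f z ^ m) (B ^ m) := by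
  induction m with
  | zero => simpa using const hW (1 : ℝ) (x := x)
  | succ m ih => simpa only [pow_succ] using ih.mul hW hf

theorem comp_add_const (t : ℝ) (hf : JetBound W (x + t) f B) :
    JetBound W x (fun z => f (z + t)) B := by
  refine ⟨?_, fun K => ?_⟩
  · exact ContDiffAt.comp x hf.smooth (contDiffAt_id.add contDiffAt_const)
  · simpa [jetSum, iteratedDeriv_comp_add_const] using hf.bound K

/-- Perturbation of an invertible function. -/
theorem inv_add (hW : JetWeight W) {η : ℝ} (hfx : f x ≠ 0)
    (hfs : ContDiffAt ℝ (⊤ : ℕ∞) f x)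
    (hf : JetBound W x (fun z => (f z)⁻¹) B) (hh : JetBound W x h η) (hη : B * η < 1) :
    f x + h x ≠ 0 ∧ JetBound W x (fun z => (f z + h z)⁻¹) (B / (1 - B * η)) := by
  have hne : f x + h x ≠ 0 := by
    intro h0
    have h1 : |f x|⁻¹ ≤ B := by simpa [abs_inv] using hf.abs_apply_le hW
    have h2 := hh.abs_apply_le hW
    have h3 : |h x| = |f x| := by rw [show h x = - f x by linarith, abs_neg]
    have h4 : 0 < |f x| := abs_pos.2 hfx
    have : |f x|⁻¹ * |f x| ≤ B * η := mul_le_mul h1 (h3 ▸ h2) h4.le hf.nonneg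
    rw [inv_mul_cancel₀ h4.ne'] at this
    linarith
  refine ⟨hne, ?_⟩
  have hs : ContDiffAt ℝ (⊤ : ℕ∞) (fun z => (f z + h z)⁻¹) x := (hfs.add hh.smooth).inv hne
  refine ⟨hs, fun K => ?_⟩
  have hev : (fun z => (f z + h z)⁻¹) =ᶠ[nhds x]
      fun z => (f z)⁻¹ - (f z)⁻¹ * h z * (f z + h z)⁻¹ := by
    filter_upwards [hfs.continuousAt.eventually_ne hfx,
      (hfs.continuousAt.add hh.smooth.continuousAt).eventually_ne hne] with z h1 h2
    have h2' : f z + h z ≠ 0 := h2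
    field_simp
    ring
  have e1 : jetSum W K (fun z => (f z + h z)⁻¹) x =
      jetSum W K (fun z => (f z)⁻¹ - (f z)⁻¹ * h z * (f z + h z)⁻¹) x := by
    simp only [jetSum, hev.iteratedDeriv_eq]
  have hy : JetBound W x (fun z => (f z)⁻¹ * h z) (B * η) := hf.mul hW hh
  have e2 : jetSum W K (fun z => (f z)⁻¹ - (f z)⁻¹ * h z * (f z + h z)⁻¹) x ≤
      jetSum W K (fun z => (f z)⁻¹) x + jetSum W K (fun z => (f z)⁻¹ * h z * (f z + h z)⁻¹) x := by
    rw [jetSum, jetSum, jetSum, ← Finset.sum_add_distrib]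
    refine Finset.sum_le_sum fun k _ => ?_
    rw [show (fun z => (f z)⁻¹ - (f z)⁻¹ * h z * (f z + h z)⁻¹) = (fun z => (f z)⁻¹) -
      (fun z => (f z)⁻¹ * h z * (f z + h z)⁻¹) from rfl,
      iteratedDeriv_sub (hf.smooth.of_top k) ((hy.smooth.mul hs).of_top k), ← add_mul]
    exact mul_le_mul_of_nonneg_right (abs_sub _ _) (hW.pos k).le
  have e3 := jetSum_mul_le hW hy.smooth hs K
  have e4 : jetSum W K (fun z => (f z)⁻¹ * h z) x * jetSum W K (fun z => (f z + h z)⁻¹) x ≤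
      B * η * jetSum W K (fun z => (f z + h z)⁻¹) x :=
    mul_le_mul_of_nonneg_right (hy.bound K) (hW.jetSum_nonneg K)
  have e5 := hf.bound K
  rw [le_div_iff₀ (by linarith)]
  rw [← e1] at e2
  linarith

theorem inv_one_add (hW : JetWeight W) {η : ℝ} (hh : JetBound W x h η) (hη : η ≤ 1 / 2) :
    1 + h x ≠ 0 ∧ JetBound W x (fun z => (1 + h z)⁻¹) 2 := by
  have h1 : JetBound W x (fun _ => ((1 : ℝ))⁻¹) 1 := by simpa using const hW (1 : ℝ)⁻¹ (x := x)
  obtain ⟨h2, h3⟩ := inv_add hW (f := fun _ => (1 : ℝ)) one_ne_zero contDiffAt_const h1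
    (hh.mono hη) (by norm_num)
  exact ⟨h2, h3.mono (by norm_num)⟩

end JetBound

namespace JetTail

variable {B B' η : ℝ}

theorem nonneg (hf : JetTail W x f B) : 0 ≤ B := by simpa [jetTail] using hf.bound 0

theorem mono (hf : JetTail W x f B) (h : B ≤ B') : JetTail W x f B' :=
  ⟨hf.smooth, fun K => (hf.bound K).trans h⟩

theorem congr (hf : JetTail W x f B) (h : g =ᶠ[nhds x] f) : JetTail W x g B :=
  ⟨hf.smooth.congr_of_eventuallyEq h, fun K => by
    have := hf.bound K
    simpa only [jetTail, h.iteratedDeriv_eq] using this⟩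

theorem add_const (hf : JetTail W x f B) (c : ℝ) : JetTail W x (fun z => f z + c) B := by
  refine ⟨hf.smooth.add contDiffAt_const, fun K => ?_⟩
  have := hf.bound K
  simp only [jetTail, iteratedDeriv_succ', deriv_add_const'] at this ⊢
  exact this

theorem sub_value (hW : JetWeight W) (hf : JetTail W x f B) :
    JetBound W x (fun z => f z - f x) B := by
  have := JetBound.of_tail hW (hf.add_const (-f x))
  simpa [sub_eq_add_neg] using this

theorem chain (hW : JetWeight W) (hy : ContDiffAt ℝ (⊤ : ℕ∞) y x)
    (hw : JetBound W x w B) (hf : JetTail W x f η)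
    (h : deriv y =ᶠ[nhds x] fun z => w z * deriv f z) : JetTail W x y (B * η) :=
  ⟨hy, fun K => (jetTail_chain hW hw.smooth hf.smooth h K).trans
    (mul_le_mul (hw.bound K) (hf.bound K) (hW.jetTail_nonneg K) hw.nonneg)⟩

/-- Self-improving chain rule: `y' = (v y) f'`. -/
theorem chain_self (hW : JetWeight W) (hy : ContDiffAt ℝ (⊤ : ℕ∞) y x)
    (hw : JetBound W x w B) (hf : JetTail W x f η) (hη : B * η < 1)
    (h : deriv y =ᶠ[nhds x] fun z => (w z * y z) * deriv f z) :
    JetTail W x y (|y x| * (B * η) / (1 - B * η)) := by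
  refine ⟨hy, fun K => ?_⟩
  have h1 := jetTail_chain hW (hw.smooth.mul hy) hf.smooth h K
  have h2 := jetSum_mul_le hW hw.smooth hy K
  have h3 := hW.jetSum_le K (f := y) (x := x)
  have h4 : jetSum W K (fun z => w z * y z) x ≤ B * (|y x| + jetTail W K y x) :=
    h2.trans (mul_le_mul (hw.bound K) h3 (hW.jetSum_nonneg K) hw.nonneg)
  have h5 : jetTail W K y x ≤ B * (|y x| + jetTail W K y x) * η :=
    h1.trans (mul_le_mul h4 (hf.bound K) (hW.jetTail_nonneg K)
      (mul_nonneg hw.nonneg (add_nonneg (abs_nonneg _) (hW.jetTail_nonneg K))))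
  rw [le_div_iff₀ (by linarith)]
  linarith

theorem rpow_const (hW : JetWeight W) (q : ℝ) (hfx : 0 < f x) (hf : JetTail W x f η)
    (hi : JetBound W x (fun z => (f z)⁻¹) B) (hη : |q| * B * η < 1) :
    JetTail W x (fun z => f z ^ q) (f x ^ q * (|q| * B * η) / (1 - |q| * B * η)) := by
  have hs : ContDiffAt ℝ (⊤ : ℕ∞) (fun z => f z ^ q) x := hf.smooth.rpow_const_of_ne hfx.ne'
  have := chain_self hW hs (hi.const_mul hW q) hf hη ?_
  · rwa [abs_of_pos (rpow_pos_of_pos hfx q)] at this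
  · filter_upwards [hf.smooth.eventually_differentiableAt_top,
      hf.smooth.continuousAt.eventually (lt_mem_nhds hfx)] with z h1 h2
    have := (h1.hasDerivAt.rpow_const (p := q) (Or.inl (ne_of_gt h2))).deriv
    rw [this, rpow_sub_one (ne_of_gt h2)]
    ring

theorem exp_small (hW : JetWeight W) (hf : JetTail W x f η) (hη : η ≤ 1 / 2) :
    JetBound W x (fun z => exp (f z)) (exp (f x) * exp (2 * η)) := by
  have hs : ContDiffAt ℝ (⊤ : ℕ∞) (fun z => exp (f z)) x := hf.smooth.exp
  have h1 := chain_self hW hs (JetBound.const hW 1) hf (by norm_num; linarith) ?_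
  · refine (JetBound.of_tail hW h1).mono ?_
    simp only [abs_exp, abs_one, one_mul]
    have h0 := hf.nonneg
    have h2 : exp (f x) + exp (f x) * η / (1 - η) = exp (f x) * (1 / (1 - η)) := by
      field_simp [show (1 - η) ≠ 0 by linarith]; ring
    rw [h2]
    refine mul_le_mul_of_nonneg_left ?_ (exp_pos _).le
    rw [div_le_iff₀ (by linarith)]
    nlinarith [add_one_le_exp (2 * η)]
  · filter_upwards [hf.smooth.eventually_differentiableAt_top] with z h1
    have := (h1.hasDerivAt.exp).deriv
    simp [this]

theorem const_mul (c : ℝ) (hf : JetTail W x f B) :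
    JetTail W x (fun z => c * f z) (|c| * B) := by
  refine ⟨contDiffAt_const.mul hf.smooth, fun K => ?_⟩
  have := mul_le_mul_of_nonneg_left (hf.bound K) (abs_nonneg c)
  refine le_trans (le_of_eq ?_) this
  simp only [jetTail, Finset.mul_sum]
  refine Finset.sum_congr rfl fun k _ => ?_
  rw [iteratedDeriv_const_mul c (hf.smooth.of_top _), abs_mul, mul_assoc]

theorem exp (hW : JetWeight W) (hf : JetTail W x f η) :
    JetBound W x (fun z => exp (f z)) (Real.exp (f x) * Real.exp (2 * η)) := by
  obtain ⟨m, hm⟩ := exists_nat_gt (2 * η)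
  have h0 := hf.nonneg
  have hm0 : (0 : ℝ) < m := by linarith
  have h1 := exp_small hW (hf.const_mul (m : ℝ)⁻¹) (by
    rw [abs_of_pos (by positivity), inv_mul_le_iff₀ hm0]; linarith)
  have h2 := h1.pow hW m
  have hmne := hm0.ne'
  refine (h2.mono (le_of_eq ?_)).congr (.of_forall fun z => ?_)
  · rw [abs_of_pos (by positivity), mul_pow, ← exp_nat_mul, ← exp_nat_mul]
    congr 2 <;> field_simp
  · show Real.exp (f z) = Real.exp ((m : ℝ)⁻¹ * f z) ^ m
    rw [← exp_nat_mul]; congr 1; field_simp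

theorem sin_cos (hW : JetWeight W) (hf : JetTail W x f η) (hη : η ≤ 1 / 2) :
    JetTail W x (fun z => sin (f z)) (4 * η) ∧ JetTail W x (fun z => cos (f z)) (4 * η) := by
  have hss : ContDiffAt ℝ (⊤ : ℕ∞) (fun z => sin (f z)) x := hf.smooth.sin
  have hcs : ContDiffAt ℝ (⊤ : ℕ∞) (fun z => cos (f z)) x := hf.smooth.cos
  have d1 : deriv (fun z => sin (f z)) =ᶠ[nhds x] fun z => cos (f z) * deriv f z := by
    filter_upwards [hf.smooth.eventually_differentiableAt_top] with z h1
    exact h1.hasDerivAt.sin.deriv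
  have d2 : deriv (fun z => -cos (f z)) =ᶠ[nhds x] fun z => sin (f z) * deriv f z := by
    filter_upwards [hf.smooth.eventually_differentiableAt_top] with z h1
    simpa using h1.hasDerivAt.cos.neg.deriv
  have en : ∀ K, jetTail W K (fun z => -cos (f z)) x = jetTail W K (fun z => cos (f z)) x := by
    intro K; simp [jetTail, iteratedDeriv_fun_neg]
  have key : ∀ K, jetTail W K (fun z => sin (f z)) x ≤ 4 * η ∧
      jetTail W K (fun z => cos (f z)) x ≤ 4 * η := by
    intro K
    have a1 := jetTail_chain hW hcs hf.smooth d1 K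
    have a2 := jetTail_chain hW hss hf.smooth d2 K
    rw [en] at a2
    have a3 := hW.jetSum_le K (f := fun z => sin (f z)) (x := x)
    have a4 := hW.jetSum_le K (f := fun z => cos (f z)) (x := x)
    have s1 := abs_sin_le_one (f x)
    have s2 := abs_cos_le_one (f x)
    have t1 := hW.jetTail_nonneg K (f := fun z => sin (f z)) (x := x)
    have t2 := hW.jetTail_nonneg K (f := fun z => cos (f z)) (x := x)
    have t3 := hf.bound K
    have t4 := hW.jetTail_nonneg K (f := f) (x := x)
    set S := jetTail W K (fun z => sin (f z)) x
    set T := jetTail W K (fun z => cos (f z)) x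
    have b1 : S ≤ (1 + T) * η := a1.trans (mul_le_mul (by linarith) t3 t4 (by linarith))
    have b2 : T ≤ (1 + S) * η := a2.trans (mul_le_mul (by linarith) t3 t4 (by linarith))
    have h0 := hf.nonneg
    have b3 : S + T ≤ 4 * η := by nlinarith
    constructor <;> linarith
  exact ⟨⟨hss, fun K => (key K).1⟩, ⟨hcs, fun K => (key K).2⟩⟩

end JetTail

namespace JetBound

variable {B B' η : ℝ}

theorem sin (hW : JetWeight W) (hf : JetBound W x f η) (hη : η ≤ 1 / 2) :
    JetBound W x (fun z => sin (f z)) (4 * η) := by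
  refine (of_tail hW (JetTail.sin_cos hW (hf.tail hW) (by linarith [abs_nonneg (f x)])).1).mono ?_
  have : |Real.sin (f x)| ≤ |f x| := abs_sin_le_abs
  linarith [abs_nonneg (f x)]

theorem cos_sub_one (hW : JetWeight W) (hf : JetBound W x f η) (hη : η ≤ 1 / 2) :
    JetBound W x (fun z => cos (f z) - 1) (4 * η) := by
  have h1 := (JetTail.sin_cos hW (hf.tail hW) (by linarith [abs_nonneg (f x)])).2
  refine (of_tail hW (h1.add_const (-1))).mono ?_
  have h3 : |f x| ≤ 1 / 2 := (hf.abs_apply_le hW).trans hη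
  have h4 := one_sub_sq_div_two_le_cos (x := f x)
  have h5 := cos_le_one (f x)
  have h6 : |Real.cos (f x) + -1| ≤ |f x| := by
    rw [abs_le]; constructor <;> nlinarith [abs_nonneg (f x), sq_abs (f x)]
  linarith [abs_nonneg (f x)]

theorem arctan (hW : JetWeight W) (hf : JetBound W x f η) (hη : η ≤ 1 / 2) :
    JetBound W x (fun z => arctan (f z)) (2 * η) := by
  have h1 := (inv_one_add hW (hf.sq hW) (by nlinarith [hf.nonneg])).2
  have hs : ContDiffAt ℝ (⊤ : ℕ∞) (fun z => Real.arctan (f z)) x := hf.smooth.arctan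
  have h2 := JetTail.chain hW hs h1 (hf.tail hW) ?_
  · refine (of_tail hW h2).mono ?_
    have arctan_le_self : ∀ {t : ℝ}, 0 ≤ t → Real.arctan t ≤ t := fun {t} ht => by
      have := le_tan (arctan_nonneg.2 ht) (arctan_lt_pi_div_two t)
      rwa [tan_arctan] at this
    have h3 : |Real.arctan (f x)| ≤ |f x| := by
      rcases le_total 0 (f x) with h | h
      · rw [abs_of_nonneg h, abs_of_nonneg (arctan_nonneg.2 h)]
        exact arctan_le_self h
      · rw [abs_of_nonpos h, abs_of_nonpos (by simpa using arctan_nonneg.2 (neg_nonneg.2 h))]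
        rw [← arctan_neg]
        exact arctan_le_self (by linarith)
    linarith [abs_nonneg (f x)]
  · filter_upwards [hf.smooth.eventually_differentiableAt_top] with z h1
    have := h1.hasDerivAt.arctan.deriv
    rw [this]; simp [one_div]

theorem arcsin (hW : JetWeight W) (hf : JetBound W x f η) (hη : η ≤ 1 / 2) :
    JetBound W x (fun z => arcsin (f z)) (4 * η) := by
  have h0 := hf.nonneg
  have hx : |f x| ≤ 1 / 2 := (hf.abs_apply_le hW).trans hη
  have hx' := abs_le.1 hx
  have hq : JetBound W x (fun z => -(f z ^ 2)) (η ^ 2) := (hf.sq hW).neg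
  have h1 := inv_add hW (f := fun _ => (1 : ℝ)) (B := 1) one_ne_zero contDiffAt_const
    (by simpa using const hW (1 : ℝ)⁻¹ (x := x)) hq (by nlinarith)
  have hpos : 0 < 1 + -(f x ^ 2) := by nlinarith
  have ht : JetTail W x (fun z => 1 + -(f z ^ 2)) (η ^ 2) := by
    simpa [add_comm] using (hq.tail' hW).add_const 1
  have hle : 1 / (1 - 1 * η ^ 2) ≤ 4 / 3 := by
    rw [div_le_div_iff₀ (by nlinarith) (by norm_num)]; nlinarith
  have h2 := JetTail.rpow_const hW (f := fun z => 1 + -(f z ^ 2)) (-1 / 2) hpos ht (h1.2.mono hle) (by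
    rw [show |(-1 / 2 : ℝ)| = 1 / 2 by norm_num [abs_div]]; nlinarith)
  have h3 := of_tail hW h2
  have hv : (1 + -(f x ^ 2)) ^ (-1 / 2 : ℝ) ≤ 2 := by
    have : (1 + -(f x ^ 2)) ^ (-1 / 2 : ℝ) ≤ (1 / 4 : ℝ) ^ (-1 / 2 : ℝ) :=
      rpow_le_rpow_of_nonpos (by norm_num) (by nlinarith) (by norm_num)
    refine this.trans (le_of_eq ?_)
    rw [show (1 / 4 : ℝ) = 2 ^ (-2 : ℝ) by norm_num [rpow_neg], ← rpow_mul (by norm_num)]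
    norm_num
  have h4 : JetBound W x (fun z => (1 + -(f z ^ 2)) ^ (-1 / 2 : ℝ)) 3 := by
    refine h3.mono ?_
    rw [abs_of_pos (rpow_pos_of_pos hpos _), show |(-1 / 2 : ℝ)| = 1 / 2 by norm_num [abs_div]]
    have hp := rpow_pos_of_pos hpos (-1 / 2 : ℝ)
    have : (1 / 2 * (4 / 3) * η ^ 2) / (1 - 1 / 2 * (4 / 3) * η ^ 2) ≤ 1 / 2 := by
      rw [div_le_iff₀ (by nlinarith)]; nlinarith
    rw [mul_div_assoc]
    nlinarith
  have hs : ContDiffAt ℝ (⊤ : ℕ∞) (fun z => Real.arcsin (f z)) x :=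
    ContDiffAt.comp x (g := Real.arcsin) (contDiffAt_arcsin (by linarith) (by linarith)) hf.smooth
  have h5 := JetTail.chain hW hs h4 (hf.tail hW) ?_
  · refine (of_tail hW h5).mono ?_
    have : |Real.arcsin (f x)| ≤ 2 * |f x| := by
      have aux : ∀ t : ℝ, 0 ≤ t → t ≤ 1 / 2 → Real.arcsin t ≤ 2 * t := by
        intro t h0 h1
        have := Real.mul_le_sin (x := Real.arcsin t) (arcsin_nonneg.2 h0) (arcsin_le_pi_div_two t)
        rw [sin_arcsin (by linarith) (by linarith)] at this
        have h7 := arcsin_nonneg.2 h0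
        have : 1 / 2 * Real.arcsin t ≤ t := by
          refine le_trans (mul_le_mul_of_nonneg_right ?_ h7) this
          rw [div_le_div_iff₀ (by norm_num) pi_pos]; linarith [pi_le_four]
        linarith
      rcases le_total 0 (f x) with h | h
      · rw [abs_of_nonneg h, abs_of_nonneg (arcsin_nonneg.2 h)]
        exact aux _ h (by linarith)
      · rw [abs_of_nonpos h, abs_of_nonpos (arcsin_nonpos.2 h), ← arcsin_neg]
        exact aux _ (by linarith) (by linarith)
    have := abs_nonneg (f x)
    linarith
  · filter_upwards [hf.smooth.eventually_differentiableAt_top,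
      hf.smooth.continuousAt.eventually (Ioo_mem_nhds (a := -1) (b := 1) (by linarith) (by linarith))]
      with z h1 h2
    have h6 := ((hasDerivAt_arcsin (x := f z) (by linarith [h2.1]) (by linarith [h2.2])).comp z
      h1.hasDerivAt).deriv
    rw [show (fun z => Real.arcsin (f z)) = Real.arcsin ∘ f from rfl, h6]
    congr 1
    rw [sqrt_eq_rpow, one_div, ← rpow_neg (by nlinarith [h2.1, h2.2])]
    norm_num [sub_eq_add_neg]

end JetBound

end

section

/-- The weights `1 / (L^k (k!)^s)` of the Gevrey class of order `s`. -/
def gevWeight (L s : ℝ) (k : ℕ) : ℝ := 1 / (L ^ k * (k.factorial : ℝ) ^ s)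

theorem gevWeight_jetWeight {L s : ℝ} (hL : 0 < L) (hs : 1 ≤ s) : JetWeight (gevWeight L s) where
  pos k := by unfold gevWeight; positivity
  zero := by simp [gevWeight]
  submul i j := by
    unfold gevWeight
    have h1 : (((i + j).factorial : ℕ) : ℝ) =
        ((i + j).choose i : ℝ) * (i.factorial * j.factorial : ℝ) := by
      rw [← Nat.add_choose_mul_factorial_mul_factorial i j, Nat.choose_symm_add]; push_cast; ring
    have hc : (1 : ℝ) ≤ ((i + j).choose i : ℝ) := by
      exact_mod_cast Nat.choose_pos (Nat.le_add_right i j)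
    have h2 : ((i + j).choose i : ℝ) ≤ ((i + j).choose i : ℝ) ^ s := by
      simpa using rpow_le_rpow_of_exponent_le hc hs
    rw [h1, mul_rpow (by positivity) (by positivity), mul_rpow (by positivity) (by positivity)]
    rw [mul_one_div, div_mul_div_comm, one_mul, div_le_div_iff₀ (by positivity) (by positivity)]
    rw [pow_add]
    calc _ = ((i + j).choose i : ℝ) * (L ^ i * L ^ j * (i.factorial ^ s * j.factorial ^ s)) := by
          ring
      _ ≤ ((i + j).choose i : ℝ) ^ s * (L ^ i * L ^ j * (i.factorial ^ s * j.factorial ^ s)) := by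
          gcongr
      _ = _ := by ring

theorem gevWeight_one {L s : ℝ} : gevWeight L s 1 = 1 / L := by simp [gevWeight]

/-- The elementary estimate `v^k ≤ (k!)^τ exp(τ v^{1/τ})`. -/
theorem pow_le_factorial_rpow_mul_exp {v τ : ℝ} (hv : 0 < v) (hτ : 0 < τ) (k : ℕ) :
    v ^ k ≤ (k.factorial : ℝ) ^ τ * exp (τ * v ^ (1 / τ)) := by
  have h1 : (v ^ (1 / τ)) ^ k / k.factorial ≤ exp (v ^ (1 / τ)) :=
    pow_div_factorial_le_exp _ (by positivity) k
  rw [div_le_iff₀ (by positivity)] at h1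
  have h2 := rpow_le_rpow (by positivity) h1 hτ.le
  rw [mul_rpow (by positivity) (by positivity), ← exp_mul, ← rpow_natCast (v ^ (1 / τ)),
    ← rpow_mul (by positivity), ← rpow_mul (by positivity)] at h2
  have h3 : 1 / τ * ((k : ℝ) * τ) = k := by field_simp
  rw [h3, rpow_natCast] at h2
  calc _ ≤ _ := h2
    _ = _ := by ring_nf

namespace JetBound

variable {W W' : ℕ → ℝ} {x B : ℝ} {f : ℝ → ℝ}

theorem change_weight {c : ℝ} (hc : 0 ≤ c) (h : ∀ k, W' k ≤ c * W k)
    (hf : JetBound W x f B) : JetBound W' x f (c * B) := by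
  refine ⟨hf.smooth, fun K => ?_⟩
  refine le_trans ?_ (mul_le_mul_of_nonneg_left (hf.bound K) hc)
  rw [jetSum, jetSum, Finset.mul_sum]
  refine Finset.sum_le_sum fun k _ => ?_
  calc _ ≤ |iteratedDeriv k f x| * (c * W k) := mul_le_mul_of_nonneg_left (h k) (abs_nonneg _)
    _ = _ := by ring

end JetBound

namespace JetBound

variable {x B L L' s s' : ℝ} {f : ℝ → ℝ}

theorem gev_mono (hL : 0 < L) (hLL : L ≤ L') (hf : JetBound (gevWeight L s) x f B) :
    JetBound (gevWeight L' s) x f B := by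
  have := hf.change_weight (W' := gevWeight L' s) zero_le_one fun k => ?_
  · simpa using this
  · unfold gevWeight
    rw [one_mul]
    gcongr

/-- Raising the Gevrey order, at the price of an exponential factor. -/
theorem gev_raise (hL : 0 < L) (hL' : 0 < L') (hs : s < s')
    (hf : JetBound (gevWeight L s) x f B) :
    JetBound (gevWeight L' s') x f (exp ((s' - s) * (L / L') ^ (1 / (s' - s))) * B) := by
  refine hf.change_weight (exp_pos _).le fun k => ?_
  have h1 := pow_le_factorial_rpow_mul_exp (div_pos hL hL') (sub_pos.2 hs) k
  have hk : (0 : ℝ) < k.factorial := by positivity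
  unfold gevWeight
  rw [mul_one_div, div_le_div_iff₀ (by positivity) (by positivity)]
  rw [div_pow, div_le_iff₀ (by positivity)] at h1
  have h2 : (k.factorial : ℝ) ^ s' = (k.factorial : ℝ) ^ s * (k.factorial : ℝ) ^ (s' - s) := by
    rw [← rpow_add hk]; ring_nf
  rw [h2]
  calc _ = (k.factorial : ℝ) ^ s * L ^ k := by ring
    _ ≤ (k.factorial : ℝ) ^ s * ((k.factorial : ℝ) ^ (s' - s) *
        exp ((s' - s) * (L / L') ^ (1 / (s' - s))) * L' ^ k) := by gcongr
    _ = _ := by ring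

theorem comp_affine (hf : ContDiff ℝ (⊤ : ℕ∞) f) (m b : ℝ) (hm : m ≠ 0)
    (h : JetBound (gevWeight L s) (m * x + b) f B) :
    JetBound (gevWeight (L * |m|) s) x (fun z => f (m * z + b)) B := by
  have hs : ContDiff ℝ (⊤ : ℕ∞) fun z => f (z + b) := hf.comp (contDiff_id.add contDiff_const)
  refine ⟨(hf.comp ((contDiff_const.mul contDiff_id).add contDiff_const)).contDiffAt, fun K => ?_⟩
  refine le_trans (le_of_eq ?_) (h.bound K)
  refine Finset.sum_congr rfl fun k _ => ?_
  rw [iteratedDeriv_comp_const_mul (f := fun z => f (z + b)) (hs.of_le (by exact_mod_cast le_top)) m,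
    iteratedDeriv_comp_add_const]
  have : |m| ≠ 0 := abs_ne_zero.2 hm
  simp only [gevWeight, abs_mul, abs_pow, mul_pow]
  field_simp

end JetBound

theorem JetTail.gev_shrink {x B L L' s : ℝ} {f : ℝ → ℝ} (hL : 0 < L) (hLL : L ≤ L')
    (hf : JetTail (gevWeight L s) x f B) : JetTail (gevWeight L' s) x f (L / L' * B) := by
  have hL' : 0 < L' := hL.trans_le hLL
  refine ⟨hf.smooth, fun K => le_trans ?_ (mul_le_mul_of_nonneg_left (hf.bound K) (by positivity))⟩
  rw [jetTail, jetTail, Finset.mul_sum]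
  refine Finset.sum_le_sum fun k _ => ?_
  rw [mul_left_comm]
  refine mul_le_mul_of_nonneg_left ?_ (abs_nonneg _)
  unfold gevWeight
  rw [mul_one_div, le_div_iff₀ (by positivity), one_div_mul_eq_div, div_le_div_iff₀ (by positivity) hL',
    pow_succ, pow_succ]
  have : L ^ k ≤ L' ^ k := pow_le_pow_left₀ hL.le hLL k
  calc _ = L ^ k * (L * L' * ((k + 1).factorial : ℝ) ^ s) := by ring
    _ ≤ L' ^ k * (L * L' * ((k + 1).factorial : ℝ) ^ s) := by gcongr
    _ = _ := by ring

theorem gevreyNorm_le {L s B : ℝ} {f : ℝ → ℝ} (hL : 0 < L) (hs : 1 ≤ s)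
    (hf : ∀ x, JetBound (gevWeight L s) x f B) :
    gevreyNorm s (4 * L) f ≤ ENNReal.ofReal (4 * π ^ 2 / 3 * B) := by
  have hW := gevWeight_jetWeight hL hs
  have hB : 0 ≤ B := (hf 0).nonneg
  unfold gevreyNorm gevreyNormOn
  refine iSup_le fun k => ?_
  have hterm : ∀ x, |iteratedDeriv k f x| ≤ B * (L ^ k * (k.factorial : ℝ) ^ s) := by
    intro x
    have h1 := (hf x).bound (k + 1)
    have h2 : |iteratedDeriv k f x| * gevWeight L s k ≤ jetSum (gevWeight L s) (k + 1) f x :=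
      Finset.single_le_sum (f := fun k => |iteratedDeriv k f x| * gevWeight L s k)
        (fun k _ => hW.term_nonneg k f x) (by simp)
    have h3 := h2.trans h1
    rwa [gevWeight, mul_one_div, div_le_iff₀ (by positivity)] at h3
  have h4 : (⨆ x ∈ Set.univ, ENNReal.ofReal |iteratedDeriv k f x|) ≤
      ENNReal.ofReal (B * (L ^ k * (k.factorial : ℝ) ^ s)) :=
    iSup_le fun x => iSup_le fun _ => ENNReal.ofReal_le_ofReal (hterm x)
  refine (mul_le_mul_right h4 _).trans ?_
  rw [← ENNReal.ofReal_mul (by positivity)]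
  refine ENNReal.ofReal_le_ofReal ?_
  have h5 : (1 + (k : ℝ)) ^ 2 ≤ 4 ^ k := by
    have : (1 + (k : ℝ)) ≤ 2 ^ k := by
      have := one_add_mul_le_pow (a := (1 : ℝ)) (by norm_num) k
      norm_num at this; linarith
    calc (1 + (k : ℝ)) ^ 2 ≤ (2 ^ k) ^ 2 := by gcongr
      _ = 4 ^ k := by rw [← pow_mul, mul_comm, pow_mul]; norm_num
  have h6 : (1 + (k : ℝ)) ^ 2 / ((4 * L) ^ k * (k.factorial : ℝ) ^ s) *
      (L ^ k * (k.factorial : ℝ) ^ s) ≤ 1 := by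
    rw [mul_pow]
    have : (1 + (k : ℝ)) ^ 2 / (4 ^ k * L ^ k * (k.factorial : ℝ) ^ s) *
      (L ^ k * (k.factorial : ℝ) ^ s) = (1 + (k : ℝ)) ^ 2 / 4 ^ k := by
      field_simp
    rw [this, div_le_one (by positivity)]
    exact h5
  calc _ = 4 * π ^ 2 / 3 * B * ((1 + (k : ℝ)) ^ 2 / ((4 * L) ^ k * (k.factorial : ℝ) ^ s) *
      (L ^ k * (k.factorial : ℝ) ^ s)) := by ring
    _ ≤ 4 * π ^ 2 / 3 * B * 1 := by gcongr
    _ = _ := by ring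

end

theorem contDiff_of_hasDerivAt_seq {F : ℕ → ℝ → ℝ} (h : ∀ k x, HasDerivAt (F k) (F (k + 1) x) x) :
    ContDiff ℝ (⊤ : ℕ∞) (F 0) ∧ ∀ k, iteratedDeriv k (F 0) = F k := by
  have h1 : ∀ k, iteratedDeriv k (F 0) = F k := by
    intro k
    induction k with
    | zero => simp
    | succ k ih => rw [iteratedDeriv_succ, ih]; funext x; exact (h k x).deriv
  exact ⟨contDiff_of_differentiable_iteratedDeriv fun k _ => by
    rw [h1]; exact fun x => (h k x).differentiableAt, h1⟩

theorem ContDiffAt.iteratedDeriv_top {f : ℝ → ℝ} {x : ℝ} (hf : ContDiffAt ℝ (⊤ : ℕ∞) f x) (k : ℕ) :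
    ContDiffAt ℝ (⊤ : ℕ∞) (iteratedDeriv k f) x := by
  induction k with
  | zero => simpa using hf
  | succ k ih => rw [iteratedDeriv_succ]; exact ih.deriv_top

/-- The flat function `exp (-x^{-q})` for `x > 0`, extended by `0`. -/
def flatExp (q x : ℝ) : ℝ := if 0 < x then exp (-(x ^ (-q))) else 0

/-- The relative size of the radius of analyticity used for `flatExp q`. -/
def flatRad (q : ℝ) : ℝ := 1 / (18 * (1 + q))

theorem flatRad_pos {q : ℝ} (hq : 0 < q) : 0 < flatRad q := by unfold flatRad; positivity

theorem flatExp_of_pos {q x : ℝ} (hx : 0 < x) : flatExp q x = exp (-(x ^ (-q))) := if_pos hx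

theorem flatExp_of_nonpos {q x : ℝ} (hx : x ≤ 0) : flatExp q x = 0 := if_neg hx.not_gt

theorem flatExp_nonneg (q x : ℝ) : 0 ≤ flatExp q x := by
  unfold flatExp; split_ifs <;> positivity

theorem flatExp_le_one (q x : ℝ) : flatExp q x ≤ 1 := by
  unfold flatExp; split_ifs with h
  · exact exp_le_one_iff.2 (neg_nonpos.2 (rpow_nonneg h.le _))
  · norm_num

theorem flatExp_eventuallyEq {q u : ℝ} (hu : 0 < u) :
    flatExp q =ᶠ[nhds u] fun z => exp (-(z ^ (-q))) := by
  filter_upwards [lt_mem_nhds hu] with z hz using flatExp_of_pos hz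

/-- Tail of the analytic norm of `z ↦ z^{-q}` at scale `flatRad q * u`. -/
theorem jetTail_rpow_neg {q u : ℝ} (hq : 0 < q) (hu : 0 < u) :
    JetTail (gevWeight (1 / (flatRad q * u)) 1) u (fun z => z ^ (-q)) (u ^ (-q) / 8) := by
  have hκ := flatRad_pos hq
  have hW := gevWeight_jetWeight (L := 1 / (flatRad q * u)) (s := 1) (by positivity) le_rfl
  have hid : JetTail (gevWeight (1 / (flatRad q * u)) 1) u (fun z => z) (flatRad q * u) := by
    refine ⟨contDiffAt_id, fun K => ?_⟩
    have h1 : ∀ k, |iteratedDeriv (k + 1) (fun z : ℝ => z) u| *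
        gevWeight (1 / (flatRad q * u)) 1 (k + 1) = if k = 0 then flatRad q * u else 0 := by
      intro k
      rw [iteratedDeriv_fun_id]
      rcases k with _ | k
      · simp [gevWeight_one]
      · simp
    simp only [jetTail, h1, Finset.sum_ite_eq', Finset.mem_range]
    split_ifs
    · exact le_rfl
    · positivity
  have hκ2 : flatRad q ≤ 1 / 2 := by
    unfold flatRad
    rw [div_le_div_iff₀ (by positivity) (by norm_num)]; linarith
  have hqκ : 2 * q * flatRad q ≤ 1 / 9 := by
    unfold flatRad
    rw [mul_one_div, div_le_div_iff₀ (by positivity) (by norm_num)]; linarith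
  have hinv : JetBound (gevWeight (1 / (flatRad q * u)) 1) u (fun z => z⁻¹) (u⁻¹ * 2) := by
    have h1 := JetBound.inv_add hW (f := fun _ => u) (x := u) (h := fun z => z - u) (B := u⁻¹) hu.ne'
      contDiffAt_const (by simpa [abs_of_pos hu] using JetBound.const hW u⁻¹ (x := u))
      (hid.sub_value hW) (by field_simp; linarith)
    have h2 := h1.2
    simp only [add_sub_cancel] at h2
    refine h2.mono ?_
    rw [div_eq_mul_inv]
    refine mul_le_mul_of_nonneg_left ?_ (by positivity)
    rw [inv_le_comm₀ (by field_simp; linarith) (by norm_num)]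
    field_simp; linarith
  have e1 : |(-q)| * (u⁻¹ * 2) * (flatRad q * u) = 2 * q * flatRad q := by
    rw [abs_neg, abs_of_pos hq]; field_simp
  have h3 := JetTail.rpow_const hW (-q) hu hid hinv (by rw [e1]; linarith)
  rw [e1] at h3
  refine h3.mono ?_
  have hp := rpow_pos_of_pos hu (-q)
  rw [mul_div_assoc, div_eq_mul_one_div (u ^ (-q))]
  refine mul_le_mul_of_nonneg_left ?_ hp.le
  rw [div_le_div_iff₀ (by linarith) (by norm_num)]
  linarith

theorem flatExp_analytic {q u : ℝ} (hq : 0 < q) (hu : 0 < u) :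
    JetBound (gevWeight (1 / (flatRad q * u)) 1) u (flatExp q) (exp (-(u ^ (-q)) / 2)) ∧
    JetBound (gevWeight (1 / (flatRad q * u)) 1) u (fun z => (flatExp q z)⁻¹)
      (exp (2 * u ^ (-q))) := by
  have hκ := flatRad_pos hq
  have hW := gevWeight_jetWeight (L := 1 / (flatRad q * u)) (s := 1) (by positivity) le_rfl
  have ht := jetTail_rpow_neg hq hu
  have hp := rpow_pos_of_pos hu (-q)
  constructor
  · have h1 := (ht.const_mul (-1)).exp hW
    refine (h1.mono ?_).congr ?_
    · rw [← exp_add]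
      apply exp_le_exp.2
      norm_num
      linarith
    · simpa using flatExp_eventuallyEq hu
  · have h1 := ht.exp hW
    refine (h1.mono ?_).congr ?_
    · rw [← exp_add]
      apply exp_le_exp.2
      linarith
    · filter_upwards [flatExp_eventuallyEq (q := q) hu] with z hz
      rw [hz, exp_neg, inv_inv]

/-- Exponential flatness beats every power. -/
theorem exists_flat_bound {q : ℝ} (hq : 0 < q) (k : ℕ) :
    ∃ C : ℝ, ∀ u : ℝ, 0 < u → u ≤ 1 → exp (-(u ^ (-q)) / 2) ≤ C * u ^ (k + 2) := by
  obtain ⟨n, hn⟩ := exists_nat_gt ((k + 2 : ℝ) / q)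
  refine ⟨2 ^ n * n.factorial, fun u hu hu1 => ?_⟩
  have ht : 0 < u ^ (-q) / 2 := by positivity
  have h1 := pow_div_factorial_le_exp _ ht.le n
  rw [neg_div, exp_neg, inv_le_comm₀ (exp_pos _) (by positivity)]
  refine le_trans ?_ h1
  have h2 : (u ^ (-q)) ^ n ≥ (u ^ (k + 2))⁻¹ := by
    rw [← rpow_natCast, ← rpow_mul hu.le, ← rpow_natCast, ← rpow_neg hu.le]
    apply rpow_le_rpow_of_exponent_ge hu hu1
    rw [div_lt_iff₀ hq] at hn
    push_cast
    linarith
  rw [div_pow, div_div, mul_inv, div_eq_mul_inv, mul_comm]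
  exact mul_le_mul_of_nonneg_right h2 (by positivity)

theorem flatExp_smooth {q : ℝ} (hq : 0 < q) :
    ContDiff ℝ (⊤ : ℕ∞) (flatExp q) ∧ ∀ k x, x ≤ 0 → iteratedDeriv k (flatExp q) x = 0 := by
  set F : ℕ → ℝ → ℝ := fun k x => if 0 < x then iteratedDeriv k (flatExp q) x else 0 with hF
  have hF0 : F 0 = flatExp q := by
    funext x
    by_cases hx : 0 < x
    · simp [hF, hx]
    · simp [hF, hx, flatExp_of_nonpos (not_lt.1 hx)]
  have key : ∀ k x, HasDerivAt (F k) (F (k + 1) x) x := by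
    intro k x
    rcases lt_trichotomy x 0 with hx | rfl | hx
    · have h1 : F k =ᶠ[nhds x] fun _ => 0 := by
        filter_upwards [gt_mem_nhds hx] with z hz
        simp [hF, not_lt.2 hz.le]
      have h2 : F (k + 1) x = 0 := by simp [hF, not_lt.2 hx.le]
      rw [h2]
      exact (hasDerivAt_const x (0 : ℝ)).congr_of_eventuallyEq h1
    · have h2 : F (k + 1) 0 = 0 := by simp [hF]
      have h3 : F k 0 = 0 := by simp [hF]
      rw [h2]
      obtain ⟨C, hC⟩ := exists_flat_bound hq k
      have hκ := flatRad_pos hq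
      have hb : ∀ u : ℝ, 0 < u → u ≤ 1 →
          |iteratedDeriv k (flatExp q) u| ≤ k.factorial / flatRad q ^ k * C * u ^ 2 := by
        intro u hu hu1
        have hW := gevWeight_jetWeight (L := 1 / (flatRad q * u)) (s := 1) (by positivity) le_rfl
        have h4 := (flatExp_analytic hq hu).1.bound (k + 1)
        have h5 : |iteratedDeriv k (flatExp q) u| * gevWeight (1 / (flatRad q * u)) 1 k ≤
            jetSum (gevWeight (1 / (flatRad q * u)) 1) (k + 1) (flatExp q) u :=
          Finset.single_le_sum (f := fun k => |iteratedDeriv k (flatExp q) u| *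
            gevWeight (1 / (flatRad q * u)) 1 k)
            (fun k _ => hW.term_nonneg k _ u) (by simp)
        have h6 := (h5.trans h4).trans (hC u hu hu1)
        have e : gevWeight (1 / (flatRad q * u)) 1 k = flatRad q ^ k * u ^ k / k.factorial := by
          simp [gevWeight, mul_pow, div_eq_mul_inv, mul_comm]
        rw [e, mul_div_assoc', div_le_iff₀ (by positivity), pow_add] at h6
        rw [div_mul_eq_mul_div, div_mul_eq_mul_div, le_div_iff₀ (by positivity)]
        have h7 : 0 < u ^ k := by positivity
        nlinarith [h6, h7]
      rw [hasDerivAt_iff_isLittleO_nhds_zero]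
      simp only [zero_add, h3, sub_zero, smul_zero]
      have hO : (fun h : ℝ => F k h) =O[nhds 0] fun h : ℝ => h ^ 2 := by
        refine Asymptotics.IsBigO.of_bound (|k.factorial / flatRad q ^ k * C|) ?_
        filter_upwards [gt_mem_nhds (show (0 : ℝ) < 1 by norm_num)] with u hu1
        by_cases hu : 0 < u
        · simp only [hF, hu, if_true, norm_eq_abs]
          refine (hb u hu hu1.le).trans ?_
          rw [abs_of_pos (show 0 < u ^ 2 by positivity)]
          exact mul_le_mul_of_nonneg_right (le_abs_self _) (by positivity)
        · simp only [hF, hu, if_false, norm_zero]; positivity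
      refine hO.trans_isLittleO ?_
      have : (fun h : ℝ => h ^ 2) =o[nhds 0] fun h : ℝ => h ^ 1 :=
        Asymptotics.isLittleO_pow_pow (by norm_num)
      simpa using this
    · have hs : ContDiffAt ℝ (⊤ : ℕ∞) (flatExp q) x := (flatExp_analytic hq hx).1.smooth
      have h1 : F k =ᶠ[nhds x] iteratedDeriv k (flatExp q) := by
        filter_upwards [lt_mem_nhds hx] with z hz
        simp [hF, hz]
      have h2 : F (k + 1) x = deriv (iteratedDeriv k (flatExp q)) x := by
        simp [hF, hx, iteratedDeriv_succ]
      rw [h2]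
      exact (((hs.iteratedDeriv_top k).differentiableAt (by simp)).hasDerivAt).congr_of_eventuallyEq h1
  have h := contDiff_of_hasDerivAt_seq key
  rw [hF0] at h
  refine ⟨h.1, fun k x hx => ?_⟩
  rw [h.2]
  simp [hF, not_lt.2 hx]

/-- Gevrey bounds for the flat function. -/
theorem flatExp_gevrey {q : ℝ} (hq : 0 < q) : ∃ L₀ > 0, ∀ L, L₀ ≤ L →
    (∀ u, 0 < u → JetBound (gevWeight L (1 + 1 / q)) u (flatExp q) (exp (-(u ^ (-q)) / 4)) ∧
      JetBound (gevWeight L (1 + 1 / q)) u (fun z => (flatExp q z)⁻¹) (exp (3 * u ^ (-q)))) ∧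
    ∀ u, u ≤ 0 → JetBound (gevWeight L (1 + 1 / q)) u (flatExp q) 0 := by
  have hκ := flatRad_pos hq
  refine ⟨(4 / q) ^ (1 / q) / flatRad q, by positivity, fun L hL => ⟨fun u hu => ?_, fun u hu => ?_⟩⟩
  · have hL0 : 0 < L := lt_of_lt_of_le (by positivity) hL
    have hp := rpow_pos_of_pos hu (-q)
    have hfac : (1 + 1 / q - 1) * (1 / (flatRad q * u) / L) ^ (1 / (1 + 1 / q - 1)) ≤
        u ^ (-q) / 4 := by
      have e1 : 1 / (1 + 1 / q - 1) = q := by field_simp; ring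
      have e2 : 1 / (flatRad q * u) / L = (flatRad q * L)⁻¹ * u⁻¹ := by field_simp
      rw [e1, e2, mul_rpow (by positivity) (by positivity), inv_rpow hu.le, ← rpow_neg hu.le]
      rw [div_le_iff₀ hκ] at hL
      have h1 : 4 / q ≤ (flatRad q * L) ^ q := by
        have := rpow_le_rpow (by positivity) hL hq.le
        rw [← rpow_mul (by positivity)] at this
        rw [show 1 / q * q = 1 by field_simp, rpow_one] at this
        rwa [mul_comm (flatRad q)]
      have h2 : ((flatRad q * L)⁻¹) ^ q ≤ q / 4 := by
        rw [inv_rpow (by positivity), inv_le_comm₀ (by positivity) (by positivity), inv_div]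
        exact h1
      calc _ ≤ (1 + 1 / q - 1) * (q / 4 * u ^ (-q)) := by
            gcongr; rw [add_sub_cancel_left]; positivity
        _ = _ := by field_simp; ring
    have hs : (1 : ℝ) < 1 + 1 / q := by have : 0 < 1 / q := by positivity
                                        linarith
    obtain ⟨h1, h2⟩ := flatExp_analytic hq hu
    refine ⟨(h1.gev_raise (by positivity) hL0 hs).mono ?_,
      (h2.gev_raise (by positivity) hL0 hs).mono ?_⟩
    · rw [← exp_add]; apply exp_le_exp.2; linarith
    · rw [← exp_add]; apply exp_le_exp.2; linarith
  · obtain ⟨h1, h2⟩ := flatExp_smooth hq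
    exact ⟨h1.contDiffAt, fun K => by simp [jetSum, h2 _ u hu]⟩

/-- A smooth Gevrey step from `0` (for `u ≤ 0`) to `1` (for `u ≥ 1`). -/
def flatStep (p u : ℝ) : ℝ := flatExp p u / (flatExp p u + flatExp p (1 - u))

theorem flatExp_mono {q : ℝ} (hq : 0 < q) {x y : ℝ} (h : x ≤ y) : flatExp q x ≤ flatExp q y := by
  rcases le_or_gt x 0 with hx | hx
  · rw [flatExp_of_nonpos hx]; exact flatExp_nonneg q y
  · rw [flatExp_of_pos hx, flatExp_of_pos (hx.trans_le h)]
    apply exp_le_exp.2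
    exact neg_le_neg (rpow_le_rpow_of_nonpos hx h (by linarith))

theorem flatStep_denom {p : ℝ} (hp : 0 < p) (u : ℝ) :
    flatExp p (1 / 2) ≤ flatExp p u + flatExp p (1 - u) := by
  rcases le_total u (1 / 2) with h | h
  · have := flatExp_mono hp (show 1 / 2 ≤ 1 - u by linarith)
    linarith [flatExp_nonneg p u]
  · have := flatExp_mono hp h
    linarith [flatExp_nonneg p (1 - u)]

theorem flatStep_half_pos (p : ℝ) : 0 < flatExp p (1 / 2) := by
  rw [flatExp_of_pos (by norm_num)]; positivity

theorem flatStep_of_nonpos {p u : ℝ} (hu : u ≤ 0) : flatStep p u = 0 := by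
  simp [flatStep, flatExp_of_nonpos hu]

theorem flatStep_of_one_le {p u : ℝ} (hu : 1 ≤ u) : flatStep p u = 1 := by
  unfold flatStep
  rw [flatExp_of_nonpos (by linarith : 1 - u ≤ 0), add_zero, div_self]
  rw [flatExp_of_pos (by linarith)]; positivity

theorem flatStep_mem {p : ℝ} (hp : 0 < p) (u : ℝ) : 0 ≤ flatStep p u ∧ flatStep p u ≤ 1 := by
  have h1 := flatStep_denom hp u
  have h2 := flatStep_half_pos p
  have h3 := flatExp_nonneg p (1 - u)
  have h4 := flatExp_nonneg p u
  unfold flatStep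
  constructor
  · positivity
  · rw [div_le_one (by linarith)]; linarith

theorem flatStep_smooth {p : ℝ} (hp : 0 < p) : ContDiff ℝ (⊤ : ℕ∞) (flatStep p) := by
  have h := (flatExp_smooth hp).1
  refine h.div (h.add (h.comp (contDiff_const.sub contDiff_id))) fun u => ?_
  have h1 := flatStep_denom hp u
  have h2 := flatStep_half_pos p
  exact ne_of_gt (lt_of_lt_of_le h2 h1)

theorem flatExp_gevrey_le_one {q : ℝ} (hq : 0 < q) : ∃ L₀ > 0, ∀ u,
    JetBound (gevWeight L₀ (1 + 1 / q)) u (flatExp q) 1 := by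
  obtain ⟨L₀, h0, h⟩ := flatExp_gevrey hq
  refine ⟨L₀, h0, fun u => ?_⟩
  obtain ⟨h1, h2⟩ := h L₀ le_rfl
  rcases le_or_gt u 0 with hu | hu
  · exact (h2 u hu).mono zero_le_one
  · refine (h1 u hu).1.mono (exp_le_one_iff.2 ?_)
    have := rpow_pos_of_pos hu (-q); linarith

theorem flatStep_gevrey {p : ℝ} (hp : 0 < p) : ∃ L₁ > 0, ∃ B ≥ 1, ∀ u,
    JetBound (gevWeight L₁ (1 + 1 / p)) u (flatStep p) B := by
  obtain ⟨L₀, h0, h⟩ := flatExp_gevrey_le_one hp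
  set m := flatExp p (1 / 2)
  have hm : 0 < m := flatStep_half_pos p
  have hm1 : m ≤ 1 := flatExp_le_one p _
  have hs : (1 : ℝ) ≤ 1 + 1 / p := by have : 0 < 1 / p := by positivity
                                      linarith
  refine ⟨4 * L₀ / m, by positivity, 2 / m, by rw [ge_iff_le, le_div_iff₀ hm]; linarith, fun u => ?_⟩
  have hLL : L₀ ≤ 4 * L₀ / m := by rw [le_div_iff₀ hm]; nlinarith
  have hW := gevWeight_jetWeight h0 hs
  have hW1 := gevWeight_jetWeight (L := 4 * L₀ / m) (by positivity) hs
  have h2 : JetBound (gevWeight L₀ (1 + 1 / p)) u (fun z => flatExp p (1 - z)) 1 := by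
    have := (h (-1 * u + 1)).comp_affine (flatExp_smooth hp).1 (-1) 1 (by norm_num)
    simpa [sub_eq_neg_add] using this
  have h3 := (h u).add hW h2
  have h4 := ((h3.tail' hW).gev_shrink h0 hLL).sub_value hW1
  have hd := flatStep_denom hp u
  have hdpos : 0 < flatExp p u + flatExp p (1 - u) := lt_of_lt_of_le hm hd
  have hcst : JetBound (gevWeight (4 * L₀ / m) (1 + 1 / p)) u
      (fun _ => (flatExp p u + flatExp p (1 - u))⁻¹) m⁻¹ := by
    refine (JetBound.const hW1 _).mono ?_
    rw [abs_of_pos (by positivity)]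
    exact inv_anti₀ hm hd
  have e : m⁻¹ * (L₀ / (4 * L₀ / m) * (1 + 1)) = 1 / 2 := by field_simp; norm_num
  have h5 := (JetBound.inv_add hW1 (f := fun _ => flatExp p u + flatExp p (1 - u)) hdpos.ne'
    contDiffAt_const hcst h4 (by rw [e]; norm_num)).2
  simp only [add_sub_cancel] at h5
  rw [e] at h5
  refine (((h u).gev_mono h0 hLL).mul hW1 h5).mono (le_of_eq ?_)
  field_simp; norm_num

/-! ### Folding modulo `π` -/

/-- Distance of `x` to `c₁ + πℤ`. -/
def critDist (c₁ x : ℝ) : ℝ := |x - c₁ - π * round ((x - c₁) / π)|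

/-- Signed representative of `x - c₁` modulo `π`. -/
def critFold (c₁ x : ℝ) : ℝ := x - c₁ - π * round ((x - c₁) / π)

theorem abs_critFold (c₁ x : ℝ) : |critFold c₁ x| = critDist c₁ x := rfl

theorem critDist_nonneg (c₁ x : ℝ) : 0 ≤ critDist c₁ x := abs_nonneg _

theorem critDist_le (c₁ x : ℝ) (m : ℤ) : critDist c₁ x ≤ |x - c₁ - π * m| := by
  have h := round_le ((x - c₁) / π) m
  have h2 := mul_le_mul_of_nonneg_left h pi_pos.le
  have e : ∀ t : ℝ, π * |(x - c₁) / π - t| = |x - c₁ - π * t| := by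
    intro t
    rw [← abs_of_pos pi_pos, ← abs_mul, abs_of_pos pi_pos, mul_sub, mul_div_cancel₀ _ pi_ne_zero]
  rwa [e, e] at h2

theorem critDist_le_half (c₁ x : ℝ) : critDist c₁ x ≤ π / 2 := by
  have h := abs_sub_round ((x - c₁) / π)
  have h2 := mul_le_mul_of_nonneg_left h pi_pos.le
  rw [← abs_of_pos pi_pos, ← abs_mul, abs_of_pos pi_pos, mul_sub,
    mul_div_cancel₀ _ pi_ne_zero] at h2
  unfold critDist; linarith

theorem critDist_add_le (c₁ x t : ℝ) : critDist c₁ (x + t) ≤ critDist c₁ x + |t| := by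
  refine (critDist_le c₁ (x + t) (round ((x - c₁) / π))).trans ?_
  rw [show x + t - c₁ - π * round ((x - c₁) / π) = (x - c₁ - π * round ((x - c₁) / π)) + t by ring]
  exact abs_add_le _ _

theorem critFold_periodic (c₁ : ℝ) : Function.Periodic (critFold c₁) π := by
  intro x
  unfold critFold
  rw [show (x + π - c₁) / π = (x - c₁) / π + 1 by field_simp; ring, round_add_one]
  push_cast; ring

theorem critDist_periodic (c₁ : ℝ) : Function.Periodic (critDist c₁) π := fun x => by
  rw [← abs_critFold, ← abs_critFold, critFold_periodic]

theorem critDist_add_int_mul_pi (c₁ x : ℝ) (m : ℤ) : critDist c₁ (x + m * π) = critDist c₁ x :=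
  (critDist_periodic c₁).int_mul m x

theorem inCircle_critSet_iff (c₁ r x : ℝ) : InCircle (critSet c₁ r) x ↔ critDist c₁ x ≤ r := by
  constructor
  · rintro ⟨k, h | h⟩
    · refine (critDist_le c₁ x (2 * k)).trans ?_
      rw [_root_.abs_le]; push_cast
      constructor <;> linarith [h.1, h.2]
    · refine (critDist_le c₁ x (2 * k + 1)).trans ?_
      rw [_root_.abs_le]; push_cast
      constructor <;> linarith [h.1, h.2]
  · intro h
    have h' := _root_.abs_le.1 h
    rcases Int.even_or_odd' (round ((x - c₁) / π)) with ⟨k, hk | hk⟩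
    · refine ⟨k, Or.inl ?_⟩
      rw [hk] at h'; push_cast at h'
      constructor <;> linarith [h'.1, h'.2]
    · refine ⟨k, Or.inr ?_⟩
      rw [hk] at h'; push_cast at h'
      constructor <;> linarith [h'.1, h'.2]

theorem critFold_eq {c₁ z : ℝ} {m : ℤ} (h : |z - c₁ - π * m| < π / 2) :
    critFold c₁ z = z - c₁ - π * m := by
  have : round ((z - c₁) / π) = m := by
    have h' := abs_lt.1 h
    rw [round_eq_iff, Set.mem_Ico, le_div_iff₀ pi_pos, div_lt_iff₀ pi_pos]
    constructor <;> linarith [h'.1, h'.2]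
  rw [critFold, this]

/-- Near `x`, a function of `critFold` supported in `[-1, 1]` is a translate. -/
theorem comp_critFold_eventuallyEq (c₁ x : ℝ) {g : ℝ → ℝ} (hg : ∀ w, 1 < |w| → g w = 0) :
    (fun z => g (critFold c₁ z)) =ᶠ[nhds x]
      fun z => g (z - c₁ - π * round ((x - c₁) / π)) := by
  have h1 := critDist_le_half c₁ x
  have hpi := pi_gt_three
  filter_upwards [Metric.ball_mem_nhds x (show (0 : ℝ) < 1 / 10 by norm_num)] with z hz
  rw [Metric.mem_ball, dist_eq] at hz
  by_cases h2 : |z - c₁ - π * round ((x - c₁) / π)| < π / 2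
  · rw [critFold_eq h2]
  · push Not at h2
    rw [hg (z - c₁ - π * round ((x - c₁) / π)) (by linarith), hg]
    have h3 := critDist_add_le c₁ z (x - z)
    rw [add_sub_cancel, abs_sub_comm] at h3
    rw [abs_critFold]
    have h4 : |z - c₁ - π * round ((x - c₁) / π)| ≤ critDist c₁ x + |z - x| := by
      unfold critDist
      rw [show z - c₁ - π * round ((x - c₁) / π) =
        (x - c₁ - π * round ((x - c₁) / π)) + (z - x) by ring]
      exact abs_add_le _ _
    linarith

theorem JetBound.comp_neg {W : ℕ → ℝ} {x B : ℝ} {f : ℝ → ℝ} (hf : JetBound W (-x) f B) :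
    JetBound W x (fun z => f (-z)) B := by
  refine ⟨hf.smooth.comp x contDiff_neg.contDiffAt, fun K => le_trans (le_of_eq ?_) (hf.bound K)⟩
  refine Finset.sum_congr rfl fun k _ => ?_
  rw [iteratedDeriv_comp_neg, smul_eq_mul, abs_mul, abs_pow, abs_neg, abs_one, one_pow, one_mul]

/-! ### The cutoff around the critical set -/

/-- Smooth plateau supported in `[-r, r]` and equal to `1` on `[-(r-δ), r-δ]`. -/
def plateau (p r δ w : ℝ) : ℝ := flatStep p ((r - w) / δ) * flatStep p ((r + w) / δ)

/-- Cutoff around the critical set. -/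
def critCut (p r δ c₁ x : ℝ) : ℝ := plateau p r δ (critFold c₁ x)

theorem plateau_of_lt {p r δ w : ℝ} (hδ : 0 < δ) (h : r ≤ |w|) : plateau p r δ w = 0 := by
  unfold plateau
  rcases le_abs.1 h with h | h
  · rw [flatStep_of_nonpos (div_nonpos_of_nonpos_of_nonneg (by linarith) hδ.le), zero_mul]
  · rw [flatStep_of_nonpos (u := (r + w) / δ)
      (div_nonpos_of_nonpos_of_nonneg (by linarith) hδ.le), mul_zero]

theorem plateau_of_le {p r δ w : ℝ} (hδ : 0 < δ) (h : |w| ≤ r - δ) : plateau p r δ w = 1 := by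
  unfold plateau
  have h' := abs_le.1 h
  rw [flatStep_of_one_le ((one_le_div hδ).2 (by linarith)),
    flatStep_of_one_le ((one_le_div hδ).2 (by linarith)), mul_one]

theorem plateau_mem {p : ℝ} (hp : 0 < p) (r δ w : ℝ) : 0 ≤ plateau p r δ w ∧ plateau p r δ w ≤ 1 := by
  have h1 := flatStep_mem hp ((r - w) / δ)
  have h2 := flatStep_mem hp ((r + w) / δ)
  exact ⟨mul_nonneg h1.1 h2.1, mul_le_one₀ h1.2 h2.1 h2.2⟩

theorem critCut_periodic (p r δ c₁ : ℝ) : Function.Periodic (critCut p r δ c₁) π := fun x => by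
  simp only [critCut, critFold_periodic c₁ x]

theorem critCut_mem {p : ℝ} (hp : 0 < p) (r δ c₁ x : ℝ) :
    0 ≤ critCut p r δ c₁ x ∧ critCut p r δ c₁ x ≤ 1 := plateau_mem hp _ _ _

theorem critDist_continuous (c₁ : ℝ) : Continuous (critDist c₁) := by
  refine LipschitzWith.continuous (K := 1) (LipschitzWith.of_le_add_mul _ fun x y => ?_)
  have := critDist_add_le c₁ y (x - y)
  simpa [dist_eq] using this

theorem critCut_eventually_one {p r δ c₁ x : ℝ} (hδ : 0 < δ) (h : critDist c₁ x < r - δ) :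
    critCut p r δ c₁ =ᶠ[nhds x] fun _ => 1 := by
  filter_upwards [(critDist_continuous c₁).continuousAt.eventually_lt continuousAt_const h] with z hz
  exact plateau_of_le hδ (by rw [abs_critFold]; exact hz.le)

theorem critCut_eventually_zero {p r δ c₁ x : ℝ} (hδ : 0 < δ) (h : r < critDist c₁ x) :
    critCut p r δ c₁ =ᶠ[nhds x] fun _ => 0 := by
  filter_upwards [continuousAt_const.eventually_lt (critDist_continuous c₁).continuousAt h] with z hz
  exact plateau_of_lt hδ (by rw [abs_critFold]; exact hz.le)

theorem critCut_eq_zero {p r δ c₁ x : ℝ} (hδ : 0 < δ) (h : r ≤ critDist c₁ x) :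
    critCut p r δ c₁ x = 0 := plateau_of_lt hδ (by rwa [abs_critFold])

theorem critCut_eq_one {p r δ c₁ x : ℝ} (hδ : 0 < δ) (h : critDist c₁ x ≤ r - δ) :
    critCut p r δ c₁ x = 1 := plateau_of_le hδ (by rwa [abs_critFold])

theorem critCut_gevrey {p : ℝ} (hp : 0 < p) : ∃ L₁ > 0, ∃ B ≥ 1, ∀ L, L₁ ≤ L →
    ∀ s' > 1 + 1 / p, ∀ r δ c₁ x, 0 < δ → r ≤ 1 →
    JetBound (gevWeight L s') x (critCut p r δ c₁)
      (B * exp (2 * ((s' - (1 + 1 / p)) * δ⁻¹ ^ (1 / (s' - (1 + 1 / p)))))) := by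
  obtain ⟨L₁, h0, B, hB, h⟩ := flatStep_gevrey hp
  refine ⟨L₁, h0, B * B, by nlinarith, fun L hL s' hs' r δ c₁ x hδ hr => ?_⟩
  have hL0 := h0.trans_le hL
  have hp' : 0 < 1 / p := by positivity
  have hW := gevWeight_jetWeight hL0 (show 1 ≤ s' by linarith)
  set τ := s' - (1 + 1 / p) with hτ
  have hτ0 : 0 < τ := by linarith
  have key : ∀ m b, |m| = δ⁻¹ →
      JetBound (gevWeight L s') x (fun z => flatStep p (m * z + b)) (exp (τ * δ⁻¹ ^ (1 / τ)) * B) := by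
    intro m b hm
    have h1 := JetBound.comp_affine (flatStep_smooth hp) m b
      (by rw [← abs_pos, hm]; positivity) (h (m * x + b))
    rw [hm] at h1
    refine (h1.gev_raise (by positivity) hL0 hs').mono ?_
    rw [← hτ]
    gcongr
    rw [div_le_iff₀ hL0, mul_comm]
    gcongr
  have e := comp_critFold_eventuallyEq c₁ x (g := plateau p r δ)
    (fun w hw => plateau_of_lt hδ (hr.trans hw.le))
  set m : ℝ := (round ((x - c₁) / π) : ℝ)
  have k1 := key (-δ⁻¹) ((r + c₁ + π * m) / δ) (by rw [abs_neg, abs_of_pos (by positivity)])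
  have k2 := key (δ⁻¹) ((r - c₁ - π * m) / δ) (by rw [abs_of_pos (by positivity)])
  refine ((k1.mul hW k2).congr (e.trans (Filter.Eventually.of_forall fun z => ?_))).mono ?_
  · simp only [plateau]
    congr 2 <;> field_simp <;> ring
  · rw [two_mul, exp_add]
    exact le_of_eq (by ring)

/-! ### The sample bump -/

theorem sampleBump_eq {ν c c₁ z : ℝ} {m : ℤ} (h : |z - c₁ - π * m| < π) :
    sampleBump ν c c₁ z = c * (flatExp ν (z - c₁ - π * m) * flatExp ν (π - (z - c₁ - π * m)) +
      flatExp ν (-(z - c₁ - π * m)) * flatExp ν (π + (z - c₁ - π * m))) := by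
  have h' := abs_lt.1 h
  have hpi := pi_pos
  rcases lt_trichotomy (z - c₁ - π * m) 0 with hw | hw | hw
  · have hf : ⌊(z - c₁) / π⌋ = m - 1 := by
      rw [Int.floor_eq_iff, le_div_iff₀ pi_pos, div_lt_iff₀ pi_pos]
      push_cast
      constructor <;> nlinarith [h'.1, h'.2]
    have e : z - c₁ - ((m - 1 : ℤ) : ℝ) * π = π + (z - c₁ - π * m) := by push_cast; ring
    unfold sampleBump
    rw [hf, e, if_neg (by linarith), flatExp_of_nonpos hw.le, zero_mul, zero_add,
      flatExp_of_pos (by linarith), flatExp_of_pos (by linarith), ← exp_add]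
    congr 2
    rw [show π - (π + (z - c₁ - π * m)) = -(z - c₁ - π * m) by ring]
    ring
  · have hf : ⌊(z - c₁) / π⌋ = m := by
      rw [Int.floor_eq_iff, le_div_iff₀ pi_pos, div_lt_iff₀ pi_pos]
      constructor <;> nlinarith [h'.1, h'.2]
    unfold sampleBump
    rw [hf, if_pos (by linarith), hw]
    simp [flatExp_of_nonpos]
  · have hf : ⌊(z - c₁) / π⌋ = m := by
      rw [Int.floor_eq_iff, le_div_iff₀ pi_pos, div_lt_iff₀ pi_pos]
      constructor <;> nlinarith [h'.1, h'.2]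
    unfold sampleBump
    rw [hf, show z - c₁ - (m : ℝ) * π = z - c₁ - π * m by ring, if_neg hw.ne',
      flatExp_of_nonpos (x := -(z - c₁ - π * m)) (by linarith), zero_mul, add_zero,
      flatExp_of_pos hw, flatExp_of_pos (by linarith), ← exp_add]
    congr 2

theorem sampleBump_eventuallyEq (ν c c₁ x : ℝ) : sampleBump ν c c₁ =ᶠ[nhds x] fun z =>
    c * (flatExp ν (z - c₁ - π * round ((x - c₁) / π)) *
        flatExp ν (π - (z - c₁ - π * round ((x - c₁) / π))) +
      flatExp ν (-(z - c₁ - π * round ((x - c₁) / π))) *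
        flatExp ν (π + (z - c₁ - π * round ((x - c₁) / π)))) := by
  have h : |x - c₁ - π * round ((x - c₁) / π)| < π := by
    have := critDist_le_half c₁ x
    unfold critDist at this
    linarith [pi_pos]
  have hc : ContinuousAt (fun z => |z - c₁ - π * round ((x - c₁) / π)|) x := by fun_prop
  filter_upwards [hc.eventually_lt continuousAt_const h] with z hz
  exact sampleBump_eq hz

theorem sampleBump_periodic (ν c c₁ : ℝ) : Function.Periodic (sampleBump ν c c₁) π := by
  intro x
  have e : (x + π - c₁) / π = (x - c₁) / π + 1 := by field_simp; ring
  unfold sampleBump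
  rw [e, Int.floor_add_one]
  push_cast
  rw [show x + π - c₁ - ((⌊(x - c₁) / π⌋ : ℝ) + 1) * π = x - c₁ - (⌊(x - c₁) / π⌋ : ℝ) * π by ring]

theorem phi0_periodic (ν c c₁ : ℝ) : Function.Periodic (phi0 ν c c₁) π := fun x => by
  unfold phi0; rw [sampleBump_periodic]

theorem sampleBump_mem {ν c : ℝ} (hc : 0 < c) (c₁ x : ℝ) :
    0 ≤ sampleBump ν c c₁ x ∧ sampleBump ν c c₁ x ≤ c := by
  rw [(sampleBump_eventuallyEq ν c c₁ x).eq_of_nhds]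
  set w := x - c₁ - π * round ((x - c₁) / π)
  have h1 := flatExp_nonneg ν w
  have h2 := flatExp_nonneg ν (-w)
  have h3 := flatExp_nonneg ν (π - w)
  have h4 := flatExp_nonneg ν (π + w)
  have h5 := flatExp_le_one ν w
  have h6 := flatExp_le_one ν (-w)
  have h7 := flatExp_le_one ν (π - w)
  have h8 := flatExp_le_one ν (π + w)
  constructor
  · positivity
  · rcases le_total w 0 with h | h
    · rw [flatExp_of_nonpos h, zero_mul, zero_add]
      exact mul_le_of_le_one_right hc.le (mul_le_one₀ h6 h4 h8)
    · rw [flatExp_of_nonpos (x := -w) (by linarith), zero_mul, add_zero]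
      exact mul_le_of_le_one_right hc.le (mul_le_one₀ h5 h3 h7)

theorem sin_phi0 {ν c : ℝ} (hc : 0 < c) (hc' : c < 1 / 1000) (c₁ x : ℝ) :
    sin (phi0 ν c c₁ x) = sampleBump ν c c₁ x := by
  have h := sampleBump_mem (ν := ν) hc c₁ x
  exact sin_arcsin (by linarith) (by linarith)

theorem sampleBump_gevrey {ν c : ℝ} (hν : 0 < ν) (hc : 0 < c) : ∃ L₀ > 0, ∀ L, L₀ ≤ L → ∀ c₁ x,
    (critDist c₁ x = 0 → JetBound (gevWeight L (1 + 1 / ν)) x (sampleBump ν c c₁) 0) ∧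
    (0 < critDist c₁ x →
      JetBound (gevWeight L (1 + 1 / ν)) x (sampleBump ν c c₁) (c * exp (-(critDist c₁ x ^ (-ν)) / 4)) ∧
      0 < sampleBump ν c c₁ x ∧
      JetBound (gevWeight L (1 + 1 / ν)) x (fun z => (sampleBump ν c c₁ z)⁻¹)
        (c⁻¹ * (exp 3 * exp (3 * critDist c₁ x ^ (-ν))))) := by
  obtain ⟨L₀, h0, h⟩ := flatExp_gevrey hν
  obtain ⟨L₀', h0', h1⟩ := flatExp_gevrey_le_one hν
  refine ⟨max L₀ L₀', by positivity, fun L hL c₁ x => ?_⟩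
  have hL0 : 0 < L := h0.trans_le ((le_max_left _ _).trans hL)
  have hs : (1 : ℝ) ≤ 1 + 1 / ν := by have : 0 < 1 / ν := by positivity
                                      linarith
  have hW := gevWeight_jetWeight hL0 hs
  obtain ⟨ha, hb⟩ := h L ((le_max_left _ _).trans hL)
  have e := sampleBump_eventuallyEq ν c c₁ x
  have hhalf := critDist_le_half c₁ x
  have hdw : critDist c₁ x = |x - c₁ - π * round ((x - c₁) / π)| := rfl
  set m : ℝ := (round ((x - c₁) / π) : ℝ)
  have hpi := pi_gt_three
  have hu1 : ∀ u, JetBound (gevWeight L (1 + 1 / ν)) u (flatExp ν) 1 := fun u =>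
    (h1 u).gev_mono h0' ((le_max_right _ _).trans hL)
  have hu0 : ∀ u ≤ 0, JetBound (gevWeight L (1 + 1 / ν)) u (flatExp ν) 0 := hb
  have aff : ∀ (σ b B u : ℝ), |σ| = 1 → σ * x + b = u →
      JetBound (gevWeight L (1 + 1 / ν)) u (flatExp ν) B →
      JetBound (gevWeight L (1 + 1 / ν)) x (fun z => flatExp ν (σ * z + b)) B := by
    intro σ b B u hσ hu hB
    rw [← hu] at hB
    have := hB.comp_affine (flatExp_smooth hν).1 σ b (by rintro rfl; simp at hσ)
    rwa [hσ, mul_one] at this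
  -- the two halves of the bump
  have pos : ∀ (σ : ℝ), |σ| = 1 → 0 < σ * (x - c₁ - π * m) →
      (sampleBump ν c c₁ =ᶠ[nhds x] fun z => c * (flatExp ν (σ * z + σ * (-c₁ - π * m)) *
        flatExp ν (-σ * z + (π - σ * (-c₁ - π * m))))) →
      JetBound (gevWeight L (1 + 1 / ν)) x (sampleBump ν c c₁) (c * exp (-(critDist c₁ x ^ (-ν)) / 4)) ∧
      0 < sampleBump ν c c₁ x ∧
      JetBound (gevWeight L (1 + 1 / ν)) x (fun z => (sampleBump ν c c₁ z)⁻¹)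
        (c⁻¹ * (exp 3 * exp (3 * critDist c₁ x ^ (-ν)))) := by
    intro σ hσ hw he
    have hd : critDist c₁ x = σ * (x - c₁ - π * m) := by
      rw [hdw, ← abs_of_pos hw, abs_mul, hσ, one_mul]
    have hx1 : σ * x + σ * (-c₁ - π * m) = critDist c₁ x := by rw [hd]; ring
    have hx2 : -σ * x + (π - σ * (-c₁ - π * m)) = π - critDist c₁ x := by rw [hd]; ring
    have hdpos : 0 < critDist c₁ x := by rw [hd]; exact hw
    have a1 := aff σ _ _ _ hσ hx1 (ha _ hdpos).1
    have a2 := aff (-σ) _ _ _ (by rwa [abs_neg]) hx2 (hu1 (π - critDist c₁ x))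
    have hpd : 1 ≤ π - critDist c₁ x := by linarith
    refine ⟨?_, ?_, ?_⟩
    · have := ((a1.mul hW a2).const_mul hW c).congr he
      rwa [mul_one, abs_of_pos hc] at this
    · rw [he.eq_of_nhds]
      simp only [hx1, hx2]
      rw [flatExp_of_pos hdpos, flatExp_of_pos (by linarith)]
      positivity
    · have affi : ∀ (σ b B u : ℝ), |σ| = 1 → σ * x + b = u → 0 < u →
          JetBound (gevWeight L (1 + 1 / ν)) u (fun z => (flatExp ν z)⁻¹) B →
          JetBound (gevWeight L (1 + 1 / ν)) x (fun z => (flatExp ν (σ * z + b))⁻¹) B := by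
        intro σ b B u hσ hu hu0 hB
        rcases (abs_eq zero_le_one).1 hσ with rfl | rfl
        · simp only [one_mul] at hu ⊢
          rw [← hu] at hB
          exact JetBound.comp_add_const (f := fun z => (flatExp ν z)⁻¹) b hB
        · simp only [neg_one_mul] at hu ⊢
          rw [← hu] at hB
          exact JetBound.comp_neg (f := fun z => (flatExp ν (z + b))⁻¹)
            (JetBound.comp_add_const (f := fun z => (flatExp ν z)⁻¹) b hB)
      have b1 := affi σ _ _ _ hσ hx1 hdpos (ha _ hdpos).2
      have b2 := affi (-σ) _ _ _ (by rwa [abs_neg]) hx2 (by linarith) (ha _ (by linarith)).2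
      have h3 : (π - critDist c₁ x) ^ (-ν) ≤ 1 := rpow_le_one_of_one_le_of_nonpos hpd (by linarith)
      refine (((b1.mul hW (b2.mono (exp_le_exp.2 (mul_le_of_le_one_right (by norm_num) h3)))
        ).const_mul hW c⁻¹).congr ?_).mono ?_
      · filter_upwards [he] with z hz
        rw [hz, mul_inv, mul_inv]
      · rw [abs_of_pos (by positivity)]
        exact le_of_eq (by ring)
  constructor
  · intro hd
    rw [hdw, abs_eq_zero] at hd
    have a1 := aff 1 (-c₁ - π * m) 0 0 (by simp) (by linarith) (hu0 0 le_rfl)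
    have a2 := aff (-1) (π - (-c₁ - π * m)) 1 π (by simp) (by linarith) (hu1 _)
    have a3 := aff (-1) (-(-c₁ - π * m)) 0 0 (by simp) (by linarith) (hu0 0 le_rfl)
    have a4 := aff 1 (π + (-c₁ - π * m)) 1 π (by simp) (by linarith) (hu1 _)
    have := ((a1.mul hW a2).add hW (a3.mul hW a4)).const_mul hW c
    refine (this.congr (e.trans (Filter.Eventually.of_forall fun z => ?_))).mono (by simp)
    simp only
    congr 4 <;> ring
  · intro hd
    rw [hdw, abs_pos] at hd
    have hcont : ContinuousAt (fun z => z - c₁ - π * m) x := by fun_prop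
    rcases lt_or_gt_of_ne hd with hw | hw
    · refine pos (-1) (by simp) (by linarith) (e.trans ?_)
      filter_upwards [hcont.eventually_lt continuousAt_const hw] with z hz
      rw [flatExp_of_nonpos hz.le, zero_mul, zero_add]
      congr 3 <;> ring
    · refine pos 1 (by simp) (by linarith) (e.trans ?_)
      filter_upwards [continuousAt_const.eventually_lt hcont hw] with z hz
      rw [flatExp_of_nonpos (x := -(z - c₁ - π * m)) (by linarith), zero_mul, add_zero]
      congr 3 <;> ring

theorem phi0_gevrey {ν c : ℝ} (hν : 0 < ν) (hc : 0 < c) (hc' : c < 1 / 1000) :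
    ∃ L₀ > 0, ∀ L, L₀ ≤ L → ∀ c₁ x,
    (critDist c₁ x = 0 → JetBound (gevWeight L (1 + 1 / ν)) x (phi0 ν c c₁) 0) ∧
    (0 < critDist c₁ x →
      JetBound (gevWeight L (1 + 1 / ν)) x (phi0 ν c c₁) (exp (-(critDist c₁ x ^ (-ν)) / 4)) ∧
      JetBound (gevWeight L (1 + 1 / ν)) x (fun z => (sin (phi0 ν c c₁ z))⁻¹)
        (c⁻¹ * (exp 3 * exp (3 * critDist c₁ x ^ (-ν))))) := by
  obtain ⟨L₀, h0, h⟩ := sampleBump_gevrey hν hc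
  refine ⟨L₀, h0, fun L hL c₁ x => ?_⟩
  have hs : (1 : ℝ) ≤ 1 + 1 / ν := by have : 0 < 1 / ν := by positivity
                                      linarith
  have hW := gevWeight_jetWeight (h0.trans_le hL) hs
  obtain ⟨ha, hb⟩ := h L hL c₁ x
  refine ⟨fun hd => ((ha hd).arcsin hW (by norm_num)).mono (by norm_num), fun hd => ?_⟩
  obtain ⟨h1, h2, h3⟩ := hb hd
  have he : exp (-(critDist c₁ x ^ (-ν)) / 4) ≤ 1 := by
    rw [exp_le_one_iff]
    have := rpow_nonneg (critDist_nonneg c₁ x) (-ν)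
    linarith
  have hpos := exp_pos (-(critDist c₁ x ^ (-ν)) / 4)
  refine ⟨(h1.arcsin hW (by nlinarith)).mono (by nlinarith), ?_⟩
  simpa only [sin_phi0 hc hc'] using h3

theorem phi0_gevrey_one {ν c : ℝ} (hν : 0 < ν) (hc : 0 < c) (hc' : c < 1 / 1000) :
    ∃ L₀ > 0, ∀ L, L₀ ≤ L → ∀ c₁ x,
    JetBound (gevWeight L (1 + 1 / ν)) x (phi0 ν c c₁) 1 := by
  obtain ⟨L₀, h0, h⟩ := phi0_gevrey hν hc hc'
  refine ⟨L₀, h0, fun L hL c₁ x => ?_⟩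
  obtain ⟨ha, hb⟩ := h L hL c₁ x
  rcases (critDist_nonneg c₁ x).eq_or_lt with hd | hd
  · exact (ha hd.symm).mono zero_le_one
  · refine (hb hd).1.mono ?_
    rw [exp_le_one_iff]
    have := rpow_nonneg (critDist_nonneg c₁ x) (-ν)
    linarith

theorem phi0_smooth {ν c : ℝ} (hν : 0 < ν) (hc : 0 < c) (hc' : c < 1 / 1000) (c₁ : ℝ) :
    ContDiff ℝ (⊤ : ℕ∞) (phi0 ν c c₁) := by
  obtain ⟨L₀, h0, h⟩ := phi0_gevrey_one hν hc hc'
  exact contDiff_iff_contDiffAt.2 fun x => (h L₀ le_rfl c₁ x).smooth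

theorem phi0_mem {ν c : ℝ} (hc : 0 < c) (hc' : c < 1 / 1000) (c₁ x : ℝ) :
    0 ≤ phi0 ν c c₁ x ∧ phi0 ν c c₁ x ≤ 1 / 100 := by
  have h := sampleBump_mem (ν := ν) hc c₁ x
  refine ⟨arcsin_nonneg.2 h.1, ?_⟩
  have h2 := sin_phi0 (ν := ν) hc hc' c₁ x
  by_contra! h3
  have h4 : phi0 ν c c₁ x ≤ π / 2 := arcsin_le_pi_div_two _
  have h5 := mul_le_sin (arcsin_nonneg.2 h.1) h4
  have h6 := pi_lt_four
  change 2 / π * phi0 ν c c₁ x ≤ sin (phi0 ν c c₁ x) at h5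
  have h7 : 1 / 2 ≤ 2 / π := by rw [div_le_div_iff₀ (by norm_num) pi_pos]; linarith
  nlinarith

/-- The starting angle: `φ₀` near the critical set, `π / 2` away from it. -/
def baseAngle (p r δ ν c c₁ x : ℝ) : ℝ :=
  π / 2 + critCut p r δ c₁ x * (phi0 ν c c₁ x - π / 2)

theorem baseAngle_periodic (p r δ ν c c₁ : ℝ) : Function.Periodic (baseAngle p r δ ν c c₁) π :=
  fun x => by simp only [baseAngle, critCut_periodic _ _ _ _ x, phi0_periodic _ _ _ x]

theorem baseAngle_of_le {p r δ ν c c₁ x : ℝ} (hδ : 0 < δ) (h : r ≤ critDist c₁ x) :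
    baseAngle p r δ ν c c₁ x = π / 2 := by
  simp [baseAngle, critCut_eq_zero hδ h]

theorem baseAngle_of_le' {p r δ ν c c₁ x : ℝ} (hδ : 0 < δ) (h : critDist c₁ x ≤ r - δ) :
    baseAngle p r δ ν c c₁ x = phi0 ν c c₁ x := by
  simp [baseAngle, critCut_eq_one hδ h]

theorem baseAngle_mem {p r δ ν c c₁ : ℝ} (hp : 0 < p) (hc : 0 < c) (hc' : c < 1 / 1000) (x : ℝ) :
    phi0 ν c c₁ x ≤ baseAngle p r δ ν c c₁ x ∧ baseAngle p r δ ν c c₁ x ≤ π / 2 := by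
  have h1 := critCut_mem hp r δ c₁ x
  have h2 := phi0_mem (ν := ν) hc hc' c₁ x
  have h3 := pi_gt_three
  unfold baseAngle
  constructor <;> nlinarith [h1.1, h1.2, h2.1, h2.2]

theorem baseAngle_gevrey {p ν c : ℝ} (hp : 0 < p) (hν : 0 < ν) (hpν : 1 / ν > 1 / p) (hc : 0 < c)
    (hc' : c < 1 / 1000) : ∃ L₀ > 0, ∀ r δ, 0 < δ → δ < r → r ≤ 1 → ∃ L₁, L₀ ≤ L₁ ∧
    ∀ L, L₁ ≤ L → ∀ c₁ x,
    JetBound (gevWeight L (1 + 1 / ν)) x (fun z => sin (baseAngle p r δ ν c c₁ z)) 2 ∧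
    JetBound (gevWeight L (1 + 1 / ν)) x (fun z => cos (baseAngle p r δ ν c c₁ z)) 2 ∧
    (0 < critDist c₁ x →
      JetBound (gevWeight L (1 + 1 / ν)) x (fun z => (sin (baseAngle p r δ ν c c₁ z))⁻¹)
        (2 * c⁻¹ * (exp 3 * exp (3 * critDist c₁ x ^ (-ν))))) := by
  obtain ⟨La, ha0, ha⟩ := phi0_gevrey hν hc hc'
  obtain ⟨Lb, hb0, hb⟩ := phi0_gevrey_one hν hc hc'
  obtain ⟨Lc, hc0, Bc, hBc, hcut⟩ := critCut_gevrey hp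
  refine ⟨max La (max Lb Lc), by positivity, fun r δ hδ hδr hr => ?_⟩
  have hs : (1 : ℝ) ≤ 1 + 1 / ν := by have : 0 < 1 / ν := by positivity
                                      linarith
  set L₀ := max La (max Lb Lc) with hL₀
  have h0 : 0 < L₀ := by positivity
  have e1 : La ≤ L₀ := le_max_left _ _
  have e2 : Lb ≤ L₀ := (le_max_left _ _).trans (le_max_right _ _)
  have e3 : Lc ≤ L₀ := (le_max_right _ _).trans (le_max_right _ _)
  have hW0 := gevWeight_jetWeight h0 hs
  set Cχ := Bc * exp (2 * ((1 + 1 / ν - (1 + 1 / p)) * δ⁻¹ ^ (1 / (1 + 1 / ν - (1 + 1 / p))))) with hCχ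
  have hCχ0 : 0 < Cχ := by positivity
  set D := Cχ * (1 + π / 2) with hD
  have hD0 : 0 < D := by positivity
  have htail : ∀ c₁ x, JetTail (gevWeight L₀ (1 + 1 / ν)) x (baseAngle p r δ ν c c₁) D := by
    intro c₁ x
    have h1 := hcut L₀ e3 (1 + 1 / ν) (by linarith) r δ c₁ x hδ hr
    have h2 := (hb L₀ e2 c₁ x).sub hW0 (JetBound.const hW0 (π / 2))
    rw [abs_of_pos (by positivity)] at h2
    refine (((h1.mul hW0 h2).tail' hW0).add_const (π / 2)).congr
      (Filter.Eventually.of_forall fun z => ?_)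
    simp only [baseAngle]; ring
  -- uniform lower bound for the sine outside the plateau
  set m := min (1 / 4) (c * exp (-3) * exp (-3 * (r - δ) ^ (-ν)) / 8) with hm
  have hm0 : 0 < m := by positivity
  refine ⟨max L₀ (L₀ * D / m), le_max_left _ _, fun L hL c₁ x => ?_⟩
  have hLL : L₀ ≤ L := (le_max_left _ _).trans hL
  have hL0 := h0.trans_le hLL
  have hW := gevWeight_jetWeight hL0 hs
  have hη : JetTail (gevWeight L (1 + 1 / ν)) x (baseAngle p r δ ν c c₁) m := by
    refine ((htail c₁ x).gev_shrink h0 hLL).mono ?_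
    have := (le_max_right _ _).trans hL
    rw [div_le_iff₀ hm0] at this
    rw [div_mul_eq_mul_div, div_le_iff₀ hL0]; linarith
  have hm4 : m ≤ 1 / 4 := min_le_left _ _
  obtain ⟨hsin, hcos⟩ := hη.sin_cos hW (by linarith)
  refine ⟨(JetBound.of_tail hW hsin).mono ?_, (JetBound.of_tail hW hcos).mono ?_, fun hd => ?_⟩
  · linarith [abs_sin_le_one (baseAngle p r δ ν c c₁ x)]
  · linarith [abs_cos_le_one (baseAngle p r δ ν c c₁ x)]
  have hinv := ((ha L (e1.trans hLL) c₁ x).2 hd).2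
  have hC : 0 < c⁻¹ * (exp 3 * exp (3 * critDist c₁ x ^ (-ν))) := by positivity
  rcases lt_or_ge (critDist c₁ x) (r - δ) with hlt | hge
  · refine (hinv.congr ?_).mono (by linarith)
    filter_upwards [critCut_eventually_one (p := p) hδ hlt] with z hz
    simp [baseAngle, hz]
  · have hφ := phi0_mem (ν := ν) hc hc' c₁ x
    have hb' := baseAngle_mem (r := r) (δ := δ) (ν := ν) (c₁ := c₁) hp hc hc' x
    have hsle : sin (phi0 ν c c₁ x) ≤ sin (baseAngle p r δ ν c c₁ x) :=
      sin_le_sin_of_le_of_le_pi_div_two (by linarith [pi_pos]) hb'.2 hb'.1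
    have hge' : c * exp (-3) * exp (-3 * critDist c₁ x ^ (-ν)) ≤ sin (phi0 ν c c₁ x) := by
      have h1 := hinv.abs_apply_le hW
      have hne : sin (phi0 ν c c₁ x) ≠ 0 ∧ 0 ≤ sin (phi0 ν c c₁ x) := by
        obtain ⟨Ld, hd0, hdd⟩ := sampleBump_gevrey hν hc
        rw [sin_phi0 hc hc']
        have := ((hdd Ld le_rfl c₁ x).2 hd).2.1
        exact ⟨this.ne', this.le⟩
      have hpos := lt_of_le_of_ne hne.2 hne.1.symm
      rw [abs_of_pos (by positivity)] at h1
      rw [inv_le_comm₀ hpos hC] at h1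
      refine le_trans (le_of_eq ?_) h1
      rw [mul_inv, mul_inv, inv_inv, ← exp_neg, ← exp_neg, neg_mul]
      ring
    have hmono : exp (-3 * (r - δ) ^ (-ν)) ≤ exp (-3 * critDist c₁ x ^ (-ν)) := by
      rw [exp_le_exp]
      have := rpow_le_rpow_of_nonpos (sub_pos.2 hδr) hge (show -ν ≤ 0 by linarith)
      linarith
    have hpos' : 0 < c * exp (-3) * exp (-3 * critDist c₁ x ^ (-ν)) := by positivity
    have hS : 0 < sin (baseAngle p r δ ν c c₁ x) := hpos'.trans_le (hge'.trans hsle)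
    have hmS : 4 * m ≤ sin (baseAngle p r δ ν c c₁ x) / 2 := by
      have : m ≤ c * exp (-3) * exp (-3 * (r - δ) ^ (-ν)) / 8 := min_le_right _ _
      have h3 : c * exp (-3) * exp (-3 * (r - δ) ^ (-ν)) ≤
          c * exp (-3) * exp (-3 * critDist c₁ x ^ (-ν)) := by gcongr
      linarith
    have hcst : JetBound (gevWeight L (1 + 1 / ν)) x
        (fun _ => (sin (baseAngle p r δ ν c c₁ x))⁻¹) (sin (baseAngle p r δ ν c c₁ x))⁻¹ := by
      have := JetBound.const (x := x) hW (sin (baseAngle p r δ ν c c₁ x))⁻¹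
      rwa [abs_of_pos (by positivity)] at this
    have hfr : (sin (baseAngle p r δ ν c c₁ x))⁻¹ * (4 * m) ≤ 1 / 2 := by
      rw [inv_mul_le_iff₀ hS]; linarith
    have h5 := (JetBound.inv_add hW (f := fun _ => sin (baseAngle p r δ ν c c₁ x)) hS.ne'
      contDiffAt_const hcst (hsin.sub_value hW) (by linarith)).2
    simp only [add_sub_cancel] at h5
    refine h5.mono ?_
    rw [div_le_iff₀ (by linarith)]
    have h6 : (sin (baseAngle p r δ ν c c₁ x))⁻¹ ≤ c⁻¹ * (exp 3 * exp (3 * critDist c₁ x ^ (-ν))) := by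
      rw [inv_le_comm₀ hS hC]
      refine le_trans (le_of_eq ?_) (hge'.trans hsle)
      rw [mul_inv, mul_inv, inv_inv, ← exp_neg, ← exp_neg, neg_mul]
      ring
    nlinarith

/-! ### Continued fractions and recurrence of the rotation -/

/-- Integral numerators and denominators of the convergents of an irrational number. -/
theorem exists_convergents {α : ℝ} (hα : Irrational α) : ∃ A B : ℕ → ℤ,
    (∀ n, cfDen α n = B n) ∧ B 0 = 1 ∧ (∀ n, B (n + 1) + B n ≤ B (n + 2)) ∧
    (∀ n, B n ≤ B (n + 1)) ∧ (∀ n : ℕ, (n : ℤ) ≤ B n) ∧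
    (∀ n, (A n * B (n + 1) - B n * A (n + 1)) ^ 2 = 1) ∧
    ∀ n, |α - A n / B n| ≤ 1 / (B n * B (n + 1)) := by
  set g := GenContFract.of α with hg
  have hterm : ∀ n, ¬ g.TerminatedAt n := by
    intro n hn
    obtain ⟨q, hq⟩ := (GenContFract.terminates_iff_rat α).1 ⟨n, hn⟩
    exact hα ⟨q, hq.symm⟩
  have hs : ∀ n, ∃ b : ℤ, g.s.get? n = some ⟨1, (b : ℝ)⟩ ∧ 1 ≤ b := by
    intro n
    obtain ⟨gp, hgp⟩ := Option.ne_none_iff_exists'.1 (hterm n)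
    obtain ⟨h1, b, h2⟩ := GenContFract.of_partNum_eq_one_and_exists_int_partDen_eq hgp
    refine ⟨b, ?_, ?_⟩
    · rw [hgp, ← h1, ← h2]
    · have := GenContFract.of_one_le_get?_partDen (GenContFract.partDen_eq_s_b hgp)
      rw [h2] at this; exact_mod_cast this
  have hint : ∀ n, (∃ z : ℤ, g.nums n = z) ∧ (∃ z : ℤ, g.dens n = z) ∧
      (∃ z : ℤ, g.nums (n + 1) = z) ∧ (∃ z : ℤ, g.dens (n + 1) = z) := by
    intro n
    induction n with
    | zero =>
      obtain ⟨b, hb, -⟩ := hs 0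
      refine ⟨⟨⌊α⌋, ?_⟩, ⟨1, ?_⟩, ⟨b * ⌊α⌋ + 1, ?_⟩, ⟨b, ?_⟩⟩
      · rw [GenContFract.zeroth_num_eq_h, hg, GenContFract.of_h_eq_floor]
      · rw [GenContFract.zeroth_den_eq_one]; simp
      · rw [GenContFract.first_num_eq hb, hg, GenContFract.of_h_eq_floor]; push_cast; ring
      · rw [GenContFract.first_den_eq hb]
    | succ n ih =>
      obtain ⟨⟨a0, ha0⟩, ⟨b0, hb0⟩, ⟨a1, ha1⟩, ⟨b1, hb1⟩⟩ := ih
      obtain ⟨b, hb, -⟩ := hs (n + 1)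
      refine ⟨⟨a1, ha1⟩, ⟨b1, hb1⟩, ⟨b * a1 + a0, ?_⟩, ⟨b * b1 + b0, ?_⟩⟩
      · rw [GenContFract.nums_recurrence hb ha0 ha1]; push_cast; ring
      · rw [GenContFract.dens_recurrence hb hb0 hb1]; push_cast; ring
  choose A hA using fun n => (hint n).1
  choose B hB using fun n => (hint n).2.1
  have hB' : ∀ n, cfDen α n = B n := hB
  have hmono : ∀ n, B n ≤ B (n + 1) := by
    intro n
    have := GenContFract.of_den_mono (v := α) (n := n)
    rw [← hg, hB, hB] at this; exact_mod_cast this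
  have h0 : B 0 = 1 := by
    have := hB 0
    rw [GenContFract.zeroth_den_eq_one] at this
    exact_mod_cast this.symm
  have h1 : ∀ n, 1 ≤ B n := by
    intro n; induction n with
    | zero => exact h0.ge
    | succ n ih => exact ih.trans (hmono n)
  have hrec : ∀ n, B (n + 1) + B n ≤ B (n + 2) := by
    intro n
    obtain ⟨b, hb, hb1⟩ := hs (n + 1)
    have := GenContFract.dens_recurrence hb (hB n) (hB (n + 1))
    rw [hB] at this
    simp only at this
    have h2 : B (n + 2) = b * B (n + 1) + 1 * B n := by exact_mod_cast this
    nlinarith [h1 (n + 1)]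
  refine ⟨A, B, hB', h0, hrec, hmono, fun n => ?_, fun n => ?_, fun n => ?_⟩
  · have : ∀ n : ℕ, (n : ℤ) ≤ B n ∧ ((n + 1 : ℕ) : ℤ) ≤ B (n + 1) := by
      intro n; induction n with
      | zero => exact ⟨by simp [h0], by simpa using h1 1⟩
      | succ n ih =>
        refine ⟨ih.2, ?_⟩
        have h2 := hrec n
        have h3 := h1 n
        have h4 := ih.2
        push_cast at h4 ⊢
        linarith
    exact (this n).1
  · have h := SimpContFract.determinant (s := SimpContFract.of α) (n := n) (hterm n)
    change g.nums n * g.dens (n + 1) - g.dens n * g.nums (n + 1) = (-1) ^ (n + 1) at h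
    rw [hA, hB, hA, hB] at h
    have h2 : A n * B (n + 1) - B n * A (n + 1) = (-1) ^ (n + 1) := by exact_mod_cast h
    rw [h2, ← pow_mul, mul_comm, pow_mul]; norm_num
  · have h := GenContFract.abs_sub_convs_le (v := α) (n := n) (hterm n)
    rw [← hg, GenContFract.conv_eq_num_div_den, hA, hB, hB] at h
    exact h

theorem one_le_cfDen {α : ℝ} (hα : Irrational α) (n : ℕ) : 1 ≤ cfDen α n := by
  obtain ⟨A, B, hB, h0, -, hmono, -⟩ := exists_convergents hα
  rw [hB]
  have : ∀ n, 1 ≤ B n := fun n => by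
    induction n with
    | zero => exact h0.ge
    | succ n ih => exact ih.trans (hmono n)
  exact_mod_cast this n

theorem cfDen_zero (α : ℝ) : cfDen α 0 = 1 := GenContFract.zeroth_den_eq_one

theorem cfDen_mono {α : ℝ} (hα : Irrational α) : Monotone (cfDen α) := by
  obtain ⟨A, B, hB, -, -, hmono, -⟩ := exists_convergents hα
  refine monotone_nat_of_le_succ fun n => ?_
  rw [hB, hB]; exact_mod_cast hmono n

theorem natCast_le_cfDen {α : ℝ} (hα : Irrational α) (n : ℕ) : (n : ℝ) ≤ cfDen α n := by
  obtain ⟨A, B, hB, -, -, -, h, -⟩ := exists_convergents hα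
  rw [hB]; exact_mod_cast h n

theorem cfDen_add_le {α : ℝ} (hα : Irrational α) (n : ℕ) :
    cfDen α (n + 1) + cfDen α n ≤ cfDen α (n + 2) := by
  obtain ⟨A, B, hB, -, h, -⟩ := exists_convergents hα
  rw [hB, hB, hB]; exact_mod_cast h n

theorem cfDen_growth {α M : ℝ} (hα : Irrational α) (hM : 1 ≤ M) (hb : BoundedType α M) {n : ℕ}
    (hn : 1 ≤ n) : (1 + 1 / M) * cfDen α n ≤ cfDen α (n + 1) := by
  obtain ⟨k, rfl⟩ := Nat.exists_eq_add_of_le' hn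
  have h1 := cfDen_add_le hα k
  have h2 : 1 / M * cfDen α (k + 1) ≤ cfDen α k := by
    rw [div_mul_eq_mul_div, one_mul, div_le_iff₀ (by linarith), mul_comm]; exact hb k
  linarith

/-- Bounded type numbers are badly approximable. -/
theorem badly_approximable {α M : ℝ} (hα : Irrational α) (hM : 1 ≤ M) (hb : BoundedType α M)
    {k : ℤ} (hk : 0 < k) (p : ℤ) : 1 / (4 * M * k) ≤ |k * α - p| := by
  obtain ⟨A, B, hB, h0, hrec, hmono, hn, hdet, happ⟩ := exists_convergents hα
  have hex : ∃ n, 2 * k ≤ B (n + 1) := ⟨(2 * k).toNat, by have := hn ((2 * k).toNat + 1); omega⟩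
  classical
  set n := Nat.find hex
  have hn1 : 2 * k ≤ B (n + 1) := Nat.find_spec hex
  have hpos : ∀ n, 1 ≤ B n := fun n => by
    induction n with
    | zero => exact h0.ge
    | succ n ih => exact ih.trans (hmono n)
  have hn0 : B n ≤ 2 * k := by
    rcases Nat.eq_zero_or_pos n with h | h
    · rw [h, h0]; linarith
    · have := Nat.find_min hex (m := n - 1) (by omega)
      rw [Nat.sub_add_cancel h] at this
      omega
  have hkR : (0 : ℝ) < k := by exact_mod_cast hk
  have aux : ∀ j, 2 * k ≤ B (j + 1) → p * B j ≠ A j * k → 1 / (2 * (B j : ℝ)) ≤ |k * α - p| := by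
    intro j hj hne
    have hBj : (1 : ℝ) ≤ B j := by exact_mod_cast hpos j
    have hBj1 : 2 * (k : ℝ) ≤ B (j + 1) := by exact_mod_cast hj
    have h1 : (1 : ℝ) ≤ |(p * B j - A j * k : ℤ)| := by
      exact_mod_cast Int.one_le_abs (sub_ne_zero.2 hne)
    have h2 := happ j
    have h3 : |(p * B j - A j * k : ℤ)| ≤ B j * |k * α - p| + k * (B j * |α - A j / B j|) := by
      have e : ((p * B j - A j * k : ℤ) : ℝ) =
          -(B j * (k * α - p)) + k * (B j * (α - A j / B j)) := by
        push_cast; field_simp; ring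
      rw [Int.cast_abs, e]
      refine (abs_add_le _ _).trans (le_of_eq ?_)
      rw [abs_neg, abs_mul, abs_mul, abs_mul, abs_of_pos hkR, abs_of_pos (by linarith : (0:ℝ) < B j)]
    have h4 : k * (B j * |α - A j / B j|) ≤ 1 / 2 := by
      calc (k : ℝ) * (B j * |α - A j / B j|) ≤ k * (B j * (1 / (B j * B (j + 1)))) := by gcongr
        _ = k / B (j + 1) := by field_simp
        _ ≤ 1 / 2 := by rw [div_le_div_iff₀ (by linarith) (by norm_num)]; linarith
    rw [div_le_iff₀ (by linarith)]
    linarith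
  have hBn : (B n : ℝ) ≤ 2 * k := by exact_mod_cast hn0
  have hBn1 : (1 : ℝ) ≤ B n := by exact_mod_cast hpos n
  by_cases hne : p * B n ≠ A n * k
  · refine le_trans ?_ (aux n hn1 hne)
    apply one_div_le_one_div_of_le (by linarith)
    nlinarith
  · push Not at hne
    have hne' : p * B (n + 1) ≠ A (n + 1) * k := by
      intro h
      have e : k * (A n * B (n + 1) - B n * A (n + 1)) = 0 := by linear_combination B n * h - B (n + 1) * hne
      rcases mul_eq_zero.1 e with e | e
      · omega
      · have := hdet n; rw [e] at this; norm_num at this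
    refine le_trans ?_ (aux (n + 1) (hn1.trans (hmono _)) hne')
    have h5 := hb n
    rw [hB, hB] at h5
    have h6 : (1 : ℝ) ≤ B (n + 1) := by exact_mod_cast hpos _
    apply one_div_le_one_div_of_le (by linarith)
    nlinarith

/-- Every orbit segment of length comparable to `1/δ` is `δ`-dense. -/
theorem exists_orbit_near {α M : ℝ} (hα : Irrational α) (hM : 1 ≤ M) (hb : BoundedType α M)
    (y δ : ℝ) (hδ : 0 < δ) (hδ1 : δ ≤ 1) (σ : ℤ) (hσ : σ ^ 2 = 1) :
    ∃ j : ℕ, 1 ≤ j ∧ (j : ℝ) ≤ 2 * M / δ ∧ ∃ m : ℤ, |y + σ * j * α - m| ≤ δ := by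
  obtain ⟨A, B, hB, h0, hrec, hmono, hn, hdet, happ⟩ := exists_convergents hα
  have hex : ∃ n, 2 / δ ≤ B n := by
    obtain ⟨n, hn'⟩ := exists_nat_ge (2 / δ)
    exact ⟨n, hn'.trans (by exact_mod_cast hn n)⟩
  classical
  set n := Nat.find hex
  have hn1 : 2 / δ ≤ B n := Nat.find_spec hex
  have h2δ : 2 ≤ 2 / δ := by rw [le_div_iff₀ hδ]; linarith
  have hn0 : (B n : ℝ) ≤ 2 * M / δ := by
    rcases Nat.eq_zero_or_pos n with h | h
    · rw [h, h0] at hn1; norm_num at hn1; linarith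
    · have := Nat.find_min hex (m := n - 1) (by omega)
      push Not at this
      have h5 := hb (n - 1)
      rw [Nat.sub_add_cancel h, hB, hB] at h5
      rw [mul_comm 2 M, mul_div_assoc]
      exact h5.trans (mul_le_mul_of_nonneg_left this.le (by linarith))
  have hBpos : 0 < B n := by
    have : (0 : ℝ) < B n := by linarith
    exact_mod_cast this
  have hBR : (0 : ℝ) < B n := by exact_mod_cast hBpos
  set r := round (y * B n)
  -- solve the congruence `σ j Aₙ ≡ -r` modulo `Bₙ`
  set dd := A n * B (n + 1) - B n * A (n + 1)
  set a := -r * σ * (dd * B (n + 1)) with ha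
  set j := (a - 1) % B n + 1 with hj
  have hj0 : 0 ≤ (a - 1) % B n := Int.emod_nonneg _ hBpos.ne'
  have hj1 : (a - 1) % B n < B n := Int.emod_lt_of_pos _ hBpos
  have hjq : ∃ t : ℤ, j = a - B n * t := ⟨(a - 1) / B n, by
    have := Int.emod_add_mul_ediv (a - 1) (B n); rw [hj]; linarith⟩
  obtain ⟨t, ht⟩ := hjq
  have hdd : dd ^ 2 = 1 := hdet n
  obtain ⟨m, hm⟩ : ∃ m : ℤ, r + σ * j * A n = B n * m := by
    refine ⟨-r * dd * A (n + 1) - σ * A n * t, ?_⟩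
    rw [ht, ha]
    have e : dd * (A n * B (n + 1)) = 1 + dd * (B n * A (n + 1)) := by
      have : dd * dd = 1 := by rw [← sq]; exact hdd
      linear_combination this
    linear_combination (-r * (σ ^ 2)) * e + (-r - r * dd * B n * A (n + 1)) * hσ
  refine ⟨j.toNat, by omega, ?_, m, ?_⟩
  · have : ((j.toNat : ℤ) : ℝ) = j := by rw [Int.toNat_of_nonneg (by omega)]
    rw [← Int.cast_natCast, this]
    refine le_trans ?_ hn0
    exact_mod_cast (by omega : j ≤ B n)
  · have hjR : ((j.toNat : ℕ) : ℝ) = j := by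
      rw [← Int.cast_natCast, Int.toNat_of_nonneg (by omega)]
    rw [hjR]
    have hmR : (m : ℝ) = (r + σ * j * A n) / B n := by
      rw [eq_div_iff hBR.ne', mul_comm]; exact_mod_cast hm.symm
    have e : y + σ * j * α - m = (y * B n - r) / B n + σ * j * (α - A n / B n) := by
      rw [hmR]; field_simp; ring
    have hσ1 : |(σ : ℝ)| = 1 := by
      rcases mul_eq_zero.1 (show (σ - 1) * (σ + 1) = 0 by linear_combination hσ) with h | h
      · simp [show σ = 1 by omega]
      · simp [show σ = -1 by omega]
    have hjn : (0 : ℝ) ≤ j := by exact_mod_cast (by omega : 0 ≤ j)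
    have hjB : (j : ℝ) ≤ B n := by exact_mod_cast (by omega : j ≤ B n)
    have hBm : (B n : ℝ) ≤ B (n + 1) := by exact_mod_cast hmono n
    rw [e]
    refine (abs_add_le _ _).trans ?_
    have h1 : |(y * B n - r) / B n| ≤ 1 / (2 * B n) := by
      rw [abs_div, abs_of_pos hBR, div_le_div_iff₀ hBR (by linarith)]
      have := abs_sub_round (y * B n)
      nlinarith
    have h2 : |σ * j * (α - A n / B n)| ≤ 1 / B n := by
      rw [abs_mul, abs_mul, hσ1, one_mul, abs_of_nonneg hjn]
      calc (j : ℝ) * |α - A n / B n| ≤ B n * (1 / (B n * B (n + 1))) := by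
            gcongr; exact happ n
        _ = 1 / B (n + 1) := by field_simp
        _ ≤ 1 / B n := one_div_le_one_div_of_le hBR hBm
    have h3 : 1 / (2 * (B n : ℝ)) + 1 / B n ≤ 2 / B n := by
      rw [show 1 / (2 * (B n : ℝ)) = 1 / 2 / B n by field_simp, ← add_div]
      gcongr; norm_num
    have h4 : 2 / (B n : ℝ) ≤ δ := by
      rw [div_le_iff₀ hBR]; rw [div_le_iff₀ hδ] at hn1; linarith
    linarith

theorem critDist_separated {α M : ℝ} (hα : Irrational α) (hM : 1 ≤ M) (hb : BoundedType α M)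
    (c₁ x : ℝ) {j : ℕ} (hj : 1 ≤ j) :
    1 / (4 * M * j) ≤ critDist c₁ x + critDist c₁ (x + 2 * π * j * α) := by
  have h := badly_approximable hα hM hb (k := 2 * j) (by omega)
    (round ((x + 2 * π * j * α - c₁) / π) - round ((x - c₁) / π))
  set m := round ((x + 2 * π * j * α - c₁) / π) with hm
  set m' := round ((x - c₁) / π) with hm'
  have e : π * (((2 * j : ℤ) : ℝ) * α - ((m - m' : ℤ) : ℝ)) =
      (x + 2 * π * j * α - c₁ - π * m) - (x - c₁ - π * m') := by push_cast; ring
  have h1 : π * |((2 * j : ℤ) : ℝ) * α - ((m - m' : ℤ) : ℝ)| ≤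
      critDist c₁ x + critDist c₁ (x + 2 * π * j * α) := by
    rw [← abs_of_pos pi_pos, ← abs_mul, abs_of_pos pi_pos, e,
      add_comm (critDist _ _)]
    exact norm_sub_le (x + 2 * π * j * α - c₁ - π * m) (x - c₁ - π * m')
  refine le_trans ?_ h1
  have hj' : (1 : ℝ) ≤ j := by exact_mod_cast hj
  have h2 : 1 / (4 * M * ((2 * j : ℤ) : ℝ)) = 1 / (4 * M * j) / 2 := by
    push_cast; field_simp
  rw [h2] at h
  have h3 : 0 ≤ 1 / (4 * M * j) := by positivity
  nlinarith [pi_gt_three, abs_nonneg (((2 * j : ℤ) : ℝ) * α - ((m - m' : ℤ) : ℝ))]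

theorem exists_critDist_le {α M : ℝ} (hα : Irrational α) (hM : 1 ≤ M) (hb : BoundedType α M)
    (c₁ x : ℝ) {δ : ℝ} (hδ : 0 < δ) (hδ1 : δ ≤ 1) (σ : ℤ) (hσ : σ ^ 2 = 1) :
    ∃ j : ℕ, 1 ≤ j ∧ (j : ℝ) ≤ 16 * M / δ ∧ critDist c₁ (x + σ * (2 * π * j * α)) ≤ δ := by
  have hpi := pi_gt_three
  have hpi4 := pi_lt_four
  obtain ⟨j, hj1, hj2, m, hm⟩ := exists_orbit_near hα hM hb ((x - c₁) / (2 * π)) (δ / (2 * π))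
    (by positivity) (by rw [div_le_one (by positivity)]; linarith) σ hσ
  refine ⟨j, hj1, hj2.trans ?_, (critDist_le c₁ _ (2 * m)).trans ?_⟩
  · rw [div_div_eq_mul_div]
    have : 2 * M * (2 * π) ≤ 16 * M := by nlinarith
    gcongr
  · rw [le_div_iff₀ (by positivity)] at hm
    refine le_trans (le_of_eq ?_) hm
    rw [← abs_of_pos (show 0 < 2 * π by positivity), ← abs_mul]
    congr 1
    rw [abs_of_pos (show 0 < 2 * π by positivity)]
    push_cast
    field_simp
    ring

theorem exists_critDist_le_fwd {α M : ℝ} (hα : Irrational α) (hM : 1 ≤ M) (hb : BoundedType α M)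
    (c₁ x : ℝ) {δ : ℝ} (hδ : 0 < δ) (hδ1 : δ ≤ 1) :
    ∃ j : ℕ, 1 ≤ j ∧ (j : ℝ) ≤ 16 * M / δ ∧ critDist c₁ (x + 2 * π * j * α) ≤ δ := by
  simpa using exists_critDist_le hα hM hb c₁ x hδ hδ1 1 (by norm_num)

theorem exists_critDist_le_bwd {α M : ℝ} (hα : Irrational α) (hM : 1 ≤ M) (hb : BoundedType α M)
    (c₁ x : ℝ) {δ : ℝ} (hδ : 0 < δ) (hδ1 : δ ≤ 1) :
    ∃ j : ℕ, 1 ≤ j ∧ (j : ℝ) ≤ 16 * M / δ ∧ critDist c₁ (x - 2 * π * j * α) ≤ δ := by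
  simpa [sub_eq_add_neg] using exists_critDist_le hα hM hb c₁ x hδ hδ1 (-1) (by norm_num)

section

/-! ### Products of hyperbolic matrices and rotations -/

/-- The rotation `R_{π/2 - φ}`. -/
def turn (φ : ℝ → ℝ) (x : ℝ) : Matrix (Fin 2) (Fin 2) ℝ :=
  !![sin (φ x), -cos (φ x); cos (φ x), sin (φ x)]

/-- The diagonal matrix `diag(λ, λ⁻¹)`. -/
def stretch (lam : ℝ) : Matrix (Fin 2) (Fin 2) ℝ := !![lam, 0; 0, lam⁻¹]

theorem Amat_eq (lam : ℝ) (φ : ℝ → ℝ) (x : ℝ) : Amat lam φ x = stretch lam * turn φ x := by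
  simp [Amat, stretch, turn, rotM, cos_pi_div_two_sub, sin_pi_div_two_sub]

/-- The product of the cocycle along `k` steps starting at `x`, without the first rotation. -/
def segMat (lam α : ℝ) (φ : ℝ → ℝ) : ℕ → ℝ → Matrix (Fin 2) (Fin 2) ℝ
  | 0, _ => 1
  | 1, _ => stretch lam
  | k + 2, x => stretch lam * turn φ (x + 2 * π * (k + 1 : ℕ) * α) * segMat lam α φ (k + 1) x

variable {lam α : ℝ} {φ : ℝ → ℝ}

theorem segMat_one (x : ℝ) : segMat lam α φ 1 x = stretch lam := rfl

theorem segMat_succ {k : ℕ} (hk : 1 ≤ k) (x : ℝ) : segMat lam α φ (k + 1) x =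
    stretch lam * turn φ (x + 2 * π * k * α) * segMat lam α φ k x := by
  obtain ⟨k, rfl⟩ := Nat.exists_eq_add_of_le' hk
  rfl

theorem segMat_add {j k : ℕ} (hj : 1 ≤ j) (hk : 1 ≤ k) (x : ℝ) : segMat lam α φ (j + k) x =
    segMat lam α φ k (x + 2 * π * j * α) * turn φ (x + 2 * π * j * α) * segMat lam α φ j x := by
  induction k, hk using Nat.le_induction with
  | base => rw [segMat_succ hj, segMat_one]
  | succ k hk ih =>
    have e : x + 2 * π * ((j + k : ℕ) : ℝ) * α = x + 2 * π * j * α + 2 * π * k * α := by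
      push_cast; ring
    rw [← add_assoc, segMat_succ (by omega), ih, segMat_succ hk, e]
    simp only [Matrix.mul_assoc]

theorem cocycleIter_eq {k : ℕ} (hk : 1 ≤ k) (x : ℝ) :
    cocycleIter α (Amat lam φ) k x = segMat lam α φ k x * turn φ x := by
  induction k, hk using Nat.le_induction with
  | base => simp [cocycleIter, segMat_one, Amat_eq]
  | succ k hk ih => rw [cocycleIter, ih, segMat_succ hk, Amat_eq]; simp only [Matrix.mul_assoc]

theorem turn_det (φ : ℝ → ℝ) (x : ℝ) : (turn φ x).det = 1 := by
  rw [turn, Matrix.det_fin_two_of]; nlinarith [sin_sq_add_cos_sq (φ x)]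

theorem segMat_det (h : lam ≠ 0) (k : ℕ) (x : ℝ) : (segMat lam α φ k x).det = 1 := by
  have hs : (stretch lam).det = 1 := by
    rw [stretch, Matrix.det_fin_two_of, mul_inv_cancel₀ h]; ring
  induction k with
  | zero => simp [segMat]
  | succ k ih =>
    rcases Nat.eq_zero_or_pos k with rfl | hk
    · exact hs
    · rw [segMat_succ hk, Matrix.det_mul, Matrix.det_mul, hs, turn_det, ih]; norm_num

theorem segMat_det' (h : lam ≠ 0) (k : ℕ) (x : ℝ) :
    segMat lam α φ k x 0 0 * segMat lam α φ k x 1 1 -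
      segMat lam α φ k x 0 1 * segMat lam α φ k x 1 0 = 1 := by
  rw [← Matrix.det_fin_two]; exact segMat_det h k x

/-- The product depends only on the angles at interior points. -/
theorem segMat_congr {φ' : ℝ → ℝ} {k : ℕ} {x : ℝ}
    (h : ∀ j : ℕ, 0 < j → j < k → φ' (x + 2 * π * j * α) = φ (x + 2 * π * j * α)) :
    segMat lam α φ' k x = segMat lam α φ k x := by
  induction k with
  | zero => rfl
  | succ k ih =>
    rcases Nat.eq_zero_or_pos k with rfl | hk
    · rfl
    · rw [segMat_succ hk, segMat_succ hk, ih fun j h0 hj => h j h0 (by omega), turn, turn,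
        h k hk (by omega)]

theorem segMat_eventuallyEq {φ' : ℝ → ℝ} {k : ℕ} {x : ℝ}
    (h : ∀ j : ℕ, 0 < j → j < k → φ' =ᶠ[nhds (x + 2 * π * j * α)] φ) :
    segMat lam α φ' k =ᶠ[nhds x] segMat lam α φ k := by
  have : ∀ᶠ z in nhds x, ∀ j ∈ Finset.Ioo 0 k,
      φ' (z + 2 * π * j * α) = φ (z + 2 * π * j * α) := by
    rw [Filter.eventually_all_finset]
    intro j hj
    rw [Finset.mem_Ioo] at hj
    have hc : Filter.Tendsto (fun z => z + 2 * π * j * α) (nhds x) (nhds (x + 2 * π * j * α)) :=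
      (continuous_id.add continuous_const).tendsto x
    exact hc.eventually (h j hj.1 hj.2)
  filter_upwards [this] with z hz
  exact segMat_congr fun j h0 hj => hz j (Finset.mem_Ioo.2 ⟨h0, hj⟩)

theorem segMat_of_trivial {k : ℕ} (hk : 1 ≤ k) {x : ℝ}
    (h : ∀ j : ℕ, 0 < j → j < k → φ (x + 2 * π * j * α) = π / 2) :
    segMat lam α φ k x = !![lam ^ k, 0; 0, lam⁻¹ ^ k] := by
  induction k, hk using Nat.le_induction with
  | base => simp [segMat_one, stretch]
  | succ k hk ih =>
    rw [segMat_succ hk, ih fun j h0 hj => h j h0 (by omega), turn, h k (by omega) (by omega), stretch]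
    simp [pow_succ, mul_comm]

/-- Inverse of the expanding entry. -/
def segInv (lam α : ℝ) (φ : ℝ → ℝ) (k : ℕ) (z : ℝ) : ℝ := (segMat lam α φ k z 0 0)⁻¹

/-- Slope of the image of the first basis vector. -/
def segT (lam α : ℝ) (φ : ℝ → ℝ) (k : ℕ) (z : ℝ) : ℝ :=
  segMat lam α φ k z 1 0 * segInv lam α φ k z

/-- Slope (with respect to the second axis) of the preimage of the second basis vector. -/
def segS (lam α : ℝ) (φ : ℝ → ℝ) (k : ℕ) (z : ℝ) : ℝ :=
  -segMat lam α φ k z 0 1 * segInv lam α φ k z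

/-- Transversality of the incoming slope `t` and outgoing slope `s` at angle `θ`. -/
def cross (θ t s : ℝ) : ℝ := sin θ - t * cos θ - s * (cos θ + t * sin θ)

theorem segMat_add_zero_zero {j k : ℕ} (hj : 1 ≤ j) (hk : 1 ≤ k) {x : ℝ}
    (h1 : segMat lam α φ j x 0 0 ≠ 0) (h2 : segMat lam α φ k (x + 2 * π * j * α) 0 0 ≠ 0) :
    segMat lam α φ (j + k) x 0 0 = segMat lam α φ k (x + 2 * π * j * α) 0 0 *
      cross (φ (x + 2 * π * j * α)) (segT lam α φ j x) (segS lam α φ k (x + 2 * π * j * α)) *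
      segMat lam α φ j x 0 0 := by
  rw [segMat_add hj hk]
  simp only [Matrix.mul_apply, Fin.sum_univ_two, turn, cross, segT, segS, segInv, Matrix.of_apply,
    Matrix.cons_val', Matrix.cons_val_zero, Matrix.cons_val_one, Matrix.cons_val_fin_one]
  field_simp
  ring

theorem segT_add (h : lam ≠ 0) {j k : ℕ} (hj : 1 ≤ j) (hk : 1 ≤ k) {x : ℝ}
    (h1 : segMat lam α φ j x 0 0 ≠ 0) (h2 : segMat lam α φ k (x + 2 * π * j * α) 0 0 ≠ 0)
    (h3 : cross (φ (x + 2 * π * j * α)) (segT lam α φ j x)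
      (segS lam α φ k (x + 2 * π * j * α)) ≠ 0) :
    segT lam α φ (j + k) x = segT lam α φ k (x + 2 * π * j * α) +
      segInv lam α φ k (x + 2 * π * j * α) ^ 2 *
      (cos (φ (x + 2 * π * j * α)) + segT lam α φ j x * sin (φ (x + 2 * π * j * α))) *
      (cross (φ (x + 2 * π * j * α)) (segT lam α φ j x)
        (segS lam α φ k (x + 2 * π * j * α)))⁻¹ := by
  have e0 := segMat_add_zero_zero (φ := φ) (α := α) (lam := lam) hj hk h1 h2
  have hd := segMat_det' (α := α) (φ := φ) h k (x + 2 * π * j * α)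
  have e1 : segMat lam α φ (j + k) x 1 0 * segInv lam α φ j x =
      segMat lam α φ k (x + 2 * π * j * α) 1 0 *
        (sin (φ (x + 2 * π * j * α)) - cos (φ (x + 2 * π * j * α)) * segT lam α φ j x) +
      segMat lam α φ k (x + 2 * π * j * α) 1 1 *
        (cos (φ (x + 2 * π * j * α)) + sin (φ (x + 2 * π * j * α)) * segT lam α φ j x) := by
    rw [segMat_add hj hk]
    simp only [Matrix.mul_apply, Fin.sum_univ_two, turn, segT, segInv, Matrix.of_apply,
      Matrix.cons_val', Matrix.cons_val_zero, Matrix.cons_val_one, Matrix.cons_val_fin_one]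
    field_simp
    ring
  have e2 : segT lam α φ (j + k) x = (segMat lam α φ (j + k) x 1 0 * segInv lam α φ j x) *
      segInv lam α φ k (x + 2 * π * j * α) * (cross (φ (x + 2 * π * j * α)) (segT lam α φ j x)
        (segS lam α φ k (x + 2 * π * j * α)))⁻¹ := by
    conv_lhs => rw [segT, segInv, e0]
    simp only [segInv, mul_inv]
    ring
  rw [e2, e1]
  have e3 : segT lam α φ k (x + 2 * π * j * α) = segT lam α φ k (x + 2 * π * j * α) *
      cross (φ (x + 2 * π * j * α)) (segT lam α φ j x) (segS lam α φ k (x + 2 * π * j * α)) *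
      (cross (φ (x + 2 * π * j * α)) (segT lam α φ j x)
        (segS lam α φ k (x + 2 * π * j * α)))⁻¹ := by rw [mul_inv_cancel_right₀ h3]
  rw [e3]
  generalize (cross (φ (x + 2 * π * j * α)) (segT lam α φ j x)
        (segS lam α φ k (x + 2 * π * j * α)))⁻¹ = q
  simp only [cross]
  rw [show segT lam α φ k (x + 2 * π * j * α) = segMat lam α φ k (x + 2 * π * j * α) 1 0 *
    segInv lam α φ k (x + 2 * π * j * α) from rfl, show segS lam α φ k (x + 2 * π * j * α) =
    -segMat lam α φ k (x + 2 * π * j * α) 0 1 * segInv lam α φ k (x + 2 * π * j * α) from rfl]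
  generalize segT lam α φ j x = t
  simp only [segInv]
  field_simp
  linear_combination q * (cos (φ (x + 2 * π * j * α)) + t * sin (φ (x + 2 * π * j * α))) * hd

theorem segS_add (h : lam ≠ 0) {j k : ℕ} (hj : 1 ≤ j) (hk : 1 ≤ k) {x : ℝ}
    (h1 : segMat lam α φ j x 0 0 ≠ 0) (h2 : segMat lam α φ k (x + 2 * π * j * α) 0 0 ≠ 0)
    (h3 : cross (φ (x + 2 * π * j * α)) (segT lam α φ j x)
      (segS lam α φ k (x + 2 * π * j * α)) ≠ 0) :
    segS lam α φ (j + k) x = segS lam α φ j x + segInv lam α φ j x ^ 2 *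
      (cos (φ (x + 2 * π * j * α)) +
        segS lam α φ k (x + 2 * π * j * α) * sin (φ (x + 2 * π * j * α))) *
      (cross (φ (x + 2 * π * j * α)) (segT lam α φ j x)
        (segS lam α φ k (x + 2 * π * j * α)))⁻¹ := by
  have e0 := segMat_add_zero_zero (φ := φ) (α := α) (lam := lam) hj hk h1 h2
  have hd := segMat_det' (α := α) (φ := φ) h j x
  have e1 : segMat lam α φ (j + k) x 0 1 * segInv lam α φ k (x + 2 * π * j * α) =
      (sin (φ (x + 2 * π * j * α)) - segS lam α φ k (x + 2 * π * j * α) *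
        cos (φ (x + 2 * π * j * α))) * segMat lam α φ j x 0 1 -
      (cos (φ (x + 2 * π * j * α)) + segS lam α φ k (x + 2 * π * j * α) *
        sin (φ (x + 2 * π * j * α))) * segMat lam α φ j x 1 1 := by
    rw [segMat_add hj hk]
    simp only [Matrix.mul_apply, Fin.sum_univ_two, turn, segS, segInv, Matrix.of_apply,
      Matrix.cons_val', Matrix.cons_val_zero, Matrix.cons_val_one, Matrix.cons_val_fin_one]
    field_simp
    ring
  have e2 : segS lam α φ (j + k) x = -(segMat lam α φ (j + k) x 0 1 *
      segInv lam α φ k (x + 2 * π * j * α)) * segInv lam α φ j x *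
      (cross (φ (x + 2 * π * j * α)) (segT lam α φ j x)
        (segS lam α φ k (x + 2 * π * j * α)))⁻¹ := by
    conv_lhs => rw [segS, segInv, e0]
    simp only [segInv, mul_inv]
    ring
  rw [e2, e1]
  have e3 : segS lam α φ j x = segS lam α φ j x *
      cross (φ (x + 2 * π * j * α)) (segT lam α φ j x) (segS lam α φ k (x + 2 * π * j * α)) *
      (cross (φ (x + 2 * π * j * α)) (segT lam α φ j x)
        (segS lam α φ k (x + 2 * π * j * α)))⁻¹ := by rw [mul_inv_cancel_right₀ h3]
  rw [e3]
  generalize (cross (φ (x + 2 * π * j * α)) (segT lam α φ j x)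
        (segS lam α φ k (x + 2 * π * j * α)))⁻¹ = q
  simp only [cross]
  rw [show segT lam α φ j x = segMat lam α φ j x 1 0 * segInv lam α φ j x from rfl,
    show segS lam α φ j x = -segMat lam α φ j x 0 1 * segInv lam α φ j x from rfl]
  generalize segS lam α φ k (x + 2 * π * j * α) = s
  simp only [segInv]
  field_simp
  linear_combination q * (cos (φ (x + 2 * π * j * α)) + s * sin (φ (x + 2 * π * j * α))) * hd

/-- Comparison of two products with the same endpoint. -/
theorem segT_sub (h : lam ≠ 0) {m r : ℕ} (hm : 1 ≤ m) (hr : 1 ≤ r) {x : ℝ}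
    (h1 : segMat lam α φ (m + r) x 0 0 ≠ 0) (h2 : segMat lam α φ r (x + 2 * π * m * α) 0 0 ≠ 0) :
    segT lam α φ (m + r) x - segT lam α φ r (x + 2 * π * m * α) =
      (turn φ (x + 2 * π * m * α) * segMat lam α φ m x) 1 0 *
        (segInv lam α φ r (x + 2 * π * m * α) * segInv lam α φ (m + r) x) := by
  have hd := segMat_det' (α := α) (φ := φ) h r (x + 2 * π * m * α)
  have e : ∀ i, segMat lam α φ (m + r) x i 0 = segMat lam α φ r (x + 2 * π * m * α) i 0 *
      (turn φ (x + 2 * π * m * α) * segMat lam α φ m x) 0 0 +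
      segMat lam α φ r (x + 2 * π * m * α) i 1 *
      (turn φ (x + 2 * π * m * α) * segMat lam α φ m x) 1 0 := by
    intro i
    rw [segMat_add hm hr, Matrix.mul_assoc, Matrix.mul_apply, Fin.sum_univ_two]
  simp only [segT, segInv]
  field_simp
  rw [e 0, e 1]
  linear_combination ((turn φ (x + 2 * π * m * α) * segMat lam α φ m x) 1 0) * hd

/-- Comparison of two products with the same starting point. -/
theorem segS_sub (h : lam ≠ 0) {m r : ℕ} (hm : 1 ≤ m) (hr : 1 ≤ r) {x : ℝ}
    (h1 : segMat lam α φ (r + m) x 0 0 ≠ 0) (h2 : segMat lam α φ r x 0 0 ≠ 0) :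
    segS lam α φ (r + m) x - segS lam α φ r x =
      -(segMat lam α φ m (x + 2 * π * r * α) * turn φ (x + 2 * π * r * α)) 0 1 *
        (segInv lam α φ r x * segInv lam α φ (r + m) x) := by
  have hd := segMat_det' (α := α) (φ := φ) h r x
  have e : ∀ i, segMat lam α φ (r + m) x 0 i =
      (segMat lam α φ m (x + 2 * π * r * α) * turn φ (x + 2 * π * r * α)) 0 0 *
        segMat lam α φ r x 0 i +
      (segMat lam α φ m (x + 2 * π * r * α) * turn φ (x + 2 * π * r * α)) 0 1 *
        segMat lam α φ r x 1 i := by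
    intro i
    rw [segMat_add hr hm, Matrix.mul_apply, Fin.sum_univ_two]
  simp only [segS, segInv]
  field_simp
  rw [e 0, e 1]
  linear_combination
    (-(segMat lam α φ m (x + 2 * π * r * α) * turn φ (x + 2 * π * r * α)) 0 1) * hd

theorem cross_mul_cos (θ t s : ℝ) :
    cross θ t s * (cos (arctan t) * cos (arctan s)) = sin (θ - arctan t - arctan s) := by
  have ht : sin (arctan t) = t * cos (arctan t) := by
    rw [sin_arctan, cos_arctan]; ring
  have hs : sin (arctan s) = s * cos (arctan s) := by
    rw [sin_arctan, cos_arctan]; ring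
  rw [sin_sub, sin_sub, cos_sub, ht, hs, cross]
  ring

end

section

variable {W : ℕ → ℝ} {ℓ α A ν : ℝ} {φ : ℝ → ℝ} {k : ℕ} {x : ℝ}

/-- Uniform hyperbolicity of the product of length `k` from `x`, in terms of jets at `x`. -/
structure SegBound (W : ℕ → ℝ) (ℓ α : ℝ) (φ : ℝ → ℝ) (A ν : ℝ) (k : ℕ) (x : ℝ) : Prop where
  ne : segMat (exp ℓ) α φ k x 0 0 ≠ 0
  inv : JetBound W x (segInv (exp ℓ) α φ k) (exp (-(k * ℓ) + A * k - A * (k : ℝ) ^ ν))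
  fwd : JetBound W x (segT (exp ℓ) α φ k) ((1 - (1 / 2) ^ k) / 10)
  bwd : JetBound W x (segS (exp ℓ) α φ k) ((1 - (1 / 2) ^ k) / 10)

/-- Bounds on the angle function by trigonometric jets. -/
def TrigBound (W : ℕ → ℝ) (φ : ℝ → ℝ) : Prop :=
  ∀ x, JetBound W x (fun z => sin (φ z)) 8 ∧ JetBound W x (fun z => cos (φ z)) 8

namespace SegBound

theorem inv' (h : SegBound W ℓ α φ A ν k x) (hA : 0 ≤ A) :
    JetBound W x (segInv (exp ℓ) α φ k) (exp (-(k * ℓ) + A * k)) :=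
  h.inv.mono (exp_le_exp.2 (by
    have : 0 ≤ A * (k : ℝ) ^ ν := by positivity
    linarith))

theorem fwd' (h : SegBound W ℓ α φ A ν k x) : JetBound W x (segT (exp ℓ) α φ k) (1 / 10) :=
  h.fwd.mono (by
    have : (0 : ℝ) ≤ (1 / 2) ^ k := by positivity
    linarith)

theorem bwd' (h : SegBound W ℓ α φ A ν k x) : JetBound W x (segS (exp ℓ) α φ k) (1 / 10) :=
  h.bwd.mono (by
    have : (0 : ℝ) ≤ (1 / 2) ^ k := by positivity
    linarith)

theorem congr {φ' : ℝ → ℝ} (h : SegBound W ℓ α φ A ν k x)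
    (he : ∀ j : ℕ, 0 < j → j < k → φ' =ᶠ[nhds (x + 2 * π * j * α)] φ) :
    SegBound W ℓ α φ' A ν k x := by
  have e := segMat_eventuallyEq (lam := exp ℓ) he
  have e1 : segInv (exp ℓ) α φ' k =ᶠ[nhds x] segInv (exp ℓ) α φ k := by
    filter_upwards [e] with z hz
    simp only [segInv, hz]
  refine ⟨by rw [e.eq_of_nhds]; exact h.ne, h.inv.congr e1, h.fwd.congr ?_, h.bwd.congr ?_⟩
  · filter_upwards [e, e1] with z hz hz'
    simp only [segT, hz, hz']
  · filter_upwards [e, e1] with z hz hz'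
    simp only [segS, hz, hz']

theorem of_trivial (hW : JetWeight W) (hA : 0 ≤ A) (hν : ν ≤ 1) (hk : 1 ≤ k)
    (h : ∀ j : ℕ, 0 < j → j < k → φ =ᶠ[nhds (x + 2 * π * j * α)] fun _ => π / 2) :
    SegBound W ℓ α φ A ν k x := by
  have hm : ∀ z, segMat (exp ℓ) α (fun _ => π / 2) k z = !![exp ℓ ^ k, 0; 0, (exp ℓ)⁻¹ ^ k] :=
    fun z => segMat_of_trivial hk fun j _ _ => rfl
  have h0 : (0 : ℝ) ≤ (1 - (1 / 2) ^ k) / 10 := by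
    have : ((1 : ℝ) / 2) ^ k ≤ 1 := pow_le_one₀ (by norm_num) (by norm_num)
    linarith
  refine congr (φ := fun _ => π / 2) ⟨by simp [hm], ?_, ?_, ?_⟩ h
  · have e : segInv (exp ℓ) α (fun _ => π / 2) k = fun _ => exp (-(k * ℓ)) := by
      funext z; simp [segInv, hm, ← exp_nat_mul, exp_neg]
    rw [e]
    refine (JetBound.const hW _).mono ?_
    rw [abs_of_pos (exp_pos _), exp_le_exp]
    have hk1 : (1 : ℝ) ≤ k := by exact_mod_cast hk
    have : (k : ℝ) ^ ν ≤ k := by simpa using rpow_le_rpow_of_exponent_le hk1 hν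
    nlinarith
  · have e : segT (exp ℓ) α (fun _ => π / 2) k = fun _ => 0 := by
      funext z; simp [segT, hm]
    rw [e]
    exact (JetBound.const hW _).mono (by simpa using h0)
  · have e : segS (exp ℓ) α (fun _ => π / 2) k = fun _ => 0 := by
      funext z; simp [segS, hm]
    rw [e]
    exact (JetBound.const hW _).mono (by simpa using h0)

end SegBound

theorem turn_bound (hφ : TrigBound W φ) (x : ℝ) (i j : Fin 2) :
    JetBound W x (fun z => turn φ z i j) 8 := by
  have h := hφ x
  fin_cases i <;> fin_cases j
  · exact h.1
  · exact h.2.neg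
  · exact h.2
  · exact h.1

theorem JetBound.matrix_mul (hW : JetWeight W) {P Q : ℝ → Matrix (Fin 2) (Fin 2) ℝ} {B B' : ℝ}
    (hP : ∀ i j, JetBound W x (fun z => P z i j) B)
    (hQ : ∀ i j, JetBound W x (fun z => Q z i j) B') (i j : Fin 2) :
    JetBound W x (fun z => (P z * Q z) i j) (2 * B * B') := by
  simp only [Matrix.mul_apply, Fin.sum_univ_two]
  exact (((hP i 0).mul hW (hQ 0 j)).add hW ((hP i 1).mul hW (hQ 1 j))).mono (by linarith)

theorem stretch_mul_bound (hW : JetWeight W) (hℓ : 0 ≤ ℓ) {P : ℝ → Matrix (Fin 2) (Fin 2) ℝ}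
    {B : ℝ} (hP : ∀ i j, JetBound W x (fun z => P z i j) B) (i j : Fin 2) :
    JetBound W x (fun z => (stretch (exp ℓ) * P z) i j) (exp ℓ * B) := by
  have hB := (hP 0 0).nonneg
  have h1 : (exp ℓ)⁻¹ ≤ exp ℓ := by rw [← exp_neg]; exact exp_le_exp.2 (by linarith)
  simp only [Matrix.mul_apply, Fin.sum_univ_two, stretch]
  fin_cases i
  · simpa [abs_of_pos (exp_pos ℓ)] using (hP 0 j).const_mul hW (exp ℓ)
  · have := (hP 1 j).const_mul hW (exp ℓ)⁻¹
    rw [abs_of_pos (inv_pos.2 (exp_pos ℓ))] at this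
    simpa using this.mono (mul_le_mul_of_nonneg_right h1 hB)

theorem segMat_bound (hW : JetWeight W) (hℓ : 0 ≤ ℓ) (hφ : TrigBound W φ) (hk : 1 ≤ k) (x : ℝ)
    (i j : Fin 2) :
    JetBound W x (fun z => segMat (exp ℓ) α φ k z i j) ((16 * exp ℓ) ^ k / 16) := by
  induction k, hk using Nat.le_induction generalizing x i j with
  | base =>
    simp only [segMat_one, stretch]
    have h1 : (exp ℓ)⁻¹ ≤ exp ℓ := by rw [← exp_neg]; exact exp_le_exp.2 (by linarith)
    have h2 := exp_pos ℓ
    refine (JetBound.const hW _).mono ?_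
    fin_cases i <;> fin_cases j <;> simp [h1, h2.le]
  | succ k hk ih =>
    have h1 : ∀ i j, JetBound W x (fun z => turn φ (z + 2 * π * k * α) i j) 8 := fun i j =>
      (turn_bound hφ (x + 2 * π * k * α) i j).comp_add_const (2 * π * k * α)
    have h2 := stretch_mul_bound hW hℓ (JetBound.matrix_mul hW h1 (ih x)) i j
    simp only [← Matrix.mul_assoc] at h2
    simp only [segMat_succ hk]
    exact h2.mono (le_of_eq (by ring))

theorem sixteen_exp_pow_le (ℓ : ℝ) (m : ℕ) : (16 * exp ℓ) ^ m ≤ exp (m * ℓ + 3 * m) := by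
  have h : (16 : ℝ) ≤ exp 3 := by
    have := exp_one_gt_d9
    calc (16 : ℝ) ≤ 2.7 ^ 3 := by norm_num
      _ ≤ exp 1 ^ 3 := by gcongr; linarith
      _ = exp 3 := by rw [← exp_nat_mul]; norm_num
  calc (16 * exp ℓ) ^ m ≤ (exp 3 * exp ℓ) ^ m := by gcongr
    _ = exp (m * ℓ + 3 * m) := by rw [← exp_add, ← exp_nat_mul]; congr 1; ring

variable {m r : ℕ}

theorem exp_compare (hA : 0 ≤ A) {a b d : ℝ} (hd : 0 < d) (ha : a / d ≤ r) (hb : (m + r : ℕ) ≤ b / d)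
    (hℓ : 2 * (A + 3) * b ≤ a * ℓ) (hℓ0 : 0 ≤ ℓ) :
    exp (m * ℓ + 3 * m) * (exp (-(r * ℓ) + A * r) * exp (-((m + r : ℕ) * ℓ) + A * (m + r : ℕ))) ≤
      exp (-(a * ℓ / d)) := by
  rw [← exp_add, ← exp_add, exp_le_exp]
  push_cast at hb ⊢
  have h1 : a * ℓ / d ≤ r * ℓ := by
    rw [mul_div_right_comm]; exact mul_le_mul_of_nonneg_right ha hℓ0
  have h2 : 2 * (A + 3) * (m + r) ≤ a * ℓ / d := by
    rw [le_div_iff₀ hd]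
    rw [le_div_iff₀ hd] at hb
    nlinarith
  have hm : (0 : ℝ) ≤ m := m.cast_nonneg
  have hr : (0 : ℝ) ≤ r := r.cast_nonneg
  nlinarith [mul_nonneg hA hm]

/-- Two products ending at `y` have almost the same image direction. -/
theorem segT_compare_of_lt (hW : JetWeight W) (hℓ0 : 0 ≤ ℓ) (hA : 0 ≤ A) (hφ : TrigBound W φ)
    {a b d y : ℝ} (hd : 0 < d) (hℓ : 2 * (A + 3) * b ≤ a * ℓ) (hm : 1 ≤ m) (hr : 1 ≤ r)
    (h1 : SegBound W ℓ α φ A ν (m + r) (y - 2 * π * (m + r : ℕ) * α))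
    (h2 : SegBound W ℓ α φ A ν r (y - 2 * π * r * α)) (ha : a / d ≤ r) (hb : (m + r : ℕ) ≤ b / d) :
    JetBound W y (fun w => segT (exp ℓ) α φ (m + r) (w - 2 * π * (m + r : ℕ) * α) -
      segT (exp ℓ) α φ r (w - 2 * π * r * α)) (exp (-(a * ℓ / d))) := by
  set x := y - 2 * π * (m + r : ℕ) * α with hx
  have ex : y - 2 * π * r * α = x + 2 * π * m * α := by rw [hx]; push_cast; ring
  rw [ex] at h2
  have key : JetBound W x (fun z => segT (exp ℓ) α φ (m + r) z -
      segT (exp ℓ) α φ r (z + 2 * π * m * α)) (exp (-(a * ℓ / d))) := by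
    have n1 := h1.inv.smooth
    have hB : JetBound W x (fun z => (turn φ (z + 2 * π * m * α) * segMat (exp ℓ) α φ m z) 1 0 *
        (segInv (exp ℓ) α φ r (z + 2 * π * m * α) * segInv (exp ℓ) α φ (m + r) z))
        (exp (-(a * ℓ / d))) := by
      refine ((JetBound.matrix_mul hW (fun i j => (turn_bound hφ _ i j).comp_add_const _)
        (segMat_bound hW hℓ0 hφ hm x) 1 0).mul hW
          (((h2.inv' hA).comp_add_const _).mul hW (h1.inv' hA))).mono ?_
      refine le_trans ?_ (exp_compare hA hd ha hb hℓ hℓ0)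
      refine mul_le_mul_of_nonneg_right ?_ (by positivity)
      linarith [sixteen_exp_pow_le ℓ m]
    refine hB.congr ?_
    have c1 : ContinuousAt (fun z => segMat (exp ℓ) α φ (m + r) z 0 0) x :=
      (segMat_bound hW hℓ0 hφ (by omega) x 0 0).smooth.continuousAt
    have c2 : ContinuousAt (fun z => segMat (exp ℓ) α φ r (z + 2 * π * m * α) 0 0) x :=
      ((segMat_bound hW hℓ0 hφ hr _ 0 0).comp_add_const (2 * π * m * α)).smooth.continuousAt
    filter_upwards [c1.eventually_ne h1.ne, c2.eventually_ne h2.ne] with z e1 e2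
    exact segT_sub (exp_pos ℓ).ne' hm hr e1 e2
  have := JetBound.comp_add_const (x := y) (-(2 * π * (m + r : ℕ) * α))
    (by rw [← sub_eq_add_neg]; exact key)
  refine this.congr (Filter.Eventually.of_forall fun w => ?_)
  simp only [← sub_eq_add_neg]
  congr 2
  push_cast; ring

/-- Two products starting at `y` have almost the same contracted direction. -/
theorem segS_compare_of_lt (hW : JetWeight W) (hℓ0 : 0 ≤ ℓ) (hA : 0 ≤ A) (hφ : TrigBound W φ)
    {a b d y : ℝ} (hd : 0 < d) (hℓ : 2 * (A + 3) * b ≤ a * ℓ) (hm : 1 ≤ m) (hr : 1 ≤ r)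
    (h1 : SegBound W ℓ α φ A ν (m + r) y) (h2 : SegBound W ℓ α φ A ν r y)
    (ha : a / d ≤ r) (hb : (m + r : ℕ) ≤ b / d) :
    JetBound W y (fun w => segS (exp ℓ) α φ (m + r) w - segS (exp ℓ) α φ r w)
      (exp (-(a * ℓ / d))) := by
  have hB : JetBound W y (fun z => -(segMat (exp ℓ) α φ m (z + 2 * π * r * α) *
      turn φ (z + 2 * π * r * α)) 0 1 * (segInv (exp ℓ) α φ r z * segInv (exp ℓ) α φ (m + r) z))
      (exp (-(a * ℓ / d))) := by
    refine ((JetBound.matrix_mul hW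
      (fun i j => (segMat_bound hW hℓ0 hφ hm _ i j).comp_add_const _)
      (fun i j => (turn_bound hφ _ i j).comp_add_const _) 0 1).neg.mul hW
        ((h2.inv' hA).mul hW (h1.inv' hA))).mono ?_
    refine le_trans ?_ (exp_compare hA hd ha hb hℓ hℓ0)
    refine mul_le_mul_of_nonneg_right ?_ (by positivity)
    linarith [sixteen_exp_pow_le ℓ m]
  refine hB.congr ?_
  have c1 : ContinuousAt (fun z => segMat (exp ℓ) α φ (m + r) z 0 0) y :=
    (segMat_bound hW hℓ0 hφ (by omega) y 0 0).smooth.continuousAt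
  have c2 : ContinuousAt (fun z => segMat (exp ℓ) α φ r z 0 0) y :=
    (segMat_bound hW hℓ0 hφ hr _ 0 0).smooth.continuousAt
  filter_upwards [c1.eventually_ne h1.ne, c2.eventually_ne h2.ne] with z e1 e2
  have := segS_sub (exp_pos ℓ).ne' hm hr (x := z) (φ := φ) (α := α) (by rwa [add_comm r m]) e2
  rwa [add_comm r m] at this

theorem segT_compare (hW : JetWeight W) (hℓ0 : 0 ≤ ℓ) (hA : 0 ≤ A) (hφ : TrigBound W φ)
    {a b d y : ℝ} (hd : 0 < d) (hℓ : 2 * (A + 3) * b ≤ a * ℓ) (hk : 1 ≤ k) (hr : 1 ≤ r)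
    (h1 : SegBound W ℓ α φ A ν k (y - 2 * π * k * α))
    (h2 : SegBound W ℓ α φ A ν r (y - 2 * π * r * α)) (ha : a / d ≤ r) (hb : r ≤ b / d)
    (ha' : a / d ≤ k) (hb' : k ≤ b / d) :
    JetBound W y (fun w => segT (exp ℓ) α φ k (w - 2 * π * k * α) -
      segT (exp ℓ) α φ r (w - 2 * π * r * α)) (exp (-(a * ℓ / d))) := by
  rcases lt_trichotomy k r with h | rfl | h
  · obtain ⟨m, rfl⟩ := Nat.exists_eq_add_of_le' h.le
    have := (segT_compare_of_lt hW hℓ0 hA hφ hd hℓ (by omega) hk h2 h1 ha' hb).neg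
    simpa using this
  · simpa using (JetBound.const hW 0 (x := y)).mono (by simpa using (exp_pos _).le)
  · obtain ⟨m, rfl⟩ := Nat.exists_eq_add_of_le' h.le
    exact segT_compare_of_lt hW hℓ0 hA hφ hd hℓ (by omega) hr h1 h2 ha hb'

theorem segS_compare (hW : JetWeight W) (hℓ0 : 0 ≤ ℓ) (hA : 0 ≤ A) (hφ : TrigBound W φ)
    {a b d y : ℝ} (hd : 0 < d) (hℓ : 2 * (A + 3) * b ≤ a * ℓ) (hk : 1 ≤ k) (hr : 1 ≤ r)
    (h1 : SegBound W ℓ α φ A ν k y) (h2 : SegBound W ℓ α φ A ν r y)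
    (ha : a / d ≤ r) (hb : r ≤ b / d) (ha' : a / d ≤ k) (hb' : k ≤ b / d) :
    JetBound W y (fun w => segS (exp ℓ) α φ k w - segS (exp ℓ) α φ r w) (exp (-(a * ℓ / d))) := by
  rcases lt_trichotomy k r with h | rfl | h
  · obtain ⟨m, rfl⟩ := Nat.exists_eq_add_of_le' h.le
    have := (segS_compare_of_lt hW hℓ0 hA hφ hd hℓ (by omega) hk h2 h1 ha' hb).neg
    simpa using this
  · simpa using (JetBound.const hW 0 (x := y)).mono (by simpa using (exp_pos _).le)
  · obtain ⟨m, rfl⟩ := Nat.exists_eq_add_of_le' h.le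
    exact segS_compare_of_lt hW hℓ0 hA hφ hd hℓ (by omega) hr h1 h2 ha hb'

end

section

variable {W : ℕ → ℝ} {ℓ α A ν c₁ Cp cr Cr : ℝ} {φ : ℝ → ℝ} {k j : ℕ} {x y : ℝ}

/-- Quantitative transversality at `y`, witnessed by products of length comparable to the inverse
distance to the critical set. -/
def PivotBound (W : ℕ → ℝ) (ℓ α : ℝ) (φ : ℝ → ℝ) (A ν c₁ Cp cr Cr y : ℝ) : Prop :=
  ∃ r s : ℕ, 1 ≤ r ∧ 1 ≤ s ∧ cr / critDist c₁ y ≤ r ∧ r ≤ Cr / critDist c₁ y ∧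
    cr / critDist c₁ y ≤ s ∧ s ≤ Cr / critDist c₁ y ∧
    (∀ i : ℕ, 0 < i → i < r → critDist c₁ y ≤ critDist c₁ (y + 2 * π * i * α)) ∧
    (∀ i : ℕ, 0 < i → i < s → critDist c₁ y ≤ critDist c₁ (y - 2 * π * i * α)) ∧
    SegBound W ℓ α φ A ν r y ∧ SegBound W ℓ α φ A ν s (y - 2 * π * s * α) ∧
    cross (φ y) (segT (exp ℓ) α φ s (y - 2 * π * s * α)) (segS (exp ℓ) α φ r y) ≠ 0 ∧
    JetBound W y (fun w => (cross (φ w) (segT (exp ℓ) α φ s (w - 2 * π * s * α))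
      (segS (exp ℓ) α φ r w))⁻¹) (exp (Cp * critDist c₁ y ^ (-ν)))

theorem PivotBound.congr {φ' : ℝ → ℝ} (h : PivotBound W ℓ α φ A ν c₁ Cp cr Cr y)
    (he : ∀ z, critDist c₁ y ≤ critDist c₁ z → φ' =ᶠ[nhds z] φ) :
    PivotBound W ℓ α φ' A ν c₁ Cp cr Cr y := by
  obtain ⟨r, s, h1, h2, h3, h4, h5, h6, h7, h8, h9, h10, h11, h12⟩ := h
  have e1 : ∀ i : ℕ, 0 < i → i < r → φ' =ᶠ[nhds (y + 2 * π * i * α)] φ :=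
    fun i hi hi' => he _ (h7 i hi hi')
  have e2 : ∀ i : ℕ, 0 < i → i < s → φ' =ᶠ[nhds (y - 2 * π * s * α + 2 * π * i * α)] φ := by
    intro i hi hi'
    have := he _ (h8 (s - i) (by omega) (by omega))
    rwa [Nat.cast_sub hi'.le, show y - 2 * π * ((s : ℝ) - i) * α =
      y - 2 * π * s * α + 2 * π * i * α by ring] at this
  have m1 := segMat_eventuallyEq (lam := exp ℓ) e1
  have m2 := segMat_eventuallyEq (lam := exp ℓ) e2
  have m2' : ∀ᶠ w in nhds y, segMat (exp ℓ) α φ' s (w - 2 * π * s * α) =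
      segMat (exp ℓ) α φ s (w - 2 * π * s * α) :=
    ((continuous_id.sub continuous_const).tendsto y).eventually m2
  have e3 : (fun w => cross (φ' w) (segT (exp ℓ) α φ' s (w - 2 * π * s * α))
      (segS (exp ℓ) α φ' r w)) =ᶠ[nhds y] fun w =>
      cross (φ w) (segT (exp ℓ) α φ s (w - 2 * π * s * α)) (segS (exp ℓ) α φ r w) := by
    filter_upwards [m1, m2', he y le_rfl] with w a1 a2 a3
    simp only [segT, segS, segInv, a1, a2, a3]
  refine ⟨r, s, h1, h2, h3, h4, h5, h6, h7, h8, h9.congr e1, h10.congr e2, ?_, h12.congr ?_⟩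
  · rwa [e3.eq_of_nhds]
  · filter_upwards [e3] with w hw
    rw [hw]

theorem cross_sub_eq (θ t t' s s' : ℝ) : cross θ t s = cross θ t' s' +
    (-((t - t') * cos θ) - (s - s') * (cos θ + t * sin θ) - s' * ((t - t') * sin θ)) := by
  unfold cross; ring

/-- Comparison of transversality. -/
theorem cross_inv_bound (hW : JetWeight W) (hφ : TrigBound W φ) {t t' s s' : ℝ → ℝ} {η B : ℝ}
    (ht : JetBound W y t (1 / 10)) (ht' : JetBound W y t' (1 / 10)) (hs' : JetBound W y s' (1 / 10))
    (hdt : JetBound W y (fun w => t w - t' w) η) (hds : JetBound W y (fun w => s w - s' w) η)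
    (h0 : cross (φ y) (t' y) (s' y) ≠ 0)
    (hB : JetBound W y (fun w => (cross (φ w) (t' w) (s' w))⁻¹) B) (hη : B * (18 * η) ≤ 1 / 2) :
    cross (φ y) (t y) (s y) ≠ 0 ∧
      JetBound W y (fun w => (cross (φ w) (t w) (s w))⁻¹) (2 * B) := by
  have hη0 := hdt.nonneg
  obtain ⟨hs, hc⟩ := hφ y
  have hh := (((hdt.mul hW hc).neg.sub hW (hds.mul hW (hc.add hW (ht.mul hW hs)))).sub hW
    (hs'.mul hW (hdt.mul hW hs))).mono (B' := 18 * η) (by linarith)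
  have hcs : ContDiffAt ℝ (⊤ : ℕ∞) (fun w => cross (φ w) (t' w) (s' w)) y := by
    unfold cross
    exact (hs.smooth.sub (ht'.smooth.mul hc.smooth)).sub
      (hs'.smooth.mul (hc.smooth.add (ht'.smooth.mul hs.smooth)))
  have := JetBound.inv_add hW (f := fun w => cross (φ w) (t' w) (s' w)) h0 hcs hB hh
    (by linarith)
  simp only [← cross_sub_eq] at this
  refine ⟨this.1, this.2.mono ?_⟩
  rw [div_le_iff₀ (by linarith)]
  nlinarith [hB.nonneg]

/-- Concatenation of two hyperbolic blocks at a pivot. -/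
theorem SegBound.add (hW : JetWeight W) (hℓ0 : 0 ≤ ℓ) (hA : 0 ≤ A) (hφ : TrigBound W φ)
    (hν : ν ≤ 1) (hCp : 0 ≤ Cp) {a b : ℝ} (ha0 : 0 < a) (hacr : a ≤ cr) (hbCr : Cr ≤ b)
    (hℓ1 : 2 * (A + 3) * b ≤ a * ℓ) (hℓ2 : Cp + 4 ≤ a * ℓ) (hℓ3 : 2 * A + 7 + Cp / a ≤ 2 * ℓ)
    (hj : 1 ≤ j) (hk : 1 ≤ k) (hd0 : 0 < critDist c₁ (x + 2 * π * j * α))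
    (hd1 : critDist c₁ (x + 2 * π * j * α) ≤ 1)
    (hja : a / critDist c₁ (x + 2 * π * j * α) ≤ j) (hjb : j ≤ b / critDist c₁ (x + 2 * π * j * α))
    (hka : a / critDist c₁ (x + 2 * π * j * α) ≤ k) (hkb : k ≤ b / critDist c₁ (x + 2 * π * j * α))
    (hsup : Cp * critDist c₁ (x + 2 * π * j * α) ^ (-ν) + 1 ≤
      A * (j : ℝ) ^ ν + A * (k : ℝ) ^ ν - A * (j + k : ℝ) ^ ν)
    (h1 : SegBound W ℓ α φ A ν j x) (h2 : SegBound W ℓ α φ A ν k (x + 2 * π * j * α))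
    (hp : PivotBound W ℓ α φ A ν c₁ Cp cr Cr (x + 2 * π * j * α)) :
    SegBound W ℓ α φ A ν (j + k) x := by
  set y := x + 2 * π * j * α with hy
  set d := critDist c₁ y with hd
  have hxy : x = y - 2 * π * j * α := by rw [hy]; ring
  obtain ⟨r, s, hr1, hs1, hr2, hr3, hs2, hs3, -, -, hrS, hsS, hc0, hcB⟩ := hp
  have w1 : a / d ≤ cr / d := by gcongr
  have w2 : Cr / d ≤ b / d := by gcongr
  have h1' : SegBound W ℓ α φ A ν j (y - 2 * π * j * α) := hxy ▸ h1
  have hT := segT_compare hW hℓ0 hA hφ hd0 hℓ1 hj hs1 h1' hsS (w1.trans hs2) (hs3.trans w2) hja hjb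
  have hS := segS_compare hW hℓ0 hA hφ hd0 hℓ1 hk hr1 h2 hrS (w1.trans hr2) (hr3.trans w2) hka hkb
  have sh : ∀ {f : ℝ → ℝ} {B : ℝ} (i : ℕ), JetBound W (y - 2 * π * i * α) f B →
      JetBound W y (fun w => f (w - 2 * π * i * α)) B := by
    intro f B i hf
    rw [sub_eq_add_neg] at hf
    simpa only [← sub_eq_add_neg] using hf.comp_add_const _
  have hdinv : 1 ≤ 1 / d := (one_le_div hd0).2 hd1
  have hdν : d ^ (-ν) ≤ 1 / d := by
    have := rpow_le_rpow_of_exponent_ge hd0 hd1 (show (-1 : ℝ) ≤ -ν by linarith)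
    rwa [rpow_neg_one, ← one_div] at this
  obtain ⟨hX0, hXB⟩ := cross_inv_bound hW hφ (sh j h1'.fwd') (sh s hsS.fwd') hrS.bwd' hT hS hc0 hcB
    (by
      have e : (36 : ℝ) ≤ exp 4 := by
        have := exp_one_gt_d9
        calc (36 : ℝ) ≤ 2.7 ^ 4 := by norm_num
          _ ≤ exp 1 ^ 4 := by gcongr; linarith
          _ = exp 4 := by rw [← exp_nat_mul]; norm_num
      have : exp (Cp * d ^ (-ν)) * exp (-(a * ℓ / d)) ≤ exp (-4) := by
        rw [← exp_add, exp_le_exp]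
        have : Cp * d ^ (-ν) ≤ Cp * (1 / d) := by gcongr
        have h' : a * ℓ / d = a * ℓ * (1 / d) := by ring
        rw [h']
        nlinarith
      have e' : exp (-4) ≤ 1 / 36 := by
        rw [exp_neg, ← one_div]; exact one_div_le_one_div_of_le (by norm_num) e
      linarith)
  have hXB' : JetBound W x (fun z => (cross (φ (z + 2 * π * j * α)) (segT (exp ℓ) α φ j z)
      (segS (exp ℓ) α φ k (z + 2 * π * j * α)))⁻¹) (2 * exp (Cp * d ^ (-ν))) := by
    have := JetBound.comp_add_const (x := x) (2 * π * j * α) hXB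
    simpa only [add_sub_cancel_right] using this
  have hX0' : cross (φ (x + 2 * π * j * α)) (segT (exp ℓ) α φ j x)
      (segS (exp ℓ) α φ k (x + 2 * π * j * α)) ≠ 0 := by
    rw [← hy]; simpa only [← hxy] using hX0
  have hl0 := (exp_pos ℓ).ne'
  have c1 : ∀ᶠ z in nhds x, segMat (exp ℓ) α φ j z 0 0 ≠ 0 :=
    (segMat_bound hW hℓ0 hφ hj x 0 0).smooth.continuousAt.eventually_ne h1.ne
  have c2 : ∀ᶠ z in nhds x, segMat (exp ℓ) α φ k (z + 2 * π * j * α) 0 0 ≠ 0 :=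
    ((segMat_bound hW hℓ0 hφ hk _ 0 0).comp_add_const (2 * π * j * α)).smooth.continuousAt.eventually_ne
      h2.ne
  have c3 : ∀ᶠ z in nhds x, cross (φ (z + 2 * π * j * α)) (segT (exp ℓ) α φ j z)
      (segS (exp ℓ) α φ k (z + 2 * π * j * α)) ≠ 0 := by
    have : ContinuousAt (fun z => cross (φ (z + 2 * π * j * α)) (segT (exp ℓ) α φ j z)
        (segS (exp ℓ) α φ k (z + 2 * π * j * α))) x := by
      have a1 := ((hφ y).1.comp_add_const (2 * π * j * α)).smooth.continuousAt
      have a2 := ((hφ y).2.comp_add_const (2 * π * j * α)).smooth.continuousAt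
      have a3 := h1.fwd.smooth.continuousAt
      have a4 := (h2.bwd.comp_add_const (2 * π * j * α)).smooth.continuousAt
      unfold cross
      exact (a1.sub (a3.mul a2)).sub (a4.mul (a2.add (a3.mul a1)))
    exact this.eventually_ne hX0'
  have hj1 : (1 : ℝ) ≤ j := by exact_mod_cast hj
  have hk1 : (1 : ℝ) ≤ k := by exact_mod_cast hk
  -- error bound for the slopes
  have err : ∀ m : ℕ, 1 ≤ m → a / d ≤ m →
      exp (-(m * ℓ) + A * m) ^ 2 * (8 + 1 / 10 * 8) * (2 * exp (Cp * d ^ (-ν))) ≤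
        (1 / 2) ^ m / 20 := by
    intro m hm hma
    have hm1 : (1 : ℝ) ≤ m := by exact_mod_cast hm
    have e : (352 : ℝ) ≤ exp 6 := by
      have := exp_one_gt_d9
      calc (352 : ℝ) ≤ 2.7 ^ 6 := by norm_num
        _ ≤ exp 1 ^ 6 := by gcongr; linarith
        _ = exp 6 := by rw [← exp_nat_mul]; norm_num
    have e2 : exp (-1 : ℝ) ≤ 1 / 2 := by
      have := exp_one_gt_d9
      rw [exp_neg, ← one_div]; exact one_div_le_one_div_of_le (by norm_num) (by linarith)
    have e3 : exp (-(m : ℝ)) ≤ (1 / 2) ^ m := by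
      rw [show (-(m : ℝ)) = m * (-1) by ring, exp_nat_mul]; gcongr
    have e4 : exp 6 * (exp (-(m * ℓ) + A * m) ^ 2 * exp (Cp * d ^ (-ν))) ≤ exp (-(m : ℝ)) := by
      rw [← exp_nat_mul, ← exp_add, ← exp_add, exp_le_exp]
      push_cast
      have f1 : Cp * d ^ (-ν) ≤ Cp / a * m := by
        calc Cp * d ^ (-ν) ≤ Cp * (1 / d) := by gcongr
          _ = Cp / a * (a / d) := by field_simp
          _ ≤ Cp / a * m := by gcongr
      nlinarith
    have e5 : 0 ≤ exp (-(m * ℓ) + A * m) ^ 2 * exp (Cp * d ^ (-ν)) := by positivity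
    nlinarith
  have half : ∀ m n : ℕ, 1 ≤ m → (1 - (1 / 2 : ℝ) ^ n) / 10 + (1 / 2) ^ n / 20 ≤
      (1 - (1 / 2 : ℝ) ^ (n + m)) / 10 := by
    intro m n hm
    have : (1 / 2 : ℝ) ^ (n + m) ≤ (1 / 2) ^ (n + 1) :=
      pow_le_pow_of_le_one (by norm_num) (by norm_num) (by omega)
    rw [pow_succ] at this
    linarith
  have s8 := (hφ y).1.comp_add_const (2 * π * j * α)
  have c8 := (hφ y).2.comp_add_const (2 * π * j * α)
  refine ⟨?_, ?_, ?_, ?_⟩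
  · rw [segMat_add_zero_zero hj hk h1.ne h2.ne]
    exact mul_ne_zero (mul_ne_zero h2.ne hX0') h1.ne
  · refine (((h2.inv.comp_add_const (2 * π * j * α)).mul hW hXB').mul hW h1.inv).congr ?_ |>.mono ?_
    · filter_upwards [c1, c2] with z z1 z2
      rw [segInv, segMat_add_zero_zero hj hk z1 z2, mul_inv, mul_inv]; rfl
    · have e2 : (2 : ℝ) ≤ exp 1 := by linarith [exp_one_gt_d9]
      calc exp (-(k * ℓ) + A * k - A * (k : ℝ) ^ ν) * (2 * exp (Cp * d ^ (-ν))) *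
            exp (-(j * ℓ) + A * j - A * (j : ℝ) ^ ν)
          ≤ exp (-(k * ℓ) + A * k - A * (k : ℝ) ^ ν) * (exp 1 * exp (Cp * d ^ (-ν))) *
            exp (-(j * ℓ) + A * j - A * (j : ℝ) ^ ν) := by gcongr
        _ = exp (-(k * ℓ) + A * k - A * (k : ℝ) ^ ν + (1 + Cp * d ^ (-ν)) +
            (-(j * ℓ) + A * j - A * (j : ℝ) ^ ν)) := by rw [← exp_add, ← exp_add, ← exp_add]
        _ ≤ _ := by
          rw [exp_le_exp]
          push_cast
          linarith
  · refine ((h2.fwd.comp_add_const (2 * π * j * α)).add hW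
      (((((h2.inv' hA).comp_add_const (2 * π * j * α)).sq hW).mul hW
        (c8.add hW (h1.fwd'.mul hW s8))).mul hW hXB')).congr ?_ |>.mono ?_
    · filter_upwards [c1, c2, c3] with z z1 z2 z3
      exact segT_add hl0 hj hk z1 z2 z3
    · rw [add_comm j k]
      exact (add_le_add le_rfl (err k hk hka)).trans (half j k hj)
  · refine (h1.bwd.add hW ((((h1.inv' hA).sq hW).mul hW
      (c8.add hW ((h2.bwd'.comp_add_const (2 * π * j * α)).mul hW s8))).mul hW hXB')).congr ?_
        |>.mono ?_
    · filter_upwards [c1, c2, c3] with z z1 z2 z3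
      exact segS_add hl0 hj hk z1 z2 z3
    · exact (add_le_add le_rfl (err j hj hja)).trans (half k j hk)

end

theorem rpow_add_le_of_balanced {ν η u v : ℝ} (hν : ν ≤ 1) (hη : 0 < η) (hu : 0 < u)
    (hv : 0 < v) (hηu : η * (u + v) ≤ u) (hηv : η * (u + v) ≤ v) :
    (1 - η) ^ (ν - 1) * (u + v) ^ ν ≤ u ^ ν + v ^ ν := by
  have hs : 0 < u + v := by linarith
  have key : ∀ w, 0 < w → w ≤ (1 - η) * (u + v) →
      w * ((1 - η) ^ (ν - 1) * (u + v) ^ (ν - 1)) ≤ w ^ ν := by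
    intro w hw hw'
    have h1 : 0 < 1 - η := by
      by_contra h
      nlinarith
    rw [← mul_rpow h1.le hs.le]
    calc w * ((1 - η) * (u + v)) ^ (ν - 1) ≤ w * w ^ (ν - 1) :=
          mul_le_mul_of_nonneg_left (rpow_le_rpow_of_nonpos hw hw' (by linarith)) hw.le
      _ = w ^ ν := by rw [mul_comm, ← rpow_add_one hw.ne', sub_add_cancel]
  have h1 := key u hu (by linarith)
  have h2 := key v hv (by linarith)
  have e : (u + v) ^ ν = (u + v) * (u + v) ^ (ν - 1) := by
    rw [mul_comm, ← rpow_add_one hs.ne', sub_add_cancel]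
  rw [e]
  nlinarith

/-- The orbit segment of length `k` from `x` stays away from the critical set, compared with its
endpoints. -/
def GoodSeg (α c₁ δ₀ : ℝ) (k : ℕ) (x : ℝ) : Prop :=
  ∀ j : ℕ, 0 < j → j < k → δ₀ < critDist c₁ (x + 2 * π * j * α) ∧
    critDist c₁ x ≤ 3 * critDist c₁ (x + 2 * π * j * α) ∧
    critDist c₁ (x + 2 * π * k * α) ≤ 3 * critDist c₁ (x + 2 * π * j * α)

/-- Uniform hyperbolicity of all good orbit segments, given transversality at every pivot. -/
theorem exists_segBound {α M ν Cp cr Cr : ℝ} (hα : Irrational α) (hM : 1 ≤ M)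
    (hb : BoundedType α M) (hν : 0 < ν) (hν1 : ν < 1) (hCp : 0 ≤ Cp) (hcr : 0 < cr) :
    ∃ A ≥ 0, ∃ ℓ₀ ≥ 0, ∀ ℓ ≥ ℓ₀, ∀ W, JetWeight W → ∀ φ, TrigBound W φ → ∀ c₁ r₀ δ₀ : ℝ,
      0 ≤ δ₀ → r₀ ≤ 1 → (∀ y, r₀ < critDist c₁ y → φ =ᶠ[nhds y] fun _ => π / 2) →
      (∀ y, δ₀ < critDist c₁ y → critDist c₁ y ≤ r₀ → PivotBound W ℓ α φ A ν c₁ Cp cr Cr y) →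
      ∀ k x, 1 ≤ k → GoodSeg α c₁ δ₀ k x → SegBound W ℓ α φ A ν k x := by
  set cs : ℝ := 1 / (4 * M) with hcs
  set CH : ℝ := 16 * M with hCH
  have hcs0 : 0 < cs := by positivity
  have hCH0 : 0 < CH := by positivity
  set η := cs / (8 * CH) with hη
  have hη0 : 0 < η := by positivity
  have hη1 : η < 1 := by
    rw [hη, div_lt_one (by positivity), hcs, hCH]
    have : 1 / (4 * M) ≤ 1 := by rw [div_le_one (by positivity)]; linarith
    linarith
  set κ := (1 - η) ^ (ν - 1) - 1 with hκ
  have hκ0 : 0 < κ := by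
    have := one_lt_rpow_of_pos_of_lt_one_of_neg (show 0 < 1 - η by linarith) (by linarith)
      (show ν - 1 < 0 by linarith)
    linarith
  set A := (Cp + 1) / (κ * (cs / 2) ^ ν) with hA
  have hA0 : 0 ≤ A := by positivity
  set a := min cr (cs / 4) with ha
  have ha0 : 0 < a := lt_min hcr (by positivity)
  set b := max Cr (2 * CH) with hbdef
  have hb0 : 0 < b := lt_of_lt_of_le (by positivity) (le_max_right _ _)
  refine ⟨A, hA0, 2 * (A + 3) * b / a + (Cp + 4) / a + (2 * A + 7 + Cp / a), by positivity, ?_⟩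
  intro ℓ hℓ W hW φ hφ c₁ r₀ δ₀ hδ₀ hr₀ htriv hpiv
  have q1 : 0 ≤ 2 * (A + 3) * b / a := by positivity
  have q2 : 0 ≤ (Cp + 4) / a := by positivity
  have q3 : 0 ≤ 2 * A + 7 + Cp / a := by positivity
  have hℓ0 : 0 ≤ ℓ := by linarith
  have hℓ1 : 2 * (A + 3) * b ≤ a * ℓ := by
    have : 2 * (A + 3) * b / a ≤ ℓ := by linarith
    rwa [div_le_iff₀' ha0] at this
  have hℓ2 : Cp + 4 ≤ a * ℓ := by
    have : (Cp + 4) / a ≤ ℓ := by linarith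
    rwa [div_le_iff₀' ha0] at this
  have hℓ3 : 2 * A + 7 + Cp / a ≤ 2 * ℓ := by linarith
  intro k
  induction k using Nat.strong_induction_on with
  | _ k ih =>
  intro x hk hgood
  by_cases hvis : ∃ j : ℕ, 0 < j ∧ j < k ∧ critDist c₁ (x + 2 * π * j * α) ≤ r₀
  swap
  · refine SegBound.of_trivial hW hA0 hν1.le hk fun j hj hjk => htriv _ ?_
    by_contra h
    exact hvis ⟨j, hj, hjk, not_lt.1 h⟩
  obtain ⟨j₀, hj₀, hj₀k, hj₀r⟩ := hvis
  obtain ⟨j, hjm, hmin⟩ := Finset.exists_min_image (Finset.Ioo 0 k)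
    (fun j : ℕ => critDist c₁ (x + 2 * π * j * α)) ⟨j₀, Finset.mem_Ioo.2 ⟨hj₀, hj₀k⟩⟩
  rw [Finset.mem_Ioo] at hjm
  obtain ⟨hj0, hjk⟩ := hjm
  set y := x + 2 * π * j * α with hy
  set d := critDist c₁ y with hd
  have hmin' : ∀ i : ℕ, 0 < i → i < k → d ≤ critDist c₁ (x + 2 * π * i * α) :=
    fun i h1 h2 => hmin i (Finset.mem_Ioo.2 ⟨h1, h2⟩)
  have hdr : d ≤ r₀ := (hmin' j₀ hj₀ hj₀k).trans hj₀r
  obtain ⟨hδd, hdx, hdk⟩ := hgood j hj0 hjk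
  have hd0 : 0 < d := lt_of_le_of_lt hδ₀ hδd
  have hd1 : d ≤ 1 := hdr.trans hr₀
  obtain ⟨n, rfl⟩ := Nat.exists_eq_add_of_le hjk.le
  have hn1 : 1 ≤ n := by omega
  have eyn : ∀ i : ℕ, y + 2 * π * i * α = x + 2 * π * (j + i : ℕ) * α := by
    intro i; rw [hy]; push_cast; ring
  have hj1 : (1 : ℝ) ≤ j := by exact_mod_cast hj0
  have hn1' : (1 : ℝ) ≤ n := by exact_mod_cast hn1
  -- lengths
  have hlen : ∀ i : ℕ, 1 ≤ i → 1 / (4 * M * i) ≤ 4 * d → cs / 4 / d ≤ i := by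
    intro i hi h
    have hi' : (0 : ℝ) < i := by exact_mod_cast hi
    rw [div_le_iff₀ hd0]
    have e : 1 / (4 * M * i) = cs / i := by rw [hcs]; field_simp
    rw [e, div_le_iff₀ hi'] at h
    linarith
  have hlj : cs / 4 / d ≤ j := hlen j hj0 (by
    have := critDist_separated hα hM hb c₁ x hj0
    linarith)
  have hln : cs / 4 / d ≤ n := hlen n hn1 (by
    have := critDist_separated hα hM hb c₁ y hn1
    rw [eyn] at this
    linarith)
  have hlk : ((j + n : ℕ) : ℝ) ≤ 2 * CH / d := by
    obtain ⟨i, hi1, hi2, hi3⟩ := exists_critDist_le_fwd hα hM hb c₁ x (δ := d / 2) (by linarith)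
      (by linarith)
    have : j + n ≤ i := by
      by_contra h
      have := hmin' i hi1 (by omega)
      linarith
    calc ((j + n : ℕ) : ℝ) ≤ i := by exact_mod_cast this
      _ ≤ 16 * M / (d / 2) := hi2
      _ = 2 * CH / d := by rw [hCH]; field_simp
  have hlk' := hlk
  push_cast at hlk'
  have wa : a / d ≤ cs / 4 / d := by gcongr; exact min_le_right _ _
  have wb : 2 * CH / d ≤ b / d := by gcongr; exact le_max_right _ _
  have hηk : η * (j + n) ≤ cs / 4 / d := by
    calc η * (j + n) ≤ η * (2 * CH / d) := by gcongr
      _ = cs / 4 / d := by rw [hη]; field_simp; norm_num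
  have hsup := rpow_add_le_of_balanced hν1.le hη0 (u := j) (v := n) (by linarith) (by linarith)
    (hηk.trans hlj) (hηk.trans hln)
  have hdν : 1 ≤ d ^ (-ν) := one_le_rpow_of_pos_of_le_one_of_nonpos hd0 hd1 (by linarith)
  have hsup' : Cp * d ^ (-ν) + 1 ≤ A * (j : ℝ) ^ ν + A * (n : ℝ) ^ ν - A * (j + n : ℝ) ^ ν := by
    have h1 : (cs / 2) ^ ν * d ^ (-ν) ≤ (j + n : ℝ) ^ ν := by
      rw [rpow_neg hd0.le, ← div_eq_mul_inv, ← div_rpow (by positivity) hd0.le]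
      refine rpow_le_rpow (by positivity) ?_ hν.le
      have : cs / 2 / d = cs / 4 / d + cs / 4 / d := by ring
      linarith
    have h2 : A * (κ * ((cs / 2) ^ ν * d ^ (-ν))) = (Cp + 1) * d ^ (-ν) := by
      rw [hA]; field_simp
    have h3 : A * (κ * ((cs / 2) ^ ν * d ^ (-ν))) ≤ A * (κ * (j + n : ℝ) ^ ν) := by gcongr
    have h4 : κ * (j + n : ℝ) ^ ν = (1 - η) ^ (ν - 1) * (j + n : ℝ) ^ ν - (j + n : ℝ) ^ ν := by
      rw [hκ]; ring
    have h5 : A * (κ * (j + n : ℝ) ^ ν) ≤ A * ((j : ℝ) ^ ν + (n : ℝ) ^ ν - (j + n : ℝ) ^ ν) := by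
      rw [h4]; gcongr
    have h6 : (Cp + 1) * d ^ (-ν) = Cp * d ^ (-ν) + d ^ (-ν) := by ring
    have h7 : A * ((j : ℝ) ^ ν + (n : ℝ) ^ ν - (j + n : ℝ) ^ ν) =
      A * (j : ℝ) ^ ν + A * (n : ℝ) ^ ν - A * (j + n : ℝ) ^ ν := by ring
    linarith
  refine SegBound.add hW hℓ0 hA0 hφ hν1.le hCp ha0 (min_le_left _ _) (le_max_left Cr (2 * CH))
    hℓ1 hℓ2 hℓ3 hj0 hn1 hd0 hd1 (wa.trans hlj) ?_ (wa.trans hln) ?_ hsup' ?_ ?_ (hpiv y hδd hdr)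
  · exact le_trans (by linarith) wb
  · exact le_trans (by linarith) wb
  · refine ih j hjk x hj0 fun i hi hij => ?_
    obtain ⟨g1, g2, -⟩ := hgood i hi (by omega)
    exact ⟨g1, g2, by have := hmin' i hi (by omega); linarith⟩
  · refine ih n (by omega) y hn1 fun i hi hin => ?_
    rw [eyn, eyn]
    obtain ⟨g1, g2, g3⟩ := hgood (j + i) (by omega) (by omega)
    exact ⟨g1, by have := hmin' (j + i) (by omega) (by omega); linarith, g3⟩

/-! ### Norms and contracted directions -/

theorem rotM_mem_unitary (θ : ℝ) :
    rotM θ ∈ unitary (Matrix (Fin 2) (Fin 2) ℝ) := by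
  have h := sin_sq_add_cos_sq θ
  rw [Unitary.mem_iff]
  constructor <;> ext i j <;> fin_cases i <;> fin_cases j <;>
    simp [rotM, Matrix.mul_apply, Fin.sum_univ_two, Matrix.star_apply] <;> nlinarith

theorem toEuclideanCLM_mem_unitary {U : Matrix (Fin 2) (Fin 2) ℝ}
    (hU : U ∈ unitary (Matrix (Fin 2) (Fin 2) ℝ)) :
    Matrix.toEuclideanCLM (𝕜 := ℝ) U ∈ unitary (EuclideanSpace ℝ (Fin 2) →L[ℝ] EuclideanSpace ℝ (Fin 2)) := by
  rw [Unitary.mem_iff] at hU ⊢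
  rw [← map_star, ← map_mul, ← map_mul, hU.1, hU.2, map_one]
  exact ⟨rfl, rfl⟩

theorem mnorm_mul_le (P Q : Matrix (Fin 2) (Fin 2) ℝ) : mnorm (P * Q) ≤ mnorm P * mnorm Q := by
  unfold mnorm; rw [map_mul]; exact norm_mul_le _ _

theorem mnorm_rotM_mul (θ : ℝ) (P : Matrix (Fin 2) (Fin 2) ℝ) : mnorm (rotM θ * P) = mnorm P := by
  unfold mnorm
  rw [map_mul]
  exact CStarRing.norm_mem_unitary_mul _ (toEuclideanCLM_mem_unitary (rotM_mem_unitary θ))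

theorem mnorm_mul_rotM (θ : ℝ) (P : Matrix (Fin 2) (Fin 2) ℝ) : mnorm (P * rotM θ) = mnorm P := by
  unfold mnorm
  rw [map_mul]
  exact CStarRing.norm_mul_mem_unitary _ (toEuclideanCLM_mem_unitary (rotM_mem_unitary θ))

theorem mnorm_inv {P : Matrix (Fin 2) (Fin 2) ℝ} (hP : P.det = 1) : mnorm P⁻¹ = mnorm P := by
  have e : P⁻¹ = rotM (π / 2) * (star P * rotM (-(π / 2))) := by
    rw [Matrix.inv_def, hP, Ring.inverse_one, one_smul, Matrix.adjugate_fin_two]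
    ext i j; fin_cases i <;> fin_cases j <;>
      simp [rotM, Matrix.mul_apply, Fin.sum_univ_two, Matrix.star_apply]
  rw [e, mnorm_rotM_mul, mnorm_mul_rotM]
  unfold mnorm
  rw [map_star]
  exact LinearIsometryEquiv.norm_map ContinuousLinearMap.adjoint _

theorem norm_apply_sq (P : Matrix (Fin 2) (Fin 2) ℝ) (v : EuclideanSpace ℝ (Fin 2)) :
    ‖Matrix.toEuclideanCLM (𝕜 := ℝ) P v‖ ^ 2 =
      (P 0 0 * v 0 + P 0 1 * v 1) ^ 2 + (P 1 0 * v 0 + P 1 1 * v 1) ^ 2 := by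
  rw [EuclideanSpace.norm_sq_eq, Fin.sum_univ_two]
  simp [Matrix.mulVec, dotProduct, Fin.sum_univ_two]

theorem norm_unitDir (t : ℝ) : ‖unitDir t‖ = 1 := by
  have : ‖unitDir t‖ ^ 2 = 1 := by
    rw [EuclideanSpace.norm_sq_eq, Fin.sum_univ_two]
    simp [unitDir]
  nlinarith [norm_nonneg (unitDir t)]

theorem abs_apply_le_mnorm (P : Matrix (Fin 2) (Fin 2) ℝ) : |P 0 0| ≤ mnorm P := by
  have h := (Matrix.toEuclideanCLM (𝕜 := ℝ) P).le_opNorm (unitDir 0)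
  rw [norm_unitDir, mul_one] at h
  refine le_trans (abs_le_of_sq_le_sq ?_ (norm_nonneg _)) h
  rw [norm_apply_sq]
  simp [unitDir]
  positivity

theorem norm_apply_unitDir_sq (P : Matrix (Fin 2) (Fin 2) ℝ) (t : ℝ) :
    ‖Matrix.toEuclideanCLM (𝕜 := ℝ) P (unitDir t)‖ ^ 2 =
      (P 0 0 ^ 2 + P 1 0 ^ 2 + (P 0 1 ^ 2 + P 1 1 ^ 2)) / 2 +
      (P 0 0 ^ 2 + P 1 0 ^ 2 - (P 0 1 ^ 2 + P 1 1 ^ 2)) / 2 * cos (2 * t) +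
      (P 0 0 * P 0 1 + P 1 0 * P 1 1) * sin (2 * t) := by
  rw [norm_apply_sq, cos_two_mul, sin_two_mul]
  simp only [unitDir, WithLp.equiv_symm_apply_ofLp, Matrix.cons_val_zero, Matrix.cons_val_one]
  have h := sin_sq_add_cos_sq t
  have hs : sin t ^ 2 = 1 - cos t ^ 2 := by linarith
  ring_nf
  rw [hs]
  ring

/-- Criterion for the most contracted direction. -/
theorem isContrDir_of {P : Matrix (Fin 2) (Fin 2) ℝ} (hP : P.det = 1) {t D : ℝ} (hD : 0 < D)
    (h1 : (P 0 0 ^ 2 + P 1 0 ^ 2 - (P 0 1 ^ 2 + P 1 1 ^ 2)) / 2 = -(D * cos (2 * t)))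
    (h2 : P 0 0 * P 0 1 + P 1 0 * P 1 1 = -(D * sin (2 * t))) : IsContrDir P t := by
  rw [Matrix.det_fin_two] at hP
  set S := (P 0 0 ^ 2 + P 1 0 ^ 2 + (P 0 1 ^ 2 + P 1 1 ^ 2)) / 2 with hS
  have hcs := sin_sq_add_cos_sq (2 * t)
  have hSD : (S - D) * (S + D) = 1 := by
    have e1 : ((P 0 0 ^ 2 + P 1 0 ^ 2 - (P 0 1 ^ 2 + P 1 1 ^ 2)) / 2) ^ 2 +
        (P 0 0 * P 0 1 + P 1 0 * P 1 1) ^ 2 = D ^ 2 := by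
      rw [h1, h2]; linear_combination D ^ 2 * hcs
    have e2 : S ^ 2 - ((P 0 0 ^ 2 + P 1 0 ^ 2 - (P 0 1 ^ 2 + P 1 1 ^ 2)) / 2) ^ 2 -
        (P 0 0 * P 0 1 + P 1 0 * P 1 1) ^ 2 = (P 0 0 * P 1 1 - P 0 1 * P 1 0) ^ 2 := by
      rw [hS]; ring
    rw [hP] at e2
    linear_combination e2 + e1
  have hS0 : 0 ≤ S := by rw [hS]; positivity
  have hSDpos : 0 < S + D := by linarith
  have hm : ‖Matrix.toEuclideanCLM (𝕜 := ℝ) P (unitDir t)‖ ^ 2 = S - D := by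
    rw [norm_apply_unitDir_sq, h1, h2]
    linear_combination -D * hcs
  have hn : ‖Matrix.toEuclideanCLM (𝕜 := ℝ) P (unitDir (t + π / 2))‖ ^ 2 = S + D := by
    rw [norm_apply_unitDir_sq, h1, h2, show 2 * (t + π / 2) = 2 * t + π by ring, cos_add_pi,
      sin_add_pi]
    linear_combination D * hcs
  have hle : mnorm P ≤ √(S + D) := by
    refine ContinuousLinearMap.opNorm_le_bound _ (sqrt_nonneg _) fun v => ?_
    refine abs_le_of_sq_le_sq' ?_ (by positivity) |>.2
    rw [norm_apply_sq, mul_pow, sq_sqrt hSDpos.le, EuclideanSpace.norm_sq_eq, Fin.sum_univ_two]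
    simp only [norm_eq_abs, sq_abs]
    have p1 : P 0 0 ^ 2 + P 1 0 ^ 2 = S - D * cos (2 * t) := by rw [hS]; linarith
    have p2 : P 0 1 ^ 2 + P 1 1 ^ 2 = S + D * cos (2 * t) := by rw [hS]; linarith
    have key : (S + D) * (v 0 ^ 2 + v 1 ^ 2) - ((P 0 0 * v 0 + P 0 1 * v 1) ^ 2 +
        (P 1 0 * v 0 + P 1 1 * v 1) ^ 2) =
        2 * D * (cos t * v 0 + sin t * v 1) ^ 2 := by
      have hs := sin_sq_add_cos_sq t
      have c2 := cos_two_mul t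
      have s2 := sin_two_mul t
      linear_combination (-(v 0 ^ 2)) * p1 - v 1 ^ 2 * p2 - 2 * v 0 * v 1 * h2 +
        D * (v 0 ^ 2 - v 1 ^ 2) * c2 + 2 * D * v 0 * v 1 * s2 - 2 * D * v 1 ^ 2 * hs
    have : 0 ≤ 2 * D * (cos t * v 0 + sin t * v 1) ^ 2 := by positivity
    linarith
  have hge : √(S + D) ≤ mnorm P := by
    have h := (Matrix.toEuclideanCLM (𝕜 := ℝ) P).le_opNorm (unitDir (t + π / 2))
    rw [norm_unitDir, mul_one] at h
    refine le_trans ?_ h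
    rw [← hn, sqrt_sq (norm_nonneg _)]
  rw [IsContrDir, le_antisymm hle hge, ← sqrt_inv, ← eq_inv_of_mul_eq_one_left hSD, ← hm,
    sqrt_sq (norm_nonneg _)]

theorem rotM_apply_unitDir (θ t : ℝ) :
    Matrix.toEuclideanCLM (𝕜 := ℝ) (rotM θ) (unitDir t) = unitDir (t + θ) := by
  ext i
  fin_cases i <;> simp [unitDir, rotM, cos_add, sin_add] <;>
    ring

theorem isContrDir_mul_rotM {P : Matrix (Fin 2) (Fin 2) ℝ} {θ t : ℝ} :
    IsContrDir (P * rotM θ) t ↔ IsContrDir P (t + θ) := by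
  rw [IsContrDir, IsContrDir, mnorm_mul_rotM, map_mul, mul_apply_eq_comp,
    rotM_apply_unitDir]

theorem isContrDir_rotM_mul {P : Matrix (Fin 2) (Fin 2) ℝ} {θ t : ℝ} :
    IsContrDir (rotM θ * P) t ↔ IsContrDir P t := by
  rw [IsContrDir, IsContrDir, mnorm_rotM_mul, map_mul, mul_apply_eq_comp]
  have h : ∀ v, ‖Matrix.toEuclideanCLM (𝕜 := ℝ) (rotM θ) v‖ = ‖v‖ := by
    intro v
    have : ‖Matrix.toEuclideanCLM (𝕜 := ℝ) (rotM θ) v‖ ^ 2 = ‖v‖ ^ 2 := by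
      rw [norm_apply_sq, EuclideanSpace.norm_sq_eq, Fin.sum_univ_two]
      simp [rotM]
      linear_combination (v 0 ^ 2 + v 1 ^ 2) * sin_sq_add_cos_sq θ
    exact (pow_left_inj₀ (norm_nonneg _) (norm_nonneg _) two_ne_zero).1 this
  rw [h]

/-- Auxiliary denominator in the formula for the contracted direction. -/
def contrDen (e t s : ℝ) : ℝ :=
  (1 + t ^ 2) * (1 + s ^ 2) ^ 2 - e * (e * (1 - s ^ 2) + 2 * s * t * (1 + s ^ 2))

/-- Angle of the contracted direction in terms of slopes. -/
def contrAngle (e t s : ℝ) : ℝ :=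
  arctan s + 1 / 2 * arctan (2 * e * (s * e - t * (1 + s ^ 2)) * (contrDen e t s)⁻¹)

theorem contrAngle_zero (e : ℝ) : contrAngle e 0 0 = 0 := by simp [contrAngle]

theorem contrDen_pos {e t s : ℝ} (he : |e| ≤ 1 / 2) (ht : |t| ≤ 1 / 2) (hs : |s| ≤ 1 / 2) :
    0 < contrDen e t s := by
  unfold contrDen
  have h1 : e ^ 2 ≤ 1 / 4 := by nlinarith [abs_nonneg e, sq_abs e]
  have h3 : |e * s * t| ≤ 1 / 8 := by
    rw [abs_mul, abs_mul]
    calc |e| * |s| * |t| ≤ 1 / 2 * (1 / 2) * (1 / 2) := by gcongr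
      _ = 1 / 8 := by norm_num
  have h4 := (abs_le.1 h3).2
  have h5 : 0 ≤ s ^ 2 := sq_nonneg s
  have h6 : 0 ≤ t ^ 2 := sq_nonneg t
  have h7 : e * s * t * (1 + s ^ 2) ≤ 1 / 8 * (1 + s ^ 2) := by gcongr
  have h8 : 0 ≤ e ^ 2 * s ^ 2 := by positivity
  have h9 : 0 ≤ t ^ 2 * (1 + s ^ 2) ^ 2 := by positivity
  nlinarith [sq_nonneg (s ^ 2)]

theorem contrAngle_cos_sin {e t s : ℝ} (h : 0 < contrDen e t s) : ∃ D > 0,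
    (1 + t ^ 2) * (1 - s ^ 2) - e * (e - 2 * s * t) = D * cos (2 * contrAngle e t s) ∧
    2 * (s * (1 + t ^ 2) - t * e) = D * sin (2 * contrAngle e t s) := by
  set u := 2 * e * (s * e - t * (1 + s ^ 2)) * (contrDen e t s)⁻¹ with hu
  have hu' : u * contrDen e t s = 2 * e * (s * e - t * (1 + s ^ 2)) := by
    rw [hu, inv_mul_cancel_right₀ h.ne']
  have e1 : 2 * contrAngle e t s = 2 * arctan s + arctan u := by rw [contrAngle]; ring
  have hw : 0 < √(1 + u ^ 2) := sqrt_pos.2 (by positivity)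
  have hs1 : 0 < 1 + s ^ 2 := by positivity
  have c1 : cos (2 * arctan s) = (1 - s ^ 2) / (1 + s ^ 2) := by
    rw [cos_two_mul, cos_sq_arctan]; field_simp; ring
  have s1 : sin (2 * arctan s) = 2 * s / (1 + s ^ 2) := by
    have : sin (arctan s) = s * cos (arctan s) := by rw [sin_arctan, cos_arctan]; ring
    rw [sin_two_mul, this, show 2 * (s * cos (arctan s)) * cos (arctan s) =
      2 * s * cos (arctan s) ^ 2 by ring, cos_sq_arctan]; ring
  refine ⟨contrDen e t s * √(1 + u ^ 2) / (1 + s ^ 2), by positivity, ?_, ?_⟩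
  · rw [e1, cos_add, c1, s1, cos_arctan, sin_arctan]
    field_simp
    unfold contrDen at hu' ⊢
    linear_combination (2 * s) * hu'
  · rw [e1, sin_add, c1, s1, cos_arctan, sin_arctan]
    field_simp
    unfold contrDen at hu' ⊢
    linear_combination (-(1 - s ^ 2)) * hu'

theorem arctan_sub_bound {W : ℕ → ℝ} {x η : ℝ} {u v : ℝ → ℝ} (hW : JetWeight W)
    (hu : JetBound W x u (1 / 2)) (hv : JetBound W x v (1 / 2))
    (h : JetBound W x (fun z => u z - v z) η) (hη : η ≤ 1 / 4) :
    JetBound W x (fun z => arctan (u z) - arctan (v z)) (4 * η) := by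
  have h1 := (JetBound.inv_one_add hW (hu.mul hW hv) (by norm_num)).2
  have h2 := (h.mul hW h1).arctan hW (by linarith)
  refine (h2.congr ?_).mono (by linarith)
  have hc : ContinuousAt (fun z => 1 + u z * v z) x :=
    continuousAt_const.add (hu.smooth.continuousAt.mul hv.smooth.continuousAt)
  have h0 : 0 < 1 + u x * v x := by
    have := ((hu.mul hW hv).abs_apply_le hW)
    have := (abs_le.1 this).1
    linarith
  filter_upwards [hc.eventually (lt_mem_nhds h0)] with z hz
  have : arctan (u z) + arctan (-v z) = arctan ((u z + -v z) / (1 - u z * -v z)) :=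
    arctan_add (by linarith)
  rw [arctan_neg] at this
  rw [sub_eq_add_neg, this]
  congr 1
  rw [div_eq_mul_inv]; ring_nf

theorem contrAngle_bound {W : ℕ → ℝ} {x η : ℝ} {i t s : ℝ → ℝ} (hW : JetWeight W)
    (hi : JetBound W x i η) (hη : η ≤ 1 / 10) (ht : JetBound W x t (1 / 10))
    (hs : JetBound W x s (1 / 10)) :
    JetBound W x (fun z => contrAngle (i z ^ 2) (t z) (s z) - arctan (s z)) (η ^ 2) := by
  have hη0 := hi.nonneg
  have hη2 : η ^ 2 ≤ 1 / 100 := by nlinarith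
  have he := hi.sq hW
  have one : JetBound W x (fun _ => (1 : ℝ)) 1 := by simpa using JetBound.const hW (1 : ℝ) (x := x)
  have hs2 := hs.sq hW
  have ht2 := ht.sq hW
  have hd : JetBound W x (fun z => t z ^ 2 + (s z ^ 2 * (s z ^ 2 + 2 * 1)) * (1 + t z ^ 2) -
      i z ^ 2 * (i z ^ 2 * (1 - s z ^ 2) + 2 * s z * t z * (1 + s z ^ 2))) (1 / 2) := by
    refine ((ht2.add hW ((hs2.mul hW (hs2.add hW (one.const_mul hW 2))).mul hW
      (one.add hW ht2))).sub hW (he.mul hW ((he.mul hW (one.sub hW hs2)).add hW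
      (((hs.const_mul hW 2).mul hW ht).mul hW (one.add hW hs2))))).mono ?_
    norm_num
    nlinarith
  have hden := (JetBound.inv_one_add hW hd le_rfl).2
  have hu := (((he.const_mul hW 2).mul hW ((hs.mul hW he).sub hW
    (ht.mul hW (one.add hW hs2)))).mul hW hden).mono (B' := η ^ 2) (by
      norm_num
      nlinarith)
  refine (((hu.arctan hW (by linarith)).const_mul hW (1 / 2)).congr
    (Filter.Eventually.of_forall fun z => ?_)).mono
    (by rw [abs_of_pos (by norm_num)]; linarith)
  simp only [contrAngle, contrDen, add_sub_cancel_left]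
  congr 4
  ring


theorem turn_eq_rotM (φ : ℝ → ℝ) (x : ℝ) : turn φ x = rotM (π / 2 - φ x) := by
  simp [turn, rotM, cos_pi_div_two_sub, sin_pi_div_two_sub]

theorem turn_inv (φ : ℝ → ℝ) (x : ℝ) : (turn φ x)⁻¹ = rotM (-(π / 2 - φ x)) := by
  rw [Matrix.inv_def, turn_det, Ring.inverse_one, one_smul, Matrix.adjugate_fin_two, rotM,
    cos_neg, sin_neg, cos_pi_div_two_sub, sin_pi_div_two_sub]
  simp [turn]

/-- Correction angle of the forward contracted direction along `k` steps. -/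
def fwdAngle (lam α : ℝ) (φ : ℝ → ℝ) (k : ℕ) (x : ℝ) : ℝ :=
  contrAngle (segInv lam α φ k x ^ 2) (segT lam α φ k x) (segS lam α φ k x)

/-- Correction angle of the backward contracted direction along `k` steps ending at `x`. -/
def bwdAngle (lam α : ℝ) (φ : ℝ → ℝ) (k : ℕ) (x : ℝ) : ℝ :=
  contrAngle (segInv lam α φ k (x - 2 * π * k * α) ^ 2) (segS lam α φ k (x - 2 * π * k * α))
    (segT lam α φ k (x - 2 * π * k * α))

theorem isContrDir_fwd {lam α : ℝ} {φ : ℝ → ℝ} (hl : lam ≠ 0) {k : ℕ} (hk : 1 ≤ k) {x : ℝ}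
    (ha : segMat lam α φ k x 0 0 ≠ 0) (hd : 0 < contrDen (segInv lam α φ k x ^ 2)
      (segT lam α φ k x) (segS lam α φ k x)) :
    IsContrDir (cocycleIter α (Amat lam φ) k x) (φ x - fwdAngle lam α φ k x) := by
  rw [cocycleIter_eq hk, turn_eq_rotM, isContrDir_mul_rotM]
  obtain ⟨D, hD, h1, h2⟩ := contrAngle_cos_sin hd
  have hdet := segMat_det' (α := α) (φ := φ) hl k x
  refine isContrDir_of (segMat_det hl k x) (D := segMat lam α φ k x 0 0 ^ 2 * D / 2)
    (by positivity) ?_ ?_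
  · rw [show 2 * (φ x - fwdAngle lam α φ k x + (π / 2 - φ x)) =
      π - 2 * fwdAngle lam α φ k x by ring, cos_pi_sub, mul_neg, neg_neg, mul_div_right_comm,
      mul_assoc, fwdAngle, ← h1]
    unfold segT segS segInv
    generalize segMat lam α φ k x 0 0 = a at *
    generalize segMat lam α φ k x 0 1 = b at *
    generalize segMat lam α φ k x 1 0 = c at *
    generalize segMat lam α φ k x 1 1 = d at *
    have hd : d = (1 + b * c) / a := by field_simp; linarith
    rw [hd]
    field_simp
    ring
  · rw [show 2 * (φ x - fwdAngle lam α φ k x + (π / 2 - φ x)) =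
      π - 2 * fwdAngle lam α φ k x by ring, sin_pi_sub, mul_div_right_comm,
      mul_assoc, fwdAngle, ← h2]
    unfold segT segS segInv
    generalize segMat lam α φ k x 0 0 = a at *
    generalize segMat lam α φ k x 0 1 = b at *
    generalize segMat lam α φ k x 1 0 = c at *
    generalize segMat lam α φ k x 1 1 = d at *
    have hd : d = (1 + b * c) / a := by field_simp; linarith
    rw [hd]
    field_simp
    ring

theorem isContrDir_bwd {lam α : ℝ} {φ : ℝ → ℝ} (hl : lam ≠ 0) {k : ℕ} (hk : 1 ≤ k) {x : ℝ}
    (ha : segMat lam α φ k (x - 2 * π * k * α) 0 0 ≠ 0)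
    (hd : 0 < contrDen (segInv lam α φ k (x - 2 * π * k * α) ^ 2)
      (segS lam α φ k (x - 2 * π * k * α)) (segT lam α φ k (x - 2 * π * k * α))) :
    IsContrDir (cocycleIterNeg α (Amat lam φ) k x) (bwdAngle lam α φ k x) := by
  rw [cocycleIterNeg, cocycleIter_eq hk, Matrix.mul_inv_rev, turn_inv, isContrDir_rotM_mul]
  unfold bwdAngle
  generalize x - 2 * π * k * α = x at *
  obtain ⟨D, hD, h1, h2⟩ := contrAngle_cos_sin hd
  have hdet := segMat_det' (α := α) (φ := φ) hl k x
  have hi : (segMat lam α φ k x)⁻¹ = !![segMat lam α φ k x 1 1, -segMat lam α φ k x 0 1;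
      -segMat lam α φ k x 1 0, segMat lam α φ k x 0 0] := by
    rw [Matrix.inv_def, segMat_det hl, Ring.inverse_one, one_smul, Matrix.adjugate_fin_two]
  refine isContrDir_of (D := segMat lam α φ k x 0 0 ^ 2 * D / 2) ?_ (by positivity) ?_ ?_
  · rw [Matrix.det_nonsing_inv, segMat_det hl, Ring.inverse_one]
  · rw [mul_div_right_comm, mul_assoc, ← h1, hi]
    simp only [Matrix.of_apply, Matrix.cons_val', Matrix.cons_val_zero, Matrix.cons_val_one,
      Matrix.cons_val_fin_one]
    unfold segT segS segInv
    generalize segMat lam α φ k x 0 0 = a at *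
    generalize segMat lam α φ k x 0 1 = b at *
    generalize segMat lam α φ k x 1 0 = c at *
    generalize segMat lam α φ k x 1 1 = d at *
    have hd : d = (1 + b * c) / a := by field_simp; linarith
    rw [hd]
    field_simp
    ring
  · rw [mul_div_right_comm, mul_assoc, ← h2, hi]
    simp only [Matrix.of_apply, Matrix.cons_val', Matrix.cons_val_zero, Matrix.cons_val_one,
      Matrix.cons_val_fin_one]
    unfold segT segS segInv
    generalize segMat lam α φ k x 0 0 = a at *
    generalize segMat lam α φ k x 0 1 = b at *
    generalize segMat lam α φ k x 1 0 = c at *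
    generalize segMat lam α φ k x 1 1 = d at *
    have hd : d = (1 + b * c) / a := by field_simp; linarith
    rw [hd]
    field_simp
    ring

/-! ### Return times -/

/-- Quantitative properties of a minimal return time. -/
structure ReturnSpec (α M c₁ r : ℝ) (R : ℕ) : Prop where
  pos : 1 ≤ R
  le : (R : ℝ) ≤ 16 * M / r
  ge : 1 / (8 * M) / r ≤ R
  interior : ∀ x, critDist c₁ x ≤ r → ∀ i : ℕ, 0 < i → i < R → r < critDist c₁ (x + 2 * π * i * α)
  near : ∀ x, critDist c₁ x ≤ r → critDist c₁ (x + 2 * π * R * α) ≤ 3 * r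

theorem fwdRet_spec {α c₁ r : ℝ} {x : ℝ}
    (hne : ∃ j : ℕ, 1 ≤ j ∧ critDist c₁ (x + 2 * π * j * α) ≤ r) :
    1 ≤ fwdRet α (critSet c₁ r) x ∧
    critDist c₁ (x + 2 * π * fwdRet α (critSet c₁ r) x * α) ≤ r ∧
    ∀ i : ℕ, 0 < i → i < fwdRet α (critSet c₁ r) x → r < critDist c₁ (x + 2 * π * i * α) := by
  obtain ⟨j, hj1, hj⟩ := hne
  have hmem := Nat.sInf_mem (s := {i : ℕ | 0 < i ∧ InCircle (critSet c₁ r) (x + 2 * π * i * α)})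
    ⟨j, hj1, (inCircle_critSet_iff c₁ r _).2 hj⟩
  refine ⟨hmem.1, (inCircle_critSet_iff c₁ r _).1 hmem.2, fun i h0 hi => ?_⟩
  by_contra! h
  exact Nat.notMem_of_lt_sInf hi ⟨h0, (inCircle_critSet_iff c₁ r _).2 h⟩

theorem critDist_le_add_two_mul {c₁ r x x₀ u : ℝ} (hx : critDist c₁ x ≤ r)
    (hx₀ : critDist c₁ x₀ ≤ r) : critDist c₁ (x + u) ≤ critDist c₁ (x₀ + u) + 2 * r := by
  have e : x + u = x₀ + u + (critFold c₁ x - critFold c₁ x₀) +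
      (round ((x - c₁) / π) - round ((x₀ - c₁) / π) : ℤ) * π := by
    unfold critFold; push_cast; ring
  rw [e, critDist_add_int_mul_pi]
  refine (critDist_add_le _ _ _).trans ?_
  rw [← abs_critFold] at hx hx₀
  linarith [abs_sub (critFold c₁ x) (critFold c₁ x₀)]

theorem returnSpec_of {α M c₁ r : ℝ} (hM : 1 ≤ M) (hr : 0 < r) (hr1 : r ≤ 1)
    (hnear : ∀ x δ : ℝ, 0 < δ → δ ≤ 1 → ∃ j : ℕ, 1 ≤ j ∧ (j : ℝ) ≤ 16 * M / δ ∧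
      critDist c₁ (x + 2 * π * j * α) ≤ δ)
    (hsep : ∀ (x : ℝ) (j : ℕ), 1 ≤ j →
      1 / (4 * M * j) ≤ critDist c₁ x + critDist c₁ (x + 2 * π * j * α)) :
    ReturnSpec α M c₁ r (minFwdRet α (critSet c₁ r)) := by
  have hfwd : ∀ x, ∃ j : ℕ, 1 ≤ j ∧ critDist c₁ (x + 2 * π * j * α) ≤ r := fun x => by
    obtain ⟨j, h1, -, h2⟩ := hnear x r hr hr1
    exact ⟨j, h1, h2⟩
  have hc : c₁ ∈ critSet c₁ r := Or.inl ⟨by linarith, by linarith⟩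
  have hdist : ∀ x ∈ critSet c₁ r, critDist c₁ x ≤ r := fun x hx =>
    (inCircle_critSet_iff c₁ r x).1 ⟨0, by simpa using hx⟩
  obtain ⟨x₀, hx₀, hR⟩ := Nat.sInf_mem (s := {m : ℕ | ∃ x ∈ critSet c₁ r,
    m = fwdRet α (critSet c₁ r) x}) ⟨_, c₁, hc, rfl⟩
  change minFwdRet α (critSet c₁ r) = _ at hR
  obtain ⟨h1, h2, -⟩ := fwdRet_spec (hfwd x₀)
  rw [← hR] at h1 h2
  have hle : ∀ x ∈ critSet c₁ r, minFwdRet α (critSet c₁ r) ≤ fwdRet α (critSet c₁ r) x :=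
    fun x hx => Nat.sInf_le ⟨x, hx, rfl⟩
  have hRpos : (0 : ℝ) < minFwdRet α (critSet c₁ r) := by exact_mod_cast h1
  refine ⟨h1, ?_, ?_, ?_, ?_⟩
  · obtain ⟨j, hj1, hj2, hj⟩ := hnear c₁ r hr hr1
    refine le_trans ?_ hj2
    exact_mod_cast (hle c₁ hc).trans (Nat.sInf_le ⟨hj1, (inCircle_critSet_iff c₁ r _).2 hj⟩)
  · have h3 := (hsep x₀ _ h1).trans (add_le_add (hdist x₀ hx₀) h2)
    rw [div_le_iff₀ (by positivity)] at h3
    rw [div_div, div_le_iff₀ (by positivity)]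
    nlinarith
  · intro x hx i h0 hi
    obtain ⟨k, hk⟩ := (inCircle_critSet_iff c₁ r x).2 hx
    have h3 := (fwdRet_spec (hfwd (x - 2 * π * k))).2.2 i h0 (hi.trans_le (hle _ hk))
    rwa [show x - 2 * π * k + 2 * π * i * α = x + 2 * π * i * α + (-(2 * k) : ℤ) * π by
      push_cast; ring, critDist_add_int_mul_pi] at h3
  · intro x hx
    have := critDist_le_add_two_mul (u := 2 * π * minFwdRet α (critSet c₁ r) * α) hx (hdist x₀ hx₀)
    linarith

theorem returnSpec_fwd {α M c₁ r : ℝ} (hα : Irrational α) (hM : 1 ≤ M) (hb : BoundedType α M)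
    (hr : 0 < r) (hr1 : r ≤ 1) : ReturnSpec α M c₁ r (minFwdRet α (critSet c₁ r)) :=
  returnSpec_of hM hr hr1 (fun x _ h h' => exists_critDist_le_fwd hα hM hb c₁ x h h')
    (fun x _ hj => critDist_separated hα hM hb c₁ x hj)

theorem returnSpec_bwd {α M c₁ r : ℝ} (hα : Irrational α) (hM : 1 ≤ M) (hb : BoundedType α M)
    (hr : 0 < r) (hr1 : r ≤ 1) : ReturnSpec (-α) M c₁ r (minBwdRet α (critSet c₁ r)) := by
  have e : minBwdRet α (critSet c₁ r) = minFwdRet (-α) (critSet c₁ r) := by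
    unfold minBwdRet minFwdRet bwdRet fwdRet
    simp only [mul_neg, sub_eq_add_neg]
  rw [e]
  refine returnSpec_of hM hr hr1 (fun x δ h h' => ?_) (fun x j hj => ?_)
  · simpa [sub_eq_add_neg] using exists_critDist_le_bwd hα hM hb c₁ x h h'
  · have := critDist_separated hα hM hb c₁ (x + 2 * π * j * -α) hj
    rwa [show x + 2 * π * j * -α + 2 * π * j * α = x by ring, add_comm] at this

theorem ReturnSpec.goodSeg_fwd {α M c₁ r δ₀ : ℝ} {R : ℕ} (h : ReturnSpec α M c₁ r R)
    (hδ : δ₀ ≤ r) {x : ℝ} (hx : critDist c₁ x ≤ r) : GoodSeg α c₁ δ₀ R x := by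
  intro j h0 hj
  have h1 := h.interior x hx j h0 hj
  have h2 := h.near x hx
  exact ⟨by linarith, by linarith [critDist_nonneg c₁ x], by linarith⟩

theorem ReturnSpec.interior_bwd {α M c₁ r : ℝ} {R : ℕ} (h : ReturnSpec (-α) M c₁ r R)
    {x : ℝ} (hx : critDist c₁ x ≤ r) {j : ℕ} (h0 : 0 < j) (hj : j < R) :
    r < critDist c₁ (x - 2 * π * R * α + 2 * π * j * α) := by
  have h1 := h.interior x hx (R - j) (by omega) (by omega)
  rwa [Nat.cast_sub hj.le, show x + 2 * π * ((R : ℝ) - j) * -α =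
    x - 2 * π * R * α + 2 * π * j * α by ring] at h1

theorem ReturnSpec.goodSeg_bwd {α M c₁ r δ₀ : ℝ} {R : ℕ} (h : ReturnSpec (-α) M c₁ r R)
    (hδ : δ₀ ≤ r) {x : ℝ} (hx : critDist c₁ x ≤ r) :
    GoodSeg α c₁ δ₀ R (x - 2 * π * R * α) := by
  intro j h0 hj
  have h1 := h.interior_bwd hx h0 hj
  have h2 := h.near x hx
  rw [show x + 2 * π * R * -α = x - 2 * π * R * α by ring] at h2
  rw [show x - 2 * π * R * α + 2 * π * R * α = x by ring]
  exact ⟨by linarith, by linarith, by linarith [critDist_nonneg c₁ x]⟩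

section

/-! ### Hyperbolicity of return blocks -/

theorem exists_extension {M r r₀ : ℝ} {D : ℕ → ℝ} (hM : 1 ≤ M) (hr : 0 < r) (hr₀ : r₀ ≤ 1)
    {i k : ℕ} (hik : i ≤ k) (h0 : D 0 ≤ r) (hk : D k ≤ r)
    (hint : ∀ j, 0 < j → j < k → r < D j)
    (hsep : ∀ j : ℕ, 1 ≤ j → 1 / (4 * M * j) ≤ D 0 + D j)
    (hnear : ∀ δ : ℝ, 0 < δ → δ ≤ 1 → ∃ j : ℕ, 1 ≤ j ∧ (j : ℝ) ≤ 16 * M / δ ∧ D (i + j) ≤ δ) :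
    (∀ j, 0 < j → j < i → r₀ < D j) ∨ ∃ m : ℕ, i + m ≤ k ∧
      ((i + m : ℕ) : ℝ) ≤ (1 + 128 * M ^ 2) * i ∧
      ∀ j, 0 < j → j < i + m → r < D j ∧ D (i + m) ≤ D j := by
  by_cases hv : ∀ j, 0 < j → j < i → r₀ < D j
  · exact Or.inl hv
  right
  push Not at hv
  obtain ⟨j₀, hj0, hj1, hj2⟩ := hv
  obtain ⟨j₁, hj₁, hmin⟩ := Finset.exists_min_image (Finset.Ioo 0 i) D
    ⟨j₀, Finset.mem_Ioo.2 ⟨hj0, hj1⟩⟩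
  rw [Finset.mem_Ioo] at hj₁
  have hd1 : r < D j₁ := hint j₁ hj₁.1 (by omega)
  have hd2 : D j₁ ≤ 1 := (hmin j₀ (Finset.mem_Ioo.2 ⟨hj0, hj1⟩)).trans (hj2.trans hr₀)
  have hd0 : 0 < D j₁ := hr.trans hd1
  obtain ⟨j, -, hj, hDj⟩ := hnear (D j₁) hd0 hd2
  have hex : ∃ m, D (i + m) ≤ D j₁ := ⟨j, hDj⟩
  classical
  refine ⟨Nat.find hex, ?_, ?_, fun a ha0 ha => ?_⟩
  · have : Nat.find hex ≤ k - i := Nat.find_le (by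
      rw [show i + (k - i) = k by omega]; linarith)
    omega
  · have h1 : (Nat.find hex : ℝ) ≤ j := by exact_mod_cast Nat.find_le hDj
    have h2 := hsep j₁ hj₁.1
    have hp : (0 : ℝ) < j₁ := by exact_mod_cast hj₁.1
    rw [div_le_iff₀ (by positivity)] at h2
    have h3 : (j₁ : ℝ) ≤ i := by exact_mod_cast hj₁.2.le
    have h4 : 1 ≤ 2 * D j₁ * (4 * M * i) := h2.trans (by gcongr; linarith)
    have h5 : 16 * M / D j₁ ≤ 128 * M ^ 2 * i := by
      rw [div_le_iff₀ hd0]; nlinarith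
    push_cast
    linarith
  · have hfind := Nat.find_spec hex
    have hik' : i + Nat.find hex ≤ k := by
      have : Nat.find hex ≤ k - i := Nat.find_le (by
        rw [show i + (k - i) = k by omega]; linarith)
      omega
    refine ⟨hint a ha0 (by omega), ?_⟩
    rcases lt_or_ge a i with h | h
    · exact hfind.trans (hmin a (Finset.mem_Ioo.2 ⟨ha0, h⟩))
    · have := Nat.find_min hex (m := a - i) (by omega)
      rw [show i + (a - i) = a by omega] at this
      linarith

theorem mnorm_stretch_le {ℓ : ℝ} (hℓ : 0 ≤ ℓ) : mnorm (stretch (exp ℓ)) ≤ exp ℓ := by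
  refine ContinuousLinearMap.opNorm_le_bound _ (exp_pos ℓ).le fun v => ?_
  refine abs_le_of_sq_le_sq' ?_ (by positivity) |>.2
  rw [norm_apply_sq, mul_pow, EuclideanSpace.norm_sq_eq, Fin.sum_univ_two]
  have h1 : (exp ℓ)⁻¹ ≤ exp ℓ := by rw [← exp_neg]; exact exp_le_exp.2 (by linarith)
  have h2 : (exp ℓ)⁻¹ ^ 2 ≤ exp ℓ ^ 2 := by gcongr
  simp only [stretch, norm_eq_abs, sq_abs, Matrix.of_apply, Matrix.cons_val', Matrix.cons_val_zero,
    Matrix.cons_val_one, Matrix.cons_val_fin_one]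
  nlinarith [mul_le_mul_of_nonneg_right h2 (sq_nonneg (v 1))]

theorem mnorm_turn_mul (φ : ℝ → ℝ) (x : ℝ) (P : Matrix (Fin 2) (Fin 2) ℝ) :
    mnorm (turn φ x * P) = mnorm P := by rw [turn_eq_rotM, mnorm_rotM_mul]

theorem mnorm_mul_turn (φ : ℝ → ℝ) (x : ℝ) (P : Matrix (Fin 2) (Fin 2) ℝ) :
    mnorm (P * turn φ x) = mnorm P := by rw [turn_eq_rotM, mnorm_mul_rotM]

theorem mnorm_segMat_le {ℓ α : ℝ} {φ : ℝ → ℝ} (hℓ : 0 ≤ ℓ) {k : ℕ} (hk : 1 ≤ k) (x : ℝ) :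
    mnorm (segMat (exp ℓ) α φ k x) ≤ exp ℓ ^ k := by
  induction k, hk using Nat.le_induction with
  | base => simpa [segMat_one] using mnorm_stretch_le hℓ
  | succ k hk ih =>
    rw [segMat_succ hk, Matrix.mul_assoc, pow_succ']
    refine (mnorm_mul_le _ _).trans ?_
    rw [mnorm_turn_mul]
    exact mul_le_mul (mnorm_stretch_le hℓ) ih (norm_nonneg _) (exp_pos ℓ).le

theorem le_mnorm_segMat {W : ℕ → ℝ} {ℓ α A ν : ℝ} {φ : ℝ → ℝ} {k : ℕ} {x : ℝ} (hW : JetWeight W)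
    (hA : 0 ≤ A) (h : SegBound W ℓ α φ A ν k x) :
    exp (k * ℓ - A * k) ≤ mnorm (segMat (exp ℓ) α φ k x) := by
  refine le_trans ?_ (abs_apply_le_mnorm _)
  have h1 := (h.inv' hA).abs_apply_le hW
  rw [segInv, abs_inv] at h1
  rw [show k * ℓ - A * k = -(-(k * ℓ) + A * k) by ring, exp_neg]
  exact inv_le_of_inv_le₀ (abs_pos.2 h.ne) h1

theorem le_mnorm_segMat_of_extension {W : ℕ → ℝ} {ℓ α A ν a : ℝ} {φ : ℝ → ℝ} {i m : ℕ} {x y : ℝ}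
    (hW : JetWeight W) (hA : 0 ≤ A) (h : SegBound W ℓ α φ A ν (i + m) y)
    (ha : ((i + m : ℕ) : ℝ) ≤ a * i)
    (hle : mnorm (segMat (exp ℓ) α φ (i + m) y) ≤ exp ℓ ^ m * mnorm (segMat (exp ℓ) α φ i x)) :
    exp (i * ℓ - A * a * i) ≤ mnorm (segMat (exp ℓ) α φ i x) := by
  have h1 := (le_mnorm_segMat hW hA h).trans hle
  rw [← exp_nat_mul] at h1
  refine le_of_mul_le_mul_left (le_trans ?_ h1) (exp_pos (m * ℓ))
  rw [← exp_add, exp_le_exp]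
  have := mul_le_mul_of_nonneg_left ha hA
  push_cast at this ⊢
  linarith

theorem le_mnorm_of_trivial {α M ℓ A c₁ r₀ : ℝ} {φ : ℝ → ℝ} (hM : 1 ≤ M)
    (hA : 0 ≤ A) (hφ : ∀ y, r₀ < critDist c₁ y → φ y = π / 2) {i : ℕ} (hi : 1 ≤ i) {x : ℝ}
    (h : ∀ j : ℕ, 0 < j → j < i → r₀ < critDist c₁ (x + 2 * π * j * α)) :
    exp (i * ℓ - A * (1 + 128 * M ^ 2) * i) ≤ mnorm (segMat (exp ℓ) α φ i x) := by
  refine le_trans ?_ (abs_apply_le_mnorm _)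
  rw [segMat_of_trivial hi fun j h0 hj => hφ _ (h j h0 hj)]
  simp only [Matrix.of_apply, Matrix.cons_val', Matrix.cons_val_zero, Matrix.cons_val_fin_one]
  rw [abs_of_pos (by positivity), ← exp_nat_mul, exp_le_exp]
  have : 0 ≤ A * (1 + 128 * M ^ 2) * i := by positivity
  linarith

theorem le_mnorm_fwd {W : ℕ → ℝ} {α M ν ℓ A c₁ r r₀ : ℝ} {φ : ℝ → ℝ}
    (hα : Irrational α) (hM : 1 ≤ M) (hb : BoundedType α M) (hr : 0 < r) (hr₀ : r₀ ≤ 1)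
    (hW : JetWeight W) (hA : 0 ≤ A) (hℓ : 0 ≤ ℓ) (hφ : ∀ y, r₀ < critDist c₁ y → φ y = π / 2)
    (hseg : ∀ (k : ℕ) (x : ℝ), 1 ≤ k → GoodSeg α c₁ r k x → SegBound W ℓ α φ A ν k x)
    {i k : ℕ} (hi : 1 ≤ i) (hik : i ≤ k) {x : ℝ} (hx : critDist c₁ x ≤ r)
    (hk : critDist c₁ (x + 2 * π * k * α) ≤ r)
    (hint : ∀ j : ℕ, 0 < j → j < k → r < critDist c₁ (x + 2 * π * j * α)) :
    exp (i * ℓ - A * (1 + 128 * M ^ 2) * i) ≤ mnorm (segMat (exp ℓ) α φ i x) := by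
  rcases exists_extension (D := fun j : ℕ => critDist c₁ (x + 2 * π * j * α)) hM hr hr₀ hik
    (by simpa using hx) hk hint
    (fun j hj => by simpa using critDist_separated hα hM hb c₁ x hj)
    (fun δ h h' => by
      obtain ⟨j, h1, h2, h3⟩ := exists_critDist_le_fwd hα hM hb c₁ (x + 2 * π * i * α) h h'
      refine ⟨j, h1, h2, ?_⟩
      rw [show x + 2 * π * ((i + j : ℕ) : ℝ) * α = x + 2 * π * i * α + 2 * π * j * α by
        push_cast; ring]
      exact h3) with h | ⟨m, hm, hle, h⟩
  · exact le_mnorm_of_trivial hM hA hφ hi h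
  · refine le_mnorm_segMat_of_extension hW hA (hseg (i + m) x (by omega) fun j h0 hj => ?_) hle ?_
    · have h1 := h j h0 hj
      exact ⟨h1.1, by linarith [critDist_nonneg c₁ x],
        by linarith [critDist_nonneg c₁ (x + 2 * π * j * α)]⟩
    · rcases Nat.eq_zero_or_pos m with rfl | hm0
      · simp
      · rw [segMat_add hi hm0, Matrix.mul_assoc]
        refine (mnorm_mul_le _ _).trans ?_
        rw [mnorm_turn_mul]
        exact mul_le_mul_of_nonneg_right (mnorm_segMat_le hℓ hm0 _) (norm_nonneg _)

theorem le_mnorm_bwd {W : ℕ → ℝ} {α M ν ℓ A c₁ r r₀ : ℝ} {φ : ℝ → ℝ}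
    (hα : Irrational α) (hM : 1 ≤ M) (hb : BoundedType α M) (hr : 0 < r) (hr₀ : r₀ ≤ 1)
    (hW : JetWeight W) (hA : 0 ≤ A) (hℓ : 0 ≤ ℓ) (hφ : ∀ y, r₀ < critDist c₁ y → φ y = π / 2)
    (hseg : ∀ (k : ℕ) (x : ℝ), 1 ≤ k → GoodSeg α c₁ r k x → SegBound W ℓ α φ A ν k x)
    {i k : ℕ} (hi : 1 ≤ i) (hik : i ≤ k) {z : ℝ} (hz : critDist c₁ z ≤ r)
    (hk : critDist c₁ (z - 2 * π * k * α) ≤ r)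
    (hint : ∀ j : ℕ, 0 < j → j < k → r < critDist c₁ (z - 2 * π * j * α)) :
    exp (i * ℓ - A * (1 + 128 * M ^ 2) * i) ≤
      mnorm (segMat (exp ℓ) α φ i (z - 2 * π * i * α)) := by
  rcases exists_extension (D := fun j : ℕ => critDist c₁ (z - 2 * π * j * α)) hM hr hr₀ hik
    (by simpa using hz) hk hint
    (fun j hj => by
      have := critDist_separated hα hM hb c₁ (z - 2 * π * j * α) hj
      rw [sub_add_cancel, add_comm] at this
      simpa using this)
    (fun δ h h' => by
      obtain ⟨j, h1, h2, h3⟩ := exists_critDist_le_bwd hα hM hb c₁ (z - 2 * π * i * α) h h'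
      refine ⟨j, h1, h2, ?_⟩
      rw [show z - 2 * π * ((i + j : ℕ) : ℝ) * α = z - 2 * π * i * α - 2 * π * j * α by
        push_cast; ring]
      exact h3) with h | ⟨m, hm, hle, h⟩
  · refine le_mnorm_of_trivial hM hA hφ hi fun j h0 hj => ?_
    have := h (i - j) (by omega) (by omega)
    rwa [Nat.cast_sub hj.le, show z - 2 * π * ((i : ℝ) - j) * α =
      z - 2 * π * i * α + 2 * π * j * α by ring] at this
  · refine le_mnorm_segMat_of_extension hW hA (hseg (i + m) (z - 2 * π * (i + m : ℕ) * α)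
      (by omega) fun j h0 hj => ?_) hle ?_
    · have h1 := h (i + m - j) (by omega) (by omega)
      rw [Nat.cast_sub hj.le, show z - 2 * π * (((i + m : ℕ) : ℝ) - j) * α =
        z - 2 * π * (i + m : ℕ) * α + 2 * π * j * α by ring] at h1
      have h2 : critDist c₁ (z - 2 * π * (i + m : ℕ) * α + 2 * π * (i + m : ℕ) * α) ≤ r := by
        rwa [sub_add_cancel]
      exact ⟨h1.1, by linarith [critDist_nonneg c₁ (z - 2 * π * (i + m : ℕ) * α)],
        by linarith⟩
    · rcases Nat.eq_zero_or_pos m with rfl | hm0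
      · simp
      · have e : z - 2 * π * (i + m : ℕ) * α + 2 * π * m * α = z - 2 * π * i * α := by
          push_cast; ring
        rw [add_comm i m] at e ⊢
        rw [segMat_add hm0 hi, e, Matrix.mul_assoc]
        refine (mnorm_mul_le _ _).trans ?_
        rw [mnorm_turn_mul, mul_comm]
        exact mul_le_mul_of_nonneg_right (mnorm_segMat_le hℓ hm0 _) (norm_nonneg _)

theorem cocycleIter_succ' (α : ℝ) (A : ℝ → Matrix (Fin 2) (Fin 2) ℝ) (n : ℕ) (x : ℝ) :
    cocycleIter α A (n + 1) x = cocycleIter α A n (x + 2 * π * α) * A x := by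
  induction n with
  | zero => simp [cocycleIter]
  | succ n ih =>
    rw [cocycleIter, ih, cocycleIter, Matrix.mul_assoc]
    congr 2
    push_cast; ring

theorem blockProd_eq (α : ℝ) (A : ℝ → Matrix (Fin 2) (Fin 2) ℝ) (x : ℝ) (i : ℕ) :
    blockProd (fun j => A (x + 2 * π * j * α)) i = cocycleIter α A i x := by
  induction i with
  | zero => rfl
  | succ i ih => rw [blockProd, ih, cocycleIter]

theorem blockProd_inv_eq (α : ℝ) (A : ℝ → Matrix (Fin 2) (Fin 2) ℝ) (x : ℝ) {i n : ℕ}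
    (hi : i ≤ n) : blockProd (fun j => (A (x + 2 * π * (n - 1 - j : ℕ) * α))⁻¹) i =
      (cocycleIter α A i (x + 2 * π * (n : ℝ) * α - 2 * π * i * α))⁻¹ := by
  induction i with
  | zero => simp [blockProd, cocycleIter]
  | succ i ih =>
    rw [blockProd, ih (by omega), cocycleIter_succ', Matrix.mul_inv_rev]
    have e : ((n - 1 - i : ℕ) : ℝ) = n - 1 - i := by
      rw [Nat.sub_sub, Nat.cast_sub (by omega)]; push_cast; ring
    rw [e]
    congr 3 <;> push_cast <;> ring_nf

theorem isHypBlock_fwdRet {W : ℕ → ℝ} {α M ν ℓ A c₁ r r₀ m ε : ℝ} {φ : ℝ → ℝ}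
    (hα : Irrational α) (hM : 1 ≤ M)
    (hb : BoundedType α M) (hr : 0 < r) (hr1 : r ≤ 1) (hr₀ : r₀ ≤ 1) (hW : JetWeight W)
    (hA : 0 ≤ A) (hℓ : 0 ≤ ℓ)
    (hφ : ∀ y, r₀ < critDist c₁ y → φ y = π / 2)
    (hseg : ∀ (k : ℕ) (x : ℝ), 1 ≤ k → GoodSeg α c₁ r k x → SegBound W ℓ α φ A ν k x)
    (hε : 0 ≤ ε) (hε1 : ε ≤ 1) (hm : m ≤ (1 - ε) * ℓ) (hAℓ : A * (1 + 128 * M ^ 2) ≤ ε * ℓ)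
    {x : ℝ} (hx : critDist c₁ x ≤ r) :
    IsHypBlock (exp ℓ) (exp m) ε (fwdRet α (critSet c₁ r) x)
      (fun i => Amat (exp ℓ) φ (x + 2 * π * i * α)) := by
  obtain ⟨-, hk, hint⟩ := fwdRet_spec (α := α) (c₁ := c₁) (r := r) (x := x) (by
    obtain ⟨j, h1, -, h2⟩ := exists_critDist_le_fwd hα hM hb c₁ x hr hr1
    exact ⟨j, h1, h2⟩)
  set k := fwdRet α (critSet c₁ r) x
  have hA1 : ∀ y, mnorm (Amat (exp ℓ) φ y) ≤ exp ℓ := fun y => by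
    rw [Amat_eq, mnorm_mul_turn]; exact mnorm_stretch_le hℓ
  have hdet : ∀ i y, (cocycleIter α (Amat (exp ℓ) φ) i y).det = 1 := fun i y => by
    rcases Nat.eq_zero_or_pos i with rfl | hi
    · simp [cocycleIter]
    · rw [cocycleIter_eq hi, Matrix.det_mul, turn_det, segMat_det (exp_pos ℓ).ne', one_mul]
  have hpow : ∀ i : ℕ, exp m ^ ((i : ℝ) * (1 - ε)) ≤
      exp (i * ℓ - A * (1 + 128 * M ^ 2) * i) := fun i => by
    rw [← exp_mul, exp_le_exp]
    have h1 : m * (i * (1 - ε)) ≤ (1 - ε) * ℓ * (i * (1 - ε)) :=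
      mul_le_mul_of_nonneg_right hm (mul_nonneg (Nat.cast_nonneg i) (by linarith))
    have h2 := mul_le_mul_of_nonneg_right hAℓ (Nat.cast_nonneg (α := ℝ) i)
    have h3 : 0 ≤ ε * (1 - ε) * ℓ * i := by
      have : 0 ≤ 1 - ε := by linarith
      positivity
    nlinarith
  refine ⟨fun i _ => hA1 _, fun i h1 hi => ?_, fun i _ => ?_, fun i h1 hi => ?_⟩
  · rw [blockProd_eq α (Amat (exp ℓ) φ), cocycleIter_eq h1, mnorm_mul_turn]
    exact (hpow i).trans (le_mnorm_fwd hα hM hb hr hr₀ hW hA hℓ hφ hseg h1 hi hx hk hint)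
  · rw [mnorm_inv (by simpa [cocycleIter] using hdet 1 (x + 2 * π * i * α))]
    exact hA1 _
  · rw [blockProd_inv_eq α (Amat (exp ℓ) φ) x hi, mnorm_inv (hdet _ _), cocycleIter_eq h1,
      mnorm_mul_turn]
    refine (hpow i).trans (le_mnorm_bwd hα hM hb hr hr₀ hW hA hℓ hφ hseg h1 hi hk ?_ ?_)
    · rwa [add_sub_cancel_right]
    · intro j h0 hj
      have := hint (k - j) (by omega) (by omega)
      rwa [Nat.cast_sub hj.le, show x + 2 * π * ((k : ℝ) - j) * α =
        x + 2 * π * k * α - 2 * π * j * α by ring] at this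

end

section

/-! ### Angles of contracted directions along return segments -/

/-- Sum of the forward and backward correction angles. -/
def dirSum (lam α : ℝ) (φ : ℝ → ℝ) (Rp Rm : ℕ) (x : ℝ) : ℝ :=
  fwdAngle lam α φ Rp x + bwdAngle lam α φ Rm x

theorem fwdAngle_eventuallyEq {lam α : ℝ} {φ φ' : ℝ → ℝ} {k : ℕ} {x : ℝ}
    (h : ∀ j : ℕ, 0 < j → j < k → φ' =ᶠ[nhds (x + 2 * π * j * α)] φ) :
    fwdAngle lam α φ' k =ᶠ[nhds x] fwdAngle lam α φ k := by
  filter_upwards [segMat_eventuallyEq (lam := lam) h] with z hz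
  simp only [fwdAngle, segT, segS, segInv, hz]

theorem bwdAngle_eventuallyEq {lam α : ℝ} {φ φ' : ℝ → ℝ} {k : ℕ} {x : ℝ}
    (h : ∀ j : ℕ, 0 < j → j < k → φ' =ᶠ[nhds (x - 2 * π * k * α + 2 * π * j * α)] φ) :
    bwdAngle lam α φ' k =ᶠ[nhds x] bwdAngle lam α φ k := by
  have := ((continuous_id.sub (continuous_const (y := 2 * π * k * α))).tendsto x).eventually
    (segMat_eventuallyEq (lam := lam) h)
  filter_upwards [this] with z hz
  replace hz : segMat lam α φ' k (z - 2 * π * k * α) = segMat lam α φ k (z - 2 * π * k * α) := hz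
  simp only [bwdAngle, segT, segS, segInv, hz]

theorem segMat_periodic {lam α T : ℝ} {φ : ℝ → ℝ} (h : Function.Periodic φ T) (k : ℕ) :
    Function.Periodic (segMat lam α φ k) T := by
  induction k with
  | zero => intro x; rfl
  | succ k ih =>
    rcases Nat.eq_zero_or_pos k with rfl | hk
    · intro x; rfl
    · intro x
      rw [segMat_succ hk, segMat_succ hk, ih x, turn, turn,
        show x + T + 2 * π * k * α = x + 2 * π * k * α + T by ring, h]

theorem dirSum_periodic {lam α T : ℝ} {φ : ℝ → ℝ} (h : Function.Periodic φ T) (Rp Rm : ℕ) :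
    Function.Periodic (dirSum lam α φ Rp Rm) T := by
  intro x
  simp only [dirSum, fwdAngle, bwdAngle, segT, segS, segInv, segMat_periodic h _ x,
    add_sub_right_comm x T,
    segMat_periodic h _ (x - 2 * π * Rm * α)]

theorem exp_neg_three_le : exp (-3) ≤ 1 / 16 := by
  have h := exp_one_gt_d9
  have : (16 : ℝ) ≤ exp 3 := by
    calc (16 : ℝ) ≤ 2.7 ^ 3 := by norm_num
      _ ≤ exp 1 ^ 3 := by gcongr; linarith
      _ = exp 3 := by rw [← exp_nat_mul]; norm_num
  rw [exp_neg, inv_le_comm₀ (exp_pos 3) (by norm_num)]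
  linarith

section
variable {W : ℕ → ℝ} {ℓ α A ν : ℝ} {φ : ℝ → ℝ}

theorem SegBound.fwdAngle_sub {k : ℕ} {x : ℝ} (hW : JetWeight W) (hA : 0 ≤ A)
    (hℓ : 2 * A + 6 ≤ ℓ) (hk : 1 ≤ k) (h : SegBound W ℓ α φ A ν k x) :
    JetBound W x (fun z => fwdAngle (exp ℓ) α φ k z - arctan (segS (exp ℓ) α φ k z))
      (exp (-(k * ℓ))) := by
  have hk' : (1 : ℝ) ≤ k := by exact_mod_cast hk
  have h1 : exp (-(k * ℓ) + A * k) ≤ 1 / 10 := by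
    have : exp (-(k * ℓ) + A * k) ≤ exp (-3) := exp_le_exp.2 (by nlinarith)
    linarith [exp_neg_three_le]
  refine (contrAngle_bound hW (h.inv' hA) h1 h.fwd' h.bwd').mono ?_
  rw [← exp_nat_mul, exp_le_exp]
  push_cast
  nlinarith

theorem SegBound.bwdAngle_sub {k : ℕ} {y : ℝ} (hW : JetWeight W) (hA : 0 ≤ A)
    (hℓ : 2 * A + 6 ≤ ℓ) (hk : 1 ≤ k) (h : SegBound W ℓ α φ A ν k (y - 2 * π * k * α)) :
    JetBound W y (fun w => bwdAngle (exp ℓ) α φ k w -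
      arctan (segT (exp ℓ) α φ k (w - 2 * π * k * α))) (exp (-(k * ℓ))) := by
  have hk' : (1 : ℝ) ≤ k := by exact_mod_cast hk
  have h1 : exp (-(k * ℓ) + A * k) ≤ 1 / 10 := by
    have : exp (-(k * ℓ) + A * k) ≤ exp (-3) := exp_le_exp.2 (by nlinarith)
    linarith [exp_neg_three_le]
  have h2 := (contrAngle_bound hW (h.inv' hA) h1 h.bwd' h.fwd').mono
    (B' := exp (-(k * ℓ))) (by
      rw [← exp_nat_mul, exp_le_exp]
      push_cast
      nlinarith)
  rw [sub_eq_add_neg] at h2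
  simpa only [bwdAngle, ← sub_eq_add_neg] using h2.comp_add_const (-(2 * π * k * α))

variable {a b d y : ℝ} {k r : ℕ}

theorem fwdAngle_compare (hW : JetWeight W) (hA : 0 ≤ A) (hφ : TrigBound W φ) (hd : 0 < d)
    (hℓ : 2 * A + 6 ≤ ℓ) (hℓ' : 2 * (A + 3) * b ≤ a * ℓ) (hk : 1 ≤ k) (hr : 1 ≤ r)
    (h1 : SegBound W ℓ α φ A ν k y) (h2 : SegBound W ℓ α φ A ν r y) (ha : a / d ≤ r)
    (hb : r ≤ b / d) (ha' : a / d ≤ k) (hb' : k ≤ b / d) (h4 : exp (-(a * ℓ / d)) ≤ 1 / 4) :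
    JetBound W y (fun w => fwdAngle (exp ℓ) α φ k w - fwdAngle (exp ℓ) α φ r w)
      (6 * exp (-(a * ℓ / d))) := by
  have hℓ0 : 0 ≤ ℓ := by linarith
  have hE : ∀ m : ℕ, a / d ≤ m → exp (-(m * ℓ)) ≤ exp (-(a * ℓ / d)) := fun m hm => by
    rw [exp_le_exp, mul_div_right_comm]
    have := mul_le_mul_of_nonneg_right hm hℓ0
    linarith
  have h3 := arctan_sub_bound hW (h1.bwd'.mono (by norm_num)) (h2.bwd'.mono (by norm_num))
    (segS_compare hW hℓ0 hA hφ hd hℓ' hk hr h1 h2 ha hb ha' hb') h4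
  refine (((h1.fwdAngle_sub hW hA hℓ hk).sub hW (h2.fwdAngle_sub hW hA hℓ hr)).add hW h3
    |>.congr (Filter.Eventually.of_forall fun w => ?_)).mono ?_
  · simp only []; ring
  · linarith [hE k ha', hE r ha]

theorem bwdAngle_compare (hW : JetWeight W) (hA : 0 ≤ A) (hφ : TrigBound W φ) (hd : 0 < d)
    (hℓ : 2 * A + 6 ≤ ℓ) (hℓ' : 2 * (A + 3) * b ≤ a * ℓ) (hk : 1 ≤ k) (hr : 1 ≤ r)
    (h1 : SegBound W ℓ α φ A ν k (y - 2 * π * k * α))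
    (h2 : SegBound W ℓ α φ A ν r (y - 2 * π * r * α)) (ha : a / d ≤ r)
    (hb : r ≤ b / d) (ha' : a / d ≤ k) (hb' : k ≤ b / d) (h4 : exp (-(a * ℓ / d)) ≤ 1 / 4) :
    JetBound W y (fun w => bwdAngle (exp ℓ) α φ k w - bwdAngle (exp ℓ) α φ r w)
      (6 * exp (-(a * ℓ / d))) := by
  have hℓ0 : 0 ≤ ℓ := by linarith
  have hE : ∀ m : ℕ, a / d ≤ m → exp (-(m * ℓ)) ≤ exp (-(a * ℓ / d)) := fun m hm => by
    rw [exp_le_exp, mul_div_right_comm]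
    have := mul_le_mul_of_nonneg_right hm hℓ0
    linarith
  have hs : ∀ m : ℕ, SegBound W ℓ α φ A ν m (y - 2 * π * m * α) →
      JetBound W y (fun w => segT (exp ℓ) α φ m (w - 2 * π * m * α)) (1 / 2) := fun m h => by
    have h' := h.fwd'.mono (B' := 1 / 2) (by norm_num)
    rw [sub_eq_add_neg] at h'
    simpa only [← sub_eq_add_neg] using h'.comp_add_const (-(2 * π * m * α))
  have h3 := arctan_sub_bound hW (hs k h1) (hs r h2)
    (segT_compare hW hℓ0 hA hφ hd hℓ' hk hr h1 h2 ha hb ha' hb') h4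
  refine (((h1.bwdAngle_sub hW hA hℓ hk).sub hW (h2.bwdAngle_sub hW hA hℓ hr)).add hW h3
    |>.congr (Filter.Eventually.of_forall fun w => ?_)).mono ?_
  · simp only []; ring
  · linarith [hE k ha', hE r ha]

theorem sin_add_sub_bound {u h : ℝ → ℝ} {x η : ℝ} (hW : JetWeight W)
    (hs : JetBound W x (fun z => sin (u z)) 2) (hc : JetBound W x (fun z => cos (u z)) 2)
    (hh : JetBound W x h η) (hη : η ≤ 1 / 2) :
    JetBound W x (fun z => sin (u z + h z) - sin (u z)) (16 * η) := by
  refine (((hs.mul hW (hh.cos_sub_one hW hη)).add hW (hc.mul hW (hh.sin hW hη))).congr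
    (Filter.Eventually.of_forall fun z => ?_)).mono (by linarith)
  simp only [Real.sin_add]; ring

theorem cos_add_sub_bound {u h : ℝ → ℝ} {x η : ℝ} (hW : JetWeight W)
    (hs : JetBound W x (fun z => Real.sin (u z)) 2) (hc : JetBound W x (fun z => cos (u z)) 2)
    (hh : JetBound W x h η) (hη : η ≤ 1 / 2) :
    JetBound W x (fun z => cos (u z + h z) - cos (u z)) (16 * η) := by
  refine (((hc.mul hW (hh.cos_sub_one hW hη)).sub hW (hs.mul hW (hh.sin hW hη))).congr
    (Filter.Eventually.of_forall fun z => ?_)).mono (by linarith)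
  simp only [Real.cos_add]; ring

theorem trigBound_of_near {u f : ℝ → ℝ} (hW : JetWeight W)
    (hs : ∀ x, JetBound W x (fun z => sin (u z)) 2) (hc : ∀ x, JetBound W x (fun z => cos (u z)) 2)
    (h : ∀ x, JetBound W x (fun z => f z - u z) (1 / 16)) : TrigBound W f := by
  intro x
  constructor
  · refine ((sin_add_sub_bound hW (hs x) (hc x) (h x) (by norm_num)).add hW (hs x) |>.congr
      (Filter.Eventually.of_forall fun z => ?_)).mono (by norm_num)
    simp
  · refine ((cos_add_sub_bound hW (hs x) (hc x) (h x) (by norm_num)).add hW (hc x) |>.congr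
      (Filter.Eventually.of_forall fun z => ?_)).mono (by norm_num)
    simp

theorem cos_arctan_bound {t : ℝ → ℝ} {x : ℝ} (hW : JetWeight W)
    (ht : JetBound W x t (1 / 10)) : JetBound W x (fun z => cos (arctan (t z))) 2 := by
  have one : JetBound W x (fun _ => (1 : ℝ)) 1 := by simpa using JetBound.const hW (1 : ℝ) (x := x)
  refine ((((ht.arctan hW (by norm_num)).cos_sub_one hW (by norm_num)).add hW one).congr
    (Filter.Eventually.of_forall fun z => ?_)).mono (by norm_num)
  simp

/-- Transversality when the angle is close to the sum of a transverse angle and the slopes. -/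
theorem cross_inv_of_near {u f t s : ℝ → ℝ} {η C : ℝ} (hW : JetWeight W)
    (hus : JetBound W y (fun z => sin (u z)) 2) (huc : JetBound W y (fun z => cos (u z)) 2)
    (hu0 : sin (u y) ≠ 0) (hui : JetBound W y (fun z => (sin (u z))⁻¹) C)
    (ht : JetBound W y t (1 / 10)) (hs : JetBound W y s (1 / 10))
    (hh : JetBound W y (fun w => f w - u w - arctan (t w) - arctan (s w)) η) (hη : η ≤ 1 / 2)
    (hC : C * (16 * η) ≤ 1 / 2) :
    cross (f y) (t y) (s y) ≠ 0 ∧ JetBound W y (fun w => (cross (f w) (t w) (s w))⁻¹) (8 * C) := by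
  have h1 := JetBound.inv_add (f := fun z => sin (u z)) hW hu0 hus.smooth hui
    (sin_add_sub_bound hW hus huc hh hη) (by linarith)
  have e : ∀ w, sin (u w) + (sin (u w + (f w - u w - arctan (t w) - arctan (s w))) - sin (u w)) =
      cross (f w) (t w) (s w) * (cos (arctan (t w)) * cos (arctan (s w))) := fun w => by
    rw [cross_mul_cos]; ring_nf
  simp only [e] at h1
  refine ⟨left_ne_zero_of_mul h1.1, ((((cos_arctan_bound hW ht).mul hW (cos_arctan_bound hW hs)).mul hW
    h1.2).congr (Filter.Eventually.of_forall fun w => ?_)).mono ?_⟩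
  · have p1 := (cos_arctan_pos (t w)).ne'
    have p2 := (cos_arctan_pos (s w)).ne'
    simp only [mul_inv_rev]
    field_simp
  · have hC0 := hui.nonneg
    have : C / (1 - C * (16 * η)) ≤ 2 * C := by
      rw [div_le_iff₀ (by linarith)]; nlinarith
    linarith

end

end

section

/-! ### The inductive construction -/

/-- Successive corrections of `base` on shrinking critical sets. -/
def phiSeq (lam α : ℝ) (base : ℝ → ℝ) (χ : ℕ → ℝ → ℝ) (Rp Rm : ℕ → ℕ) : ℕ → ℝ → ℝ
  | 0 => base
  | j + 1 => fun x => phiSeq lam α base χ Rp Rm j x + χ (j + 1) x *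
      (dirSum lam α (phiSeq lam α base χ Rp Rm j) (Rp (j + 1)) (Rm (j + 1)) x -
        dirSum lam α (phiSeq lam α base χ Rp Rm j) (Rp j) (Rm j) x)

theorem phiSeq_periodic {lam α T : ℝ} {base : ℝ → ℝ} {χ : ℕ → ℝ → ℝ} {Rp Rm : ℕ → ℕ}
    (hb : Function.Periodic base T) (hχ : ∀ j, Function.Periodic (χ j) T) (j : ℕ) :
    Function.Periodic (phiSeq lam α base χ Rp Rm j) T := by
  induction j with
  | zero => exact hb
  | succ j ih =>
    intro x
    simp only [phiSeq, ih x, hχ (j + 1) x, dirSum_periodic ih _ _ x]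

theorem trivial_seg {lam α : ℝ} {φ : ℝ → ℝ} {k : ℕ} {x : ℝ} (hk : 1 ≤ k)
    (h : ∀ j : ℕ, 0 < j → j < k → φ =ᶠ[nhds (x + 2 * π * j * α)] fun _ => π / 2) :
    ∀ᶠ z in nhds x, segT lam α φ k z = 0 ∧ segS lam α φ k z = 0 := by
  filter_upwards [segMat_eventuallyEq (lam := lam) h] with z hz
  have e : segMat lam α (fun _ => π / 2) k z = !![lam ^ k, 0; 0, lam⁻¹ ^ k] :=
    segMat_of_trivial hk fun _ _ _ => rfl
  simp [segT, segS, hz, e]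

theorem trivial_seg_bwd {lam α : ℝ} {φ : ℝ → ℝ} {k : ℕ} {x : ℝ} (hk : 1 ≤ k)
    (h : ∀ j : ℕ, 0 < j → j < k →
      φ =ᶠ[nhds (x - 2 * π * k * α + 2 * π * j * α)] fun _ => π / 2) :
    ∀ᶠ z in nhds x, segT lam α φ k (z - 2 * π * k * α) = 0 ∧
      segS lam α φ k (z - 2 * π * k * α) = 0 :=
  ((continuous_id.sub (continuous_const (y := 2 * π * k * α))).tendsto x).eventually
    (trivial_seg (lam := lam) hk h)

/-- The data entering the inductive construction. -/
structure Scheme (W : ℕ → ℝ) (ℓ α M ν m a A c2 B c₁ : ℝ) (rad ρ : ℕ → ℝ) (Rp Rm : ℕ → ℕ)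
    (base : ℝ → ℝ) (χ : ℕ → ℝ → ℝ) : Prop where
  hW : JetWeight W
  hA : 0 ≤ A
  hM : 1 ≤ M
  hm : 1 ≤ m
  ha : 8 * M * m * a = 1
  hν : 0 < ν
  hν1 : ν < 1
  hc2 : 0 ≤ c2
  hB : 1 ≤ B
  rad_pos : ∀ j, 0 < rad j
  rad_le_one : ∀ j, rad j ≤ 1
  rad_succ : ∀ j, rad (j + 1) < ρ j
  ρ_lt : ∀ j, ρ j < rad j
  rad_le : ∀ j, rad j ≤ m * rad (j + 1)
  le_inv_rad : ∀ j : ℕ, (j : ℝ) ≤ (rad j)⁻¹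
  fwd : ∀ j, ReturnSpec α M c₁ (rad j) (Rp j)
  bwd : ∀ j, ReturnSpec (-α) M c₁ (rad j) (Rm j)
  base_sin : ∀ x, JetBound W x (fun z => sin (base z)) 2
  base_cos : ∀ x, JetBound W x (fun z => cos (base z)) 2
  base_ne : ∀ x, 0 < critDist c₁ x → sin (base x) ≠ 0
  base_inv : ∀ x, 0 < critDist c₁ x → JetBound W x (fun z => (sin (base z))⁻¹)
    (c2 * exp (3 * critDist c₁ x ^ (-ν)))
  base_triv : ∀ x, rad 0 < critDist c₁ x → base =ᶠ[nhds x] fun _ => π / 2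
  cut : ∀ j x, JetBound W x (χ j) (B * exp (2 * (M + 1) / rad j))
  cut_zero : ∀ j x, rad j < critDist c₁ x → χ j =ᶠ[nhds x] fun _ => 0
  cut_one : ∀ j x, critDist c₁ x < ρ j → χ j =ᶠ[nhds x] fun _ => 1
  seg : ∀ φ : ℝ → ℝ, TrigBound W φ → ∀ δ₀ : ℝ, 0 ≤ δ₀ →
    (∀ y, rad 0 < critDist c₁ y → φ =ᶠ[nhds y] fun _ => π / 2) →
    (∀ y, δ₀ < critDist c₁ y → critDist c₁ y ≤ rad 0 →
      PivotBound W ℓ α φ A ν c₁ (3 + 8 * c2) (a / m) (16 * M) y) →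
    ∀ (k : ℕ) (x : ℝ), 1 ≤ k → GoodSeg α c₁ δ₀ k x → SegBound W ℓ α φ A ν k x
  l1 : 2 * A + 6 ≤ ℓ
  l2 : 2 * (A + 3) * (16 * M) ≤ a * ℓ
  l3 : 2 * (M + 1) + 12 * B ≤ a * ℓ / 2
  l4 : 3 * m + 96 * c2 ≤ a * ℓ / 2
  l5 : 6 ≤ a * ℓ / 2

/-- The properties propagated along the construction. -/
structure SchemeInv (W : ℕ → ℝ) (ℓ α M ν m a A c2 c₁ : ℝ) (rad : ℕ → ℝ) (Rp Rm : ℕ → ℕ)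
    (base : ℝ → ℝ) (χ : ℕ → ℝ → ℝ) (j : ℕ) (f : ℝ → ℝ) : Prop where
  near : ∀ x, JetBound W x (fun z => f z - base z) ((1 - (1 / 2) ^ j) / 16)
  triv : ∀ x, rad 0 < critDist c₁ x → f =ᶠ[nhds x] fun _ => π / 2
  pivot : ∀ y, rad (j + 1) < critDist c₁ y → critDist c₁ y ≤ rad 0 →
    PivotBound W ℓ α f A ν c₁ (3 + 8 * c2) (a / m) (16 * M) y
  dev : ∀ x, critDist c₁ x ≤ rad j → ∃ t : ℝ, |t| ≤ 12 * exp (-(a * ℓ / rad j)) ∧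
    f x - dirSum (exp ℓ) α f (Rp j) (Rm j) x = base x - (1 - χ j x) * t

section
variable {W : ℕ → ℝ} {ℓ α M ν m a A c2 B c₁ : ℝ} {rad ρ : ℕ → ℝ} {Rp Rm : ℕ → ℕ}
  {base : ℝ → ℝ} {χ : ℕ → ℝ → ℝ} {j : ℕ} {f : ℝ → ℝ}

theorem JetBound.zero_of_eventually {W : ℕ → ℝ} {x η : ℝ} {f : ℝ → ℝ} (hW : JetWeight W)
    (hη : 0 ≤ η) (h : f =ᶠ[nhds x] fun _ => 0) : JetBound W x f η :=
  ((JetBound.const hW (0 : ℝ)).congr h).mono (by simpa using hη)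

namespace Scheme

theorem a_pos (S : Scheme W ℓ α M ν m a A c2 B c₁ rad ρ Rp Rm base χ) : 0 < a := by
  have := S.ha
  have h : 0 < 8 * M * m := by nlinarith [S.hM, S.hm]
  by_contra! h'
  nlinarith

theorem ℓ_nonneg (S : Scheme W ℓ α M ν m a A c2 B c₁ rad ρ Rp Rm base χ) : 0 ≤ ℓ := by
  linarith [S.l1, S.hA]

theorem rad_anti (S : Scheme W ℓ α M ν m a A c2 B c₁ rad ρ Rp Rm base χ) : Antitone rad :=
  antitone_nat_of_succ_le fun j => ((S.rad_succ j).trans (S.ρ_lt j)).le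

theorem rate_le {r : ℝ} {R : ℕ} (S : Scheme W ℓ α M ν m a A c2 B c₁ rad ρ Rp Rm base χ)
    (h : 1 / (8 * M) / r ≤ R) (hr : 0 < r) {d : ℝ} (hd : 0 < d) (hrd : r ≤ m * d) :
    a / d ≤ R := by
  refine le_trans ?_ h
  have h8 : 0 < 8 * M := by linarith [S.hM]
  have e : 1 / (8 * M) = a * m := by
    rw [div_eq_iff h8.ne', ← S.ha]; ring
  rw [e, div_le_div_iff₀ hd hr]
  nlinarith [S.a_pos]

theorem trigBound (S : Scheme W ℓ α M ν m a A c2 B c₁ rad ρ Rp Rm base χ)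
    (h : ∀ x, JetBound W x (fun z => f z - base z) ((1 - (1 / 2) ^ j) / 16)) : TrigBound W f :=
  trigBound_of_near S.hW S.base_sin S.base_cos fun x => (h x).mono (by
    have : (0 : ℝ) ≤ (1 / 2) ^ j := by positivity
    linarith)

/-- Transversality from closeness to `base` plus the slopes of the return segments. -/
theorem pivotBound (S : Scheme W ℓ α M ν m a A c2 B c₁ rad ρ Rp Rm base χ) (i : ℕ) {y η : ℝ}
    (hy0 : 0 < critDist c₁ y) (hy : critDist c₁ y ≤ rad i) (hy' : rad i ≤ m * (m * critDist c₁ y))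
    (hp : SegBound W ℓ α f A ν (Rp i) y) (hm : SegBound W ℓ α f A ν (Rm i) (y - 2 * π * Rm i * α))
    (hh : JetBound W y (fun w => f w - base w -
      arctan (segT (exp ℓ) α f (Rm i) (w - 2 * π * Rm i * α)) -
      arctan (segS (exp ℓ) α f (Rp i) w)) η) (hη : η ≤ 1 / 2)
    (hC : c2 * exp (3 * critDist c₁ y ^ (-ν)) * (16 * η) ≤ 1 / 2) :
    PivotBound W ℓ α f A ν c₁ (3 + 8 * c2) (a / m) (16 * M) y := by
  have hT : JetBound W y (fun w => segT (exp ℓ) α f (Rm i) (w - 2 * π * Rm i * α)) (1 / 10) := by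
    have h' := hm.fwd'
    rw [sub_eq_add_neg] at h'
    simpa only [← sub_eq_add_neg] using h'.comp_add_const (-(2 * π * Rm i * α))
  obtain ⟨c1, c3⟩ := cross_inv_of_near S.hW (S.base_sin y) (S.base_cos y) (S.base_ne y hy0)
    (S.base_inv y hy0) hT hp.bwd' hh hη hC
  have hm0 : 0 < m := by linarith [S.hm]
  have hM16 : 0 ≤ 16 * M := by linarith [S.hM]
  have hrate : ∀ R : ℕ, 1 / (8 * M) / rad i ≤ R → a / m / critDist c₁ y ≤ R := fun R hR => by
    rw [div_div]
    exact S.rate_le hR (S.rad_pos i) (by positivity) hy'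
  refine ⟨Rp i, Rm i, (S.fwd i).pos, (S.bwd i).pos, hrate _ (S.fwd i).ge,
    (S.fwd i).le.trans (by gcongr), hrate _ (S.bwd i).ge, (S.bwd i).le.trans (by gcongr),
    fun k h0 hk => hy.trans ((S.fwd i).interior y hy k h0 hk).le, fun k h0 hk => ?_, hp, hm, c1,
    c3.mono ?_⟩
  · refine hy.trans (((S.bwd i).interior y hy k h0 hk).le.trans_eq ?_)
    congr 1; ring
  · have h1 : 1 ≤ critDist c₁ y ^ (-ν) :=
      one_le_rpow_of_pos_of_le_one_of_nonpos hy0 (hy.trans (S.rad_le_one i)) (by linarith [S.hν])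
    have h2 : 8 * c2 ≤ exp (8 * c2 * critDist c₁ y ^ (-ν)) := by
      have := add_one_le_exp (8 * c2 * critDist c₁ y ^ (-ν))
      nlinarith [S.hc2]
    calc 8 * (c2 * exp (3 * critDist c₁ y ^ (-ν)))
        = 8 * c2 * exp (3 * critDist c₁ y ^ (-ν)) := by ring
      _ ≤ exp (8 * c2 * critDist c₁ y ^ (-ν)) * exp (3 * critDist c₁ y ^ (-ν)) := by gcongr
      _ = exp ((3 + 8 * c2) * critDist c₁ y ^ (-ν)) := by rw [← exp_add]; ring_nf

theorem inv_zero (S : Scheme W ℓ α M ν m a A c2 B c₁ rad ρ Rp Rm base χ) :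
    SchemeInv W ℓ α M ν m a A c2 c₁ rad Rp Rm base χ 0 base := by
  have hf : ∀ y, critDist c₁ y ≤ rad 0 → ∀ k : ℕ, 0 < k → k < Rp 0 →
      base =ᶠ[nhds (y + 2 * π * k * α)] fun _ => π / 2 := fun y hy k h0 hk =>
    S.base_triv _ ((S.fwd 0).interior y hy k h0 hk)
  have hb : ∀ y, critDist c₁ y ≤ rad 0 → ∀ k : ℕ, 0 < k → k < Rm 0 →
      base =ᶠ[nhds (y - 2 * π * Rm 0 * α + 2 * π * k * α)] fun _ => π / 2 := fun y hy k h0 hk =>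
    S.base_triv _ ((S.bwd 0).interior_bwd hy h0 hk)
  refine ⟨fun x => .zero_of_eventually S.hW (by norm_num) (by simp), S.base_triv,
    fun y h1 h2 => ?_, fun x hx => ⟨0, by simp; positivity, ?_⟩⟩
  · have hy0 := (S.rad_pos 1).trans h1
    refine S.pivotBound 0 (η := 0) hy0 h2 ?_
      (.of_trivial S.hW S.hA S.hν1.le (S.fwd 0).pos (hf y h2))
      (.of_trivial S.hW S.hA S.hν1.le (S.bwd 0).pos (hb y h2)) ?_ (by norm_num) (by norm_num)
    · have := S.rad_le 0
      have h3 : m * rad 1 ≤ m * critDist c₁ y := by nlinarith [S.hm]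
      have h4 : m * critDist c₁ y ≤ m * (m * critDist c₁ y) := by
        have := S.hm
        exact le_mul_of_one_le_left (by positivity) S.hm
      simp only [zero_add] at this
      linarith
    · refine .zero_of_eventually S.hW le_rfl ?_
      filter_upwards [trivial_seg (lam := exp ℓ) (S.fwd 0).pos (hf y h2),
        trivial_seg_bwd (lam := exp ℓ) (S.bwd 0).pos (hb y h2)] with z h3 h4
      simp [h3.2, h4.1]
  · have h3 := (trivial_seg (lam := exp ℓ) (S.fwd 0).pos (hf x hx)).self_of_nhds
    have h4 := (trivial_seg_bwd (lam := exp ℓ) (S.bwd 0).pos (hb x hx)).self_of_nhds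
    simp [dirSum, fwdAngle, bwdAngle, h3.1, h3.2, h4.1, h4.2, contrAngle_zero]

end Scheme
end

end

section

section
variable {W : ℕ → ℝ} {ℓ α M ν m a A c2 B c₁ : ℝ} {rad ρ : ℕ → ℝ} {Rp Rm : ℕ → ℕ}
  {base : ℝ → ℝ} {χ : ℕ → ℝ → ℝ} {j : ℕ} {f : ℝ → ℝ}

theorem SchemeInv.segBound (I : SchemeInv W ℓ α M ν m a A c2 c₁ rad Rp Rm base χ j f)
    (S : Scheme W ℓ α M ν m a A c2 B c₁ rad ρ Rp Rm base χ) (k : ℕ) (x : ℝ) (hk : 1 ≤ k)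
    (h : GoodSeg α c₁ (rad (j + 1)) k x) : SegBound W ℓ α f A ν k x :=
  S.seg f (S.trigBound I.near) _ (S.rad_pos _).le I.triv I.pivot k x hk h

theorem SchemeInv.core (I : SchemeInv W ℓ α M ν m a A c2 c₁ rad Rp Rm base χ j f)
    (S : Scheme W ℓ α M ν m a A c2 B c₁ rad ρ Rp Rm base χ) {x : ℝ} (hx : critDist c₁ x < ρ j) :
    ∀ᶠ z in nhds x, f z = base z + dirSum (exp ℓ) α f (Rp j) (Rm j) z := by
  have h := (critDist_continuous c₁).continuousAt.eventually_lt continuousAt_const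
    (hx.trans (S.ρ_lt j))
  filter_upwards [h, S.cut_one j x hx] with z h1 h2
  obtain ⟨t, -, ht⟩ := I.dev z h1.le
  simp only [h2] at ht
  linarith

/-- The correction added in one step. -/
def stepGap (ℓ α : ℝ) (Rp Rm : ℕ → ℕ) (f : ℝ → ℝ) (j : ℕ) (x : ℝ) : ℝ :=
  dirSum (exp ℓ) α f (Rp (j + 1)) (Rm (j + 1)) x - dirSum (exp ℓ) α f (Rp j) (Rm j) x

namespace Scheme

theorem exp_rad_le (S : Scheme W ℓ α M ν m a A c2 B c₁ rad ρ Rp Rm base χ) {u v : ℝ}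
    (hv : 0 ≤ v) (h : u + v ≤ a * ℓ / 2) (j : ℕ) :
    exp (v + u / rad j) * exp (-(a * ℓ / rad j)) ≤ exp (-(a * ℓ / (2 * rad j))) := by
  have hr := S.rad_pos j
  have h1 : 1 ≤ (rad j)⁻¹ := (one_le_inv₀ hr).2 (S.rad_le_one j)
  rw [← exp_add, exp_le_exp]
  simp only [div_eq_mul_inv, mul_inv] at *
  nlinarith

theorem exp_neg_le (S : Scheme W ℓ α M ν m a A c2 B c₁ rad ρ Rp Rm base χ) (j : ℕ) :
    exp (-(a * ℓ / (2 * rad (j + 1)))) ≤ (1 / 2) ^ (j + 1) / 16 := by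
  have h1 := S.le_inv_rad (j + 1)
  push_cast at h1
  have h2 : exp (-(a * ℓ / (2 * rad (j + 1)))) ≤ exp (((j + 1 : ℕ) : ℝ) * (-6)) := by
    rw [exp_le_exp]
    simp only [div_eq_mul_inv, mul_inv]
    push_cast
    nlinarith [S.l5]
  have h3 : exp (-6) ≤ 1 / 32 := by
    have : exp (-6) = exp (-3) * exp (-3) := by rw [← exp_add]; norm_num
    rw [this]
    nlinarith [exp_neg_three_le, exp_pos (-3)]
  calc _ ≤ exp (-6) ^ (j + 1) := by rw [← exp_nat_mul]; exact h2
    _ ≤ (1 / 32) ^ (j + 1) := by gcongr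
    _ = (1 / 2) ^ (j + 1) * (1 / 16) ^ (j + 1) := by rw [← mul_pow]; norm_num
    _ ≤ (1 / 2) ^ (j + 1) * (1 / 16) ^ 1 := by
      gcongr ?_ * ?_
      exact pow_le_pow_of_le_one (by norm_num) (by norm_num) (by omega)
    _ = _ := by ring

theorem gap_bound (S : Scheme W ℓ α M ν m a A c2 B c₁ rad ρ Rp Rm base χ)
    (I : SchemeInv W ℓ α M ν m a A c2 c₁ rad Rp Rm base χ j f) {x : ℝ}
    (hx : critDist c₁ x ≤ rad (j + 1)) :
    JetBound W x (stepGap ℓ α Rp Rm f j) (12 * exp (-(a * ℓ / rad (j + 1)))) := by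
  have hr := S.rad_pos (j + 1)
  have hx' := hx.trans (S.rad_anti (Nat.le_succ j))
  have hM16 : 0 ≤ 16 * M := by linarith [S.hM]
  have hle := S.rad_anti (Nat.le_succ j)
  have g1 : rad (j + 1) ≤ m * rad (j + 1) := le_mul_of_one_le_left hr.le S.hm
  have h4 : exp (-(a * ℓ / rad (j + 1))) ≤ 1 / 4 := by
    have := S.exp_rad_le (u := 0) (v := 0) le_rfl (by linarith [S.l5]) (j + 1)
    have h2 := S.exp_neg_le j
    have : ((1 : ℝ) / 2) ^ (j + 1) ≤ 1 := pow_le_one₀ (by norm_num) (by norm_num)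
    simp only [zero_div, add_zero, exp_zero, one_mul] at *
    linarith
  have seg := I.segBound S
  have p := fwdAngle_compare S.hW S.hA (S.trigBound I.near) hr S.l1 S.l2 (S.fwd (j + 1)).pos
    (S.fwd j).pos (seg _ _ (S.fwd (j + 1)).pos ((S.fwd (j + 1)).goodSeg_fwd le_rfl hx))
    (seg _ _ (S.fwd j).pos ((S.fwd j).goodSeg_fwd hle hx'))
    (S.rate_le (S.fwd j).ge (S.rad_pos j) hr (S.rad_le j)) ((S.fwd j).le.trans (by gcongr))
    (S.rate_le (S.fwd (j + 1)).ge hr hr g1) (S.fwd (j + 1)).le h4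
  have q := bwdAngle_compare S.hW S.hA (S.trigBound I.near) hr S.l1 S.l2 (S.bwd (j + 1)).pos
    (S.bwd j).pos (seg _ _ (S.bwd (j + 1)).pos ((S.bwd (j + 1)).goodSeg_bwd le_rfl hx))
    (seg _ _ (S.bwd j).pos ((S.bwd j).goodSeg_bwd hle hx'))
    (S.rate_le (S.bwd j).ge (S.rad_pos j) hr (S.rad_le j)) ((S.bwd j).le.trans (by gcongr))
    (S.rate_le (S.bwd (j + 1)).ge hr hr g1) (S.bwd (j + 1)).le h4
  refine ((p.add S.hW q).congr (Filter.Eventually.of_forall fun w => ?_)).mono (by linarith)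
  simp only [stepGap, dirSum]; ring

theorem step_bound (S : Scheme W ℓ α M ν m a A c2 B c₁ rad ρ Rp Rm base χ)
    (I : SchemeInv W ℓ α M ν m a A c2 c₁ rad Rp Rm base χ j f) (x : ℝ) :
    JetBound W x (fun z => χ (j + 1) z * stepGap ℓ α Rp Rm f j z)
      (exp (-(a * ℓ / (2 * rad (j + 1))))) := by
  rcases le_or_gt (critDist c₁ x) (rad (j + 1)) with h | h
  · refine ((S.cut (j + 1) x).mul S.hW (S.gap_bound I h)).mono ?_
    refine le_trans ?_ (S.exp_rad_le (u := 2 * (M + 1)) (v := 12 * B) (by linarith [S.hB])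
      S.l3 (j + 1))
    have : 12 * B ≤ exp (12 * B) := by linarith [add_one_le_exp (12 * B)]
    rw [exp_add]
    calc _ = 12 * B * exp (2 * (M + 1) / rad (j + 1)) * exp (-(a * ℓ / rad (j + 1))) := by ring
      _ ≤ _ := by gcongr
  · refine .zero_of_eventually S.hW (exp_pos _).le ?_
    filter_upwards [S.cut_zero (j + 1) x h] with z hz
    simp [hz]

theorem dirSum_eventuallyEq (S : Scheme W ℓ α M ν m a A c2 B c₁ rad ρ Rp Rm base χ)
    {f' : ℝ → ℝ} (h : ∀ z, rad j < critDist c₁ z → f' =ᶠ[nhds z] f) {x : ℝ}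
    (hx : critDist c₁ x ≤ rad j) :
    fwdAngle (exp ℓ) α f' (Rp j) =ᶠ[nhds x] fwdAngle (exp ℓ) α f (Rp j) ∧
    bwdAngle (exp ℓ) α f' (Rm j) =ᶠ[nhds x] bwdAngle (exp ℓ) α f (Rm j) :=
  ⟨fwdAngle_eventuallyEq fun k h0 hk => h _ ((S.fwd j).interior x hx k h0 hk),
   bwdAngle_eventuallyEq fun _ h0 hk => h _ ((S.bwd j).interior_bwd hx h0 hk)⟩

theorem inv_succ (S : Scheme W ℓ α M ν m a A c2 B c₁ rad ρ Rp Rm base χ)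
    (I : SchemeInv W ℓ α M ν m a A c2 c₁ rad Rp Rm base χ j f) :
    SchemeInv W ℓ α M ν m a A c2 c₁ rad Rp Rm base χ (j + 1)
      (fun x => f x + χ (j + 1) x * stepGap ℓ α Rp Rm f j x) := by
  set f' : ℝ → ℝ := fun x => f x + χ (j + 1) x * stepGap ℓ α Rp Rm f j x with hf'
  have hout : ∀ z, rad (j + 1) < critDist c₁ z → f' =ᶠ[nhds z] f := fun z hz => by
    filter_upwards [S.cut_zero (j + 1) z hz] with w hw
    simp [hf', hw]
  have hout' : ∀ z, rad j < critDist c₁ z → f' =ᶠ[nhds z] f := fun z hz =>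
    hout z ((S.rad_anti (Nat.le_succ j)).trans_lt hz)
  have hnear : ∀ x, JetBound W x (fun z => f' z - base z) ((1 - (1 / 2) ^ (j + 1)) / 16) :=
    fun x => by
    refine (((I.near x).add S.hW (S.step_bound I x)).congr
      (Filter.Eventually.of_forall fun w => ?_)).mono ?_
    · simp only [hf']; ring
    · have := S.exp_neg_le j
      have e : ((1 : ℝ) / 2) ^ (j + 1) = (1 / 2) ^ j / 2 := by rw [pow_succ]; ring
      rw [e] at this ⊢
      linarith
  have htriv : ∀ x, rad 0 < critDist c₁ x → f' =ᶠ[nhds x] fun _ => π / 2 := fun x hx =>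
    (hout x ((S.rad_anti (Nat.zero_le _)).trans_lt hx)).trans (I.triv x hx)
  have hpiv : ∀ y, rad (j + 1) < critDist c₁ y → critDist c₁ y ≤ rad 0 →
      PivotBound W ℓ α f' A ν c₁ (3 + 8 * c2) (a / m) (16 * M) y := fun y h1 h2 =>
    (I.pivot y h1 h2).congr fun z hz => hout z (h1.trans_le hz)
  have hseg : ∀ (k : ℕ) (x : ℝ), 1 ≤ k → GoodSeg α c₁ (rad (j + 1)) k x →
      SegBound W ℓ α f' A ν k x :=
    S.seg f' (S.trigBound hnear) _ (S.rad_pos _).le htriv hpiv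
  refine ⟨hnear, htriv, fun y h1 h2 => ?_, fun x hx => ?_⟩
  · rcases lt_or_ge (rad (j + 1)) (critDist c₁ y) with h3 | h3
    · exact hpiv y h3 h2
    have hy0 := (S.rad_pos _).trans h1
    have hle := S.rad_anti (Nat.le_succ j)
    have hr := S.rad_pos (j + 1)
    have hm0 : 0 < m := by linarith [S.hm]
    have hyj := h3.trans hle
    have sp := hseg _ _ (S.fwd j).pos ((S.fwd j).goodSeg_fwd hle hyj)
    have sm := hseg _ _ (S.bwd j).pos ((S.bwd j).goodSeg_bwd hle hyj)
    have hE : ∀ R : ℕ, 1 / (8 * M) / rad j ≤ R →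
        exp (-(R * ℓ)) ≤ exp (-(a * ℓ / (2 * rad (j + 1)))) := fun R hR => by
      rw [exp_le_exp]
      have h5 := mul_le_mul_of_nonneg_right (S.rate_le hR (S.rad_pos j) hr (S.rad_le j))
        S.ℓ_nonneg
      have h6 : 0 ≤ a * ℓ / rad (j + 1) := by
        have := S.a_pos; have := S.ℓ_nonneg; positivity
      have h7 : a * ℓ / (2 * rad (j + 1)) = a * ℓ / rad (j + 1) / 2 := by
        field_simp
      rw [div_mul_eq_mul_div] at h5
      rw [h7]
      linarith
    refine S.pivotBound j (η := 3 * exp (-(a * ℓ / (2 * rad (j + 1))))) hy0 hyj ?_ sp sm ?_ ?_ ?_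
    · refine (S.rad_le j).trans (mul_le_mul_of_nonneg_left ?_ hm0.le)
      exact (S.rad_le (j + 1)).trans (mul_le_mul_of_nonneg_left h1.le hm0.le)
    · refine (((sp.fwdAngle_sub S.hW S.hA S.l1 (S.fwd j).pos).add S.hW
        (sm.bwdAngle_sub S.hW S.hA S.l1 (S.bwd j).pos)).add S.hW (S.step_bound I y)
        |>.congr ?_).mono (by linarith [hE _ (S.fwd j).ge, hE _ (S.bwd j).ge])
      filter_upwards [I.core S (h3.trans_lt (S.rad_succ j)),
        (S.dirSum_eventuallyEq hout' hyj).1, (S.dirSum_eventuallyEq hout' hyj).2] with z e1 e2 e3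
      rw [e2, e3]
      simp only [hf', dirSum] at e1 ⊢
      linarith
    · have := S.exp_neg_le j
      have : ((1 : ℝ) / 2) ^ (j + 1) ≤ 1 := pow_le_one₀ (by norm_num) (by norm_num)
      linarith
    · have h5 : 1 ≤ (critDist c₁ y)⁻¹ := (one_le_inv₀ hy0).2 (hyj.trans (S.rad_le_one j))
      have h6 : critDist c₁ y ^ (-ν) ≤ m / rad (j + 1) := by
        rw [rpow_neg hy0.le, ← inv_rpow hy0.le]
        refine (rpow_le_rpow_of_exponent_le h5 S.hν1.le).trans ?_
        rw [rpow_one, inv_eq_one_div, div_le_div_iff₀ hy0 hr]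
        have := S.rad_le (j + 1)
        nlinarith
      have h7 : exp (3 * critDist c₁ y ^ (-ν)) ≤ exp (3 * m / rad (j + 1)) := by
        rw [exp_le_exp, mul_div_assoc]; linarith
      have h8 : 96 * c2 ≤ exp (96 * c2) := by linarith [add_one_le_exp (96 * c2)]
      have h9 : exp (96 * c2 + 3 * m / rad (j + 1)) * exp (-(a * ℓ / (2 * rad (j + 1)))) ≤ 1 := by
        rw [← exp_add, exp_le_one_iff]
        have h1 : 1 ≤ (rad (j + 1))⁻¹ := (one_le_inv₀ hr).2 (S.rad_le_one _)
        have := S.l4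
        have := S.hc2
        simp only [div_eq_mul_inv, mul_inv] at *
        nlinarith
      rw [exp_add] at h9
      have h10 : 96 * c2 * exp (3 * critDist c₁ y ^ (-ν)) ≤
          exp (96 * c2) * exp (3 * m / rad (j + 1)) := by gcongr
      have h11 := mul_le_mul_of_nonneg_right h10 (exp_pos (-(a * ℓ / (2 * rad (j + 1))))).le
      linarith
  · refine ⟨stepGap ℓ α Rp Rm f j x, (S.gap_bound I hx).abs_apply_le S.hW, ?_⟩
    have e := S.dirSum_eventuallyEq hout hx
    have e1 := (I.core S (hx.trans_lt (S.rad_succ j))).self_of_nhds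
    have e2 : dirSum (exp ℓ) α f' (Rp (j + 1)) (Rm (j + 1)) x =
        dirSum (exp ℓ) α f (Rp (j + 1)) (Rm (j + 1)) x := by
      rw [dirSum, e.1.self_of_nhds, e.2.self_of_nhds, dirSum]
    rw [e2]
    simp only [hf', stepGap]
    linear_combination e1

theorem inv (S : Scheme W ℓ α M ν m a A c2 B c₁ rad ρ Rp Rm base χ) (j : ℕ) :
    SchemeInv W ℓ α M ν m a A c2 c₁ rad Rp Rm base χ j
      (phiSeq (exp ℓ) α base χ Rp Rm j) := by
  induction j with
  | zero => exact S.inv_zero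
  | succ j ih => exact S.inv_succ ih

end Scheme
end

end

section

/-! ### Consequences of the construction -/

theorem critDist_le_of_mem {c₁ r x : ℝ} (h : x ∈ critSet c₁ r) : critDist c₁ x ≤ r :=
  (inCircle_critSet_iff c₁ r x).1 ⟨0, by simpa using h⟩

theorem lt_critDist_of_notMem {c₁ r r' x : ℝ} (hr : r ≤ 1) (hr' : r' ≤ 1) (h : x ∈ critSet c₁ r)
    (h' : x ∉ critSet c₁ r') : r' < critDist c₁ x := by
  by_contra! hd
  obtain ⟨k, hk⟩ := (inCircle_critSet_iff c₁ r' x).2 hd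
  have hπ := pi_gt_three
  have b : ∀ {y s : ℝ}, s ≤ 1 → y ∈ critSet c₁ s → c₁ - 1 ≤ y ∧ y ≤ c₁ + π + 1 := by
    rintro y s hs (⟨h1, h2⟩ | ⟨h1, h2⟩) <;> constructor <;> linarith
  have b1 := b hr h
  have b2 := b hr' hk
  have k1 : (k : ℝ) < 1 := by nlinarith
  have k2 : (-1 : ℝ) < k := by nlinarith
  have : k = 0 := by
    have k1' : k < 1 := by exact_mod_cast k1
    have k2' : -1 < k := by exact_mod_cast k2
    omega
  subst this
  exact h' (by simpa using hk)

theorem sin_phi0_pos {ν c : ℝ} (hc : 0 < c) (hc' : c < 1 / 1000) {c₁ x : ℝ}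
    (hx : 0 < critDist c₁ x) : 0 < sin (phi0 ν c c₁ x) := by
  rw [sin_phi0 hc hc', sampleBump, if_neg]
  · positivity
  · intro h
    have := critDist_le c₁ x ⌊(x - c₁) / π⌋
    rw [mul_comm, h, abs_zero] at this
    linarith

theorem exists_rpow_mul_exp_bound {ν κ b : ℝ} (hκ : 0 < κ) (hκν : κ < ν) (hb : 0 ≤ b) :
    ∃ C > 0, ∀ Y : ℝ, 1 ≤ Y → exp (-(Y ^ ν) / 4 + b * Y ^ κ) ≤ C * Y ^ (-(2 : ℝ)) := by
  have hν := hκ.trans hκν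
  have h0 : (fun Y : ℝ => Y ^ κ) =o[Filter.atTop] fun Y : ℝ => Y ^ ν := by
    refine Asymptotics.isLittleO_of_tendsto' ?_ ?_
    · filter_upwards [Filter.eventually_gt_atTop 0] with Y hY h
      exact absurd h (rpow_pos_of_pos hY ν).ne'
    · refine (tendsto_rpow_neg_atTop (sub_pos.2 hκν)).congr' ?_
      filter_upwards [Filter.eventually_gt_atTop 0] with Y hY
      rw [← rpow_sub hY, neg_sub]
  have h1 : (fun Y : ℝ => 2 * log Y + b * Y ^ κ) =o[Filter.atTop] fun Y : ℝ => Y ^ ν :=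
    ((isLittleO_log_rpow_atTop hν).const_mul_left 2).add
      (h0.const_mul_left b)
  have h2 := (Asymptotics.isLittleO_iff.1 h1) (c := 1 / 4) (by norm_num)
  obtain ⟨Y₀, h3⟩ := Filter.eventually_atTop.1 h2
  refine ⟨exp (2 * |Y₀| + b * |Y₀| ^ κ), exp_pos _, fun Y hY => ?_⟩
  have hY0 : 0 < Y := by linarith
  rw [rpow_def_of_pos hY0 (-2), ← exp_add, exp_le_exp]
  have hp : 0 ≤ Y ^ ν := by positivity
  rcases le_total Y₀ Y with h | h
  · have := h3 Y h
    rw [norm_of_nonneg hp] at this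
    have := (le_abs_self _).trans this
    have : 0 ≤ b * |Y₀| ^ κ := by positivity
    linarith [abs_nonneg Y₀]
  · have hle : Y ≤ |Y₀| := h.trans (le_abs_self _)
    have := mul_le_mul_of_nonneg_left (rpow_le_rpow hY0.le hle hκ.le) hb
    have := log_le_sub_one_of_pos hY0
    linarith

section
variable {W : ℕ → ℝ} {ℓ α M ν m a A c2 B c₁ : ℝ} {rad ρ : ℕ → ℝ} {Rp Rm : ℕ → ℕ}
  {base : ℝ → ℝ} {χ : ℕ → ℝ → ℝ} {j : ℕ} {f f' : ℝ → ℝ}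

theorem SegBound.small {k : ℕ} {x : ℝ} (hW : JetWeight W) (hA : 0 ≤ A)
    (hℓ : 2 * A + 6 ≤ ℓ) (hk : 1 ≤ k) (h : SegBound W ℓ α f A ν k x) :
    |segInv (exp ℓ) α f k x ^ 2| ≤ 1 / 2 ∧ |segT (exp ℓ) α f k x| ≤ 1 / 2 ∧
      |segS (exp ℓ) α f k x| ≤ 1 / 2 := by
  have hk' : (1 : ℝ) ≤ k := by exact_mod_cast hk
  have h1 := (h.inv' hA).abs_apply_le hW
  have h2 : exp (-(k * ℓ) + A * k) ≤ exp (-3) := exp_le_exp.2 (by nlinarith)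
  have h3 := h1.trans (h2.trans exp_neg_three_le)
  refine ⟨?_, (h.fwd'.abs_apply_le hW).trans (by norm_num),
    (h.bwd'.abs_apply_le hW).trans (by norm_num)⟩
  rw [abs_pow]
  nlinarith [abs_nonneg (segInv (exp ℓ) α f k x)]

theorem SchemeInv.contDiff (I : SchemeInv W ℓ α M ν m a A c2 c₁ rad Rp Rm base χ j f)
    (hb : ContDiff ℝ (⊤ : ℕ∞) base) : ContDiff ℝ (⊤ : ℕ∞) f := by
  rw [contDiff_iff_contDiffAt]
  intro x
  have := (I.near x).smooth.add hb.contDiffAt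
  refine this.congr_of_eventuallyEq (Filter.Eventually.of_forall fun z => ?_)
  simp

namespace Scheme

theorem segBound_congr (S : Scheme W ℓ α M ν m a A c2 B c₁ rad ρ Rp Rm base χ)
    (I : SchemeInv W ℓ α M ν m a A c2 c₁ rad Rp Rm base χ j f)
    (hf : ∀ z, rad j < critDist c₁ z → f' =ᶠ[nhds z] f) (k : ℕ) (x : ℝ) (hk : 1 ≤ k)
    (h : GoodSeg α c₁ (rad j) k x) : SegBound W ℓ α f' A ν k x :=
  (I.segBound S k x hk fun i h0 hi =>
    ⟨(S.rad_anti (Nat.le_succ j)).trans_lt (h i h0 hi).1, (h i h0 hi).2⟩).congr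
    fun i h0 hi => hf _ (h i h0 hi).1

theorem isContrDir (S : Scheme W ℓ α M ν m a A c2 B c₁ rad ρ Rp Rm base χ)
    (I : SchemeInv W ℓ α M ν m a A c2 c₁ rad Rp Rm base χ j f)
    (hf : ∀ z, rad j < critDist c₁ z → f' =ᶠ[nhds z] f) {x : ℝ} (hx : critDist c₁ x ≤ rad j) :
    IsContrDir (cocycleIter α (Amat (exp ℓ) f') (Rp j) x)
      (f' x - fwdAngle (exp ℓ) α f' (Rp j) x) ∧
    IsContrDir (cocycleIterNeg α (Amat (exp ℓ) f') (Rm j) x)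
      (bwdAngle (exp ℓ) α f' (Rm j) x) := by
  have hp := S.segBound_congr I hf _ _ (S.fwd j).pos ((S.fwd j).goodSeg_fwd le_rfl hx)
  have hm := S.segBound_congr I hf _ _ (S.bwd j).pos ((S.bwd j).goodSeg_bwd le_rfl hx)
  obtain ⟨p1, p2, p3⟩ := hp.small S.hW S.hA S.l1 (S.fwd j).pos
  obtain ⟨m1, m2, m3⟩ := hm.small S.hW S.hA S.l1 (S.bwd j).pos
  exact ⟨isContrDir_fwd (exp_ne_zero _) (S.fwd j).pos hp.ne (contrDen_pos p1 p2 p3),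
    isContrDir_bwd (exp_ne_zero _) (S.bwd j).pos hm.ne (contrDen_pos m1 m3 m2)⟩

theorem isHypBlock (S : Scheme W ℓ α M ν m a A c2 B c₁ rad ρ Rp Rm base χ)
    (I : SchemeInv W ℓ α M ν m a A c2 c₁ rad Rp Rm base χ j f)
    (hf : ∀ z, rad j < critDist c₁ z → f' =ᶠ[nhds z] f) (hα : Irrational α)
    (hb : BoundedType α M) {ε μ : ℝ} (hε : 0 ≤ ε) (hε1 : ε ≤ 1) (hμ : μ ≤ (1 - ε) * ℓ)
    (hAℓ : A * (1 + 128 * M ^ 2) ≤ ε * ℓ) {x : ℝ} (hx : critDist c₁ x ≤ rad j) :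
    IsHypBlock (exp ℓ) (exp μ) ε (fwdRet α (critSet c₁ (rad j)) x)
      (fun i => Amat (exp ℓ) f' (x + 2 * π * i * α)) :=
  isHypBlock_fwdRet hα S.hM hb (S.rad_pos j) (S.rad_le_one j) (S.rad_le_one 0) S.hW S.hA
    S.ℓ_nonneg (fun y hy => ((hf y ((S.rad_anti (Nat.zero_le j)).trans_lt hy)).trans
      (I.triv y hy)).self_of_nhds)
    (S.segBound_congr I hf) hε hε1 hμ hAℓ hx

theorem dirSum_congr (S : Scheme W ℓ α M ν m a A c2 B c₁ rad ρ Rp Rm base χ)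
    (hf : ∀ z, rad j < critDist c₁ z → f' =ᶠ[nhds z] f) {x : ℝ} (hx : critDist c₁ x ≤ rad j) :
    dirSum (exp ℓ) α f' (Rp j) (Rm j) x = dirSum (exp ℓ) α f (Rp j) (Rm j) x := by
  have e := S.dirSum_eventuallyEq hf hx
  rw [dirSum, e.1.self_of_nhds, e.2.self_of_nhds, dirSum]

/-- The direction difference dominates half of any profile below `base` which does not decay too
fast away from the critical set. -/
theorem half_le_dev (S : Scheme W ℓ α M ν m a A c2 B c₁ rad ρ Rp Rm base χ)
    (I : SchemeInv W ℓ α M ν m a A c2 c₁ rad Rp Rm base χ j f)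
    (l6 : 30 + 24 * c2 ≤ a * ℓ / 2) {x p : ℝ} (hx : critDist c₁ x ≤ rad j)
    (hx' : rad j / 10 < critDist c₁ x) (hχ : 0 ≤ χ j x ∧ χ j x ≤ 1) (hp : 0 < p)
    (hpb : p ≤ base x) (hpi : p⁻¹ ≤ c2 * exp (3 * critDist c₁ x ^ (-ν))) :
    1 / 2 * |p| ≤ |f x - dirSum (exp ℓ) α f (Rp j) (Rm j) x| := by
  obtain ⟨t, ht, e⟩ := I.dev x hx
  have hr := S.rad_pos j
  have hd : 0 < critDist c₁ x := by linarith
  have h5 : 1 ≤ (critDist c₁ x)⁻¹ := (one_le_inv₀ hd).2 (hx.trans (S.rad_le_one j))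
  have h6 : critDist c₁ x ^ (-ν) ≤ 10 / rad j := by
    rw [rpow_neg hd.le, ← inv_rpow hd.le]
    refine (rpow_le_rpow_of_exponent_le h5 S.hν1.le).trans ?_
    rw [rpow_one, inv_eq_one_div, div_le_div_iff₀ hd hr]
    linarith
  have h7 : p⁻¹ ≤ c2 * exp (30 / rad j) := hpi.trans (by
    refine mul_le_mul_of_nonneg_left (exp_le_exp.2 ?_) S.hc2
    calc 3 * critDist c₁ x ^ (-ν) ≤ 3 * (10 / rad j) := by linarith
      _ = 30 / rad j := by ring)
  have h8 : 24 * c2 ≤ exp (24 * c2) := by linarith [add_one_le_exp (24 * c2)]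
  have h9 := S.exp_rad_le (u := 30) (v := 24 * c2) (by linarith [S.hc2]) l6 j
  have h10 : exp (-(a * ℓ / (2 * rad j))) ≤ 1 := by
    rw [exp_le_one_iff]
    have := S.a_pos
    have := S.ℓ_nonneg
    have : 0 ≤ a * ℓ / (2 * rad j) := by positivity
    linarith
  rw [exp_add] at h9
  have h11 : 12 * exp (-(a * ℓ / rad j)) ≤ p / 2 := by
    have h12 : 24 * p⁻¹ * exp (-(a * ℓ / rad j)) ≤ 1 := by
      refine le_trans ?_ (h9.trans h10)
      refine mul_le_mul_of_nonneg_right ?_ (exp_pos _).le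
      have := mul_le_mul_of_nonneg_right h8 (exp_pos (30 / rad j)).le
      linarith
    have := mul_le_mul_of_nonneg_left h12 hp.le
    have e2 : p * (24 * p⁻¹ * exp (-(a * ℓ / rad j))) = 24 * exp (-(a * ℓ / rad j)) := by
      field_simp
    linarith
  have h13 : |(1 - χ j x) * t| ≤ p / 2 := by
    rw [abs_mul, abs_of_nonneg (by linarith [hχ.2])]
    have := abs_nonneg t
    nlinarith [hχ.1]
  rw [e, abs_of_pos hp]
  refine le_trans ?_ (le_abs_self _)
  linarith [le_abs_self ((1 - χ j x) * t)]

end Scheme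
end

end

/-! ### Choice of parameters -/

theorem one_add_inv_cutExp {ν : ℝ} (hν : 0 < ν) (hν1 : ν < 1) : 1 + 1 / (ν / (1 - ν)) = 1 / ν := by
  have : 1 - ν ≠ 0 := by linarith
  field_simp
  ring

theorem phi0_mul_critCut_gevrey {ν c M : ℝ} (hν : 0 < ν) (hν1 : ν < 1) (hc : 0 < c)
    (hc' : c < 1 / 1000) (hM : 1 ≤ M) : ∃ L₀ > 0, ∀ L, L₀ ≤ L → ∃ C > 0, ∀ r c₁ x, 0 < r → r ≤ 1 →
    JetBound (gevWeight L (1 + 1 / (ν / 2))) x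
      (fun z => phi0 ν c c₁ z * critCut (ν / (1 - ν)) r (r / (M + 1)) c₁ z) (C * r ^ 2) := by
  have hp : 0 < ν / (1 - ν) := div_pos hν (by linarith)
  obtain ⟨La, ha0, ha⟩ := phi0_gevrey hν hc hc'
  obtain ⟨Lb, hb0, B, hB, hb⟩ := critCut_gevrey hp
  have hν' : 0 < 1 / ν := by positivity
  have e1 := one_add_inv_cutExp hν hν1
  have e2 : 1 + 1 / (ν / 2) - 1 / ν = 1 + 1 / ν := by field_simp; ring
  have e3 : 1 + 1 / (ν / 2) - (1 + 1 / ν) = 1 / ν := by field_simp; ring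
  set κ : ℝ := 1 / (1 + 1 / ν) with hκ
  have hκ0 : 0 < κ := by positivity
  have hκν : κ < ν := by
    rw [hκ, div_lt_iff₀ (by positivity), mul_add, mul_one, mul_one_div_cancel hν.ne']
    linarith
  obtain ⟨C₀, hC₀, h0⟩ := exists_rpow_mul_exp_bound (b := 2 * ((1 + 1 / ν) * (M + 1) ^ κ)) hκ0 hκν
    (by positivity)
  refine ⟨max La Lb, lt_max_of_lt_left ha0, fun L hL => ?_⟩
  have hLa := (le_max_left _ _).trans hL
  have hLb := (le_max_right _ _).trans hL
  have hL0 : 0 < L := ha0.trans_le hLa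
  set F := exp ((1 + 1 / (ν / 2) - (1 + 1 / ν)) * (L / L) ^ (1 / (1 + 1 / (ν / 2) - (1 + 1 / ν))))
  have hs : 1 + 1 / ν < 1 + 1 / (ν / 2) := by linarith
  have hW : JetWeight (gevWeight L (1 + 1 / (ν / 2))) := gevWeight_jetWeight hL0 (by linarith)
  refine ⟨F * B * C₀, by positivity, fun r c₁ x hr hr1 => ?_⟩
  have hδ : 0 < r / (M + 1) := by positivity
  have hcut := hb L hLb (1 + 1 / (ν / 2)) (by rw [e1]; linarith) r (r / (M + 1)) c₁ x hδ hr1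
  rw [e1, e2, ← hκ] at hcut
  rcases lt_or_ge r (critDist c₁ x) with hd | hd
  · refine .zero_of_eventually hW (by positivity) ?_
    filter_upwards [critCut_eventually_zero (p := ν / (1 - ν)) hδ hd] with z hz
    simp [hz]
  rcases (critDist_nonneg c₁ x).eq_or_lt with hd0 | hd0
  · refine ((((ha L hLa c₁ x).1 hd0.symm).gev_raise hL0 hL0 hs).mul hW hcut).mono ?_
    simp only [mul_zero, zero_mul]
    positivity
  · refine ((((ha L hLa c₁ x).2 hd0).1.gev_raise hL0 hL0 hs).mul hW hcut).mono ?_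
    have h1 : (r⁻¹) ^ ν ≤ critDist c₁ x ^ (-ν) := by
      rw [rpow_neg hd0.le, ← inv_rpow hd0.le]
      gcongr
    have h2 := h0 r⁻¹ ((one_le_inv₀ hr).2 hr1)
    have e4 : (r / (M + 1))⁻¹ ^ κ = (M + 1) ^ κ * r⁻¹ ^ κ := by
      rw [inv_div, div_eq_mul_inv, mul_rpow (by positivity) (by positivity)]
    have e5 : r⁻¹ ^ (-(2 : ℝ)) = r ^ 2 := by
      rw [rpow_neg (by positivity), inv_rpow hr.le, inv_inv]
      norm_cast
    rw [e4]
    rw [e5] at h2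
    have h3 : exp (-critDist c₁ x ^ (-ν) / 4) *
        exp (2 * ((1 + 1 / ν) * ((M + 1) ^ κ * r⁻¹ ^ κ))) ≤ C₀ * r ^ 2 := by
      refine le_trans ?_ h2
      rw [← exp_add, exp_le_exp]
      linarith
    calc _ = F * B * (exp (-critDist c₁ x ^ (-ν) / 4) *
        exp (2 * ((1 + 1 / ν) * ((M + 1) ^ κ * r⁻¹ ^ κ)))) := by ring
      _ ≤ F * B * (C₀ * r ^ 2) := by gcongr
      _ = _ := by ring

/-- The parameters of the construction exist for all large heights. -/
theorem exists_scheme {α M ν β c : ℝ} (c₁ : ℝ) (hα : Irrational α) (hM : 1 ≤ M)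
    (hbdd : BoundedType α M) (hν : 0 < ν) (hν1 : ν < 1) (hβ : 1 < β) (hc : 0 < c)
    (hc' : c < 1 / 1000) : ∃ a > 0, ∃ A ≥ 0, ∃ B, ∃ ℓ₀ ≥ 0, 30 + 24 * (2 * c⁻¹ * exp 3) ≤ a * ℓ₀ / 2 ∧
    ∀ N, 1 ≤ N → ∃ L₁ > 0, ∀ L, L₁ ≤ L → ∀ ℓ, ℓ₀ ≤ ℓ →
    Scheme (gevWeight L (1 + 1 / ν)) ℓ α M ν (M ^ β) a A (2 * c⁻¹ * exp 3) B c₁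
      (fun j => cfDen α (N + j) ^ (-β))
      (fun j => cfDen α (N + j) ^ (-β) - cfDen α (N + j) ^ (-β) / (M + 1))
      (fun j => minFwdRet α (critI α β c₁ (N + j))) (fun j => minBwdRet α (critI α β c₁ (N + j)))
      (baseAngle (ν / (1 - ν)) (cfDen α N ^ (-β)) (cfDen α N ^ (-β) / (M + 1)) ν c c₁)
      (fun j => critCut (ν / (1 - ν)) (cfDen α (N + j) ^ (-β))
        (cfDen α (N + j) ^ (-β) / (M + 1)) c₁) := by
  have hp : 0 < ν / (1 - ν) := div_pos hν (by linarith)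
  have hν' : 0 < 1 / ν := by positivity
  have e1 := one_add_inv_cutExp hν hν1
  have hM0 : 0 < M := by linarith
  have hm : 1 ≤ M ^ β := one_le_rpow hM (by linarith)
  set m := M ^ β with hmdef
  have hm0 : 0 < m := by linarith
  set c2 := 2 * c⁻¹ * exp 3 with hc2def
  have hc2 : 0 ≤ c2 := by positivity
  set a := 1 / (8 * M * m) with hadef
  have ha : 0 < a := by positivity
  obtain ⟨A, hA, ℓ₁, hℓ₁, hseg⟩ := exists_segBound (Cp := 3 + 8 * c2) (cr := a / m)
    (Cr := 16 * M) hα hM hbdd hν hν1 (by positivity) (by positivity)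
  obtain ⟨Lb, hb0, B, hB, hcut⟩ := critCut_gevrey hp
  obtain ⟨La, ha0, hbase⟩ := baseAngle_gevrey (p := ν / (1 - ν)) (c := c) hp hν
    (by rw [gt_iff_lt]; linarith) hc hc'
  set T := 2 * (A + 3) * (16 * M) + 2 * (2 * (M + 1) + 12 * B) + 2 * (3 * m + 96 * c2) + 12 +
    2 * (30 + 24 * c2) with hT
  have p1 : 0 ≤ 2 * (A + 3) * (16 * M) := by positivity
  have hT0 : 0 ≤ T := by positivity
  have haT : a * (T / a) = T := by field_simp
  have hℓa : ∀ ℓ, ℓ₁ + (2 * A + 6) + T / a ≤ ℓ → T ≤ a * ℓ := fun ℓ h => by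
    rw [← haT]
    exact mul_le_mul_of_nonneg_left (by linarith) ha.le
  refine ⟨a, ha, A, hA, B, ℓ₁ + (2 * A + 6) + T / a, by positivity, ?_, fun N hN => ?_⟩
  · have := hℓa _ le_rfl
    linarith
  have q1 : ∀ n, 1 ≤ cfDen α n := one_le_cfDen hα
  have q0 : ∀ n, 0 < cfDen α n := fun n => zero_lt_one.trans_le (q1 n)
  have hr0 : ∀ n, 0 < cfDen α n ^ (-β) := fun n => rpow_pos_of_pos (q0 n) _
  have hr1 : ∀ n, cfDen α n ^ (-β) ≤ 1 := fun n =>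
    rpow_le_one_of_one_le_of_nonpos (q1 n) (by linarith)
  have hδ : ∀ n, 0 < cfDen α n ^ (-β) / (M + 1) := fun n => div_pos (hr0 n) (by linarith)
  have hδr : ∀ n, cfDen α n ^ (-β) / (M + 1) < cfDen α n ^ (-β) := fun n =>
    div_lt_self (hr0 n) (by linarith)
  obtain ⟨Lc, hLc, hbase⟩ := hbase _ _ (hδ N) (hδr N) (hr1 N)
  refine ⟨max Lb Lc, lt_max_of_lt_left hb0, fun L hL ℓ hℓ => ?_⟩
  have hLb := (le_max_left _ _).trans hL
  have hLc := (le_max_right _ _).trans hL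
  have hL0 : 0 < L := hb0.trans_le hLb
  have hW : JetWeight (gevWeight L (1 + 1 / ν)) := gevWeight_jetWeight hL0 (by linarith)
  have hT' := hℓa ℓ hℓ
  have hTa : 0 ≤ T / a := by positivity
  exact
  { hW := hW
    hA := hA
    hM := hM
    hm := hm
    ha := by rw [hadef]; field_simp
    hν := hν
    hν1 := hν1
    hc2 := hc2
    hB := hB
    rad_pos := fun j => hr0 _
    rad_le_one := fun j => hr1 _
    rad_succ := fun j => by
      have h1 := cfDen_growth hα hM hbdd (n := N + j) (by omega)
      have h2 : 1 < 1 + 1 / M := by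
        have : 0 < 1 / M := by positivity
        linarith
      have h3 : cfDen α (N + j + 1) ^ (-β) ≤ (1 + 1 / M) ^ (-β) * cfDen α (N + j) ^ (-β) := by
        rw [← mul_rpow (by linarith) (q0 _).le]
        exact rpow_le_rpow_of_nonpos (mul_pos (by linarith) (q0 _)) h1 (by linarith)
      have h4 : (1 + 1 / M) ^ (-β) < (1 + 1 / M) ^ (-1 : ℝ) :=
        rpow_lt_rpow_of_exponent_lt h2 (by linarith)
      have h5 : (1 + 1 / M) ^ (-1 : ℝ) = 1 - 1 / (M + 1) := by
        rw [rpow_neg_one]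
        field_simp
        ring
      have h6 := mul_lt_mul_of_pos_right (h4.trans_eq h5) (hr0 (N + j))
      refine (h3.trans_lt h6).trans_eq ?_
      ring
    ρ_lt := fun j => by linarith [hδ (N + j)]
    rad_le := fun j => by
      have h1 := hbdd (N + j)
      have h2 : (M * cfDen α (N + j)) ^ (-β) ≤ cfDen α (N + j + 1) ^ (-β) :=
        rpow_le_rpow_of_nonpos (q0 _) h1 (by linarith)
      rw [mul_rpow hM0.le (q0 _).le, rpow_neg hM0.le, ← hmdef, inv_mul_le_iff₀ hm0] at h2
      exact h2
    le_inv_rad := fun j => by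
      rw [← rpow_neg (q0 _).le, neg_neg]
      calc (j : ℝ) ≤ ((N + j : ℕ) : ℝ) := by push_cast; linarith [(Nat.cast_nonneg N : (0:ℝ) ≤ N)]
        _ ≤ cfDen α (N + j) := natCast_le_cfDen hα _
        _ = cfDen α (N + j) ^ (1 : ℝ) := (rpow_one _).symm
        _ ≤ _ := rpow_le_rpow_of_exponent_le (q1 _) hβ.le
    fwd := fun j => returnSpec_fwd hα hM hbdd (hr0 _) (hr1 _)
    bwd := fun j => returnSpec_bwd hα hM hbdd (hr0 _) (hr1 _)
    base_sin := fun x => (hbase L hLc c₁ x).1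
    base_cos := fun x => (hbase L hLc c₁ x).2.1
    base_ne := fun x hx => by
      have h1 := baseAngle_mem (p := ν / (1 - ν)) (r := cfDen α N ^ (-β))
        (δ := cfDen α N ^ (-β) / (M + 1)) (ν := ν) (c₁ := c₁) hp hc hc' x
      have h2 := sin_phi0_pos (ν := ν) hc hc' hx
      have h3 := phi0_mem (ν := ν) hc hc' c₁ x
      have h4 := sin_le_sin_of_le_of_le_pi_div_two (by linarith [pi_pos]) h1.2 h1.1
      exact (h2.trans_le h4).ne'
    base_inv := fun x hx => ((hbase L hLc c₁ x).2.2 hx).mono (le_of_eq (by rw [hc2def]; ring))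
    base_triv := fun x hx => by
      filter_upwards [continuousAt_const.eventually_lt (critDist_continuous c₁).continuousAt hx]
        with z hz
      exact baseAngle_of_le (hδ N) (le_of_lt hz)
    cut := fun j x => by
      refine (hcut L hLb (1 + 1 / ν) (by rw [e1]; linarith) _ _ c₁ x (hδ (N + j))
        (hr1 (N + j))).mono (le_of_eq ?_)
      rw [e1, add_sub_cancel_right, div_one, rpow_one, inv_div]
      ring_nf
    cut_zero := fun j x hx => critCut_eventually_zero (hδ _) hx
    cut_one := fun j x hx => critCut_eventually_one (hδ _) hx
    seg := fun φ hφ δ₀ hδ₀ => hseg ℓ (by linarith) _ hW φ hφ c₁ _ δ₀ hδ₀ (hr1 _)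
    l1 := by linarith
    l2 := by linarith
    l3 := by linarith
    l4 := by linarith
    l5 := by linarith }

theorem critCut_smooth {p r δ : ℝ} (c₁ : ℝ) (hp : 0 < p) (hδ : 0 < δ) (hr : r ≤ 1) :
    ContDiff ℝ (⊤ : ℕ∞) (critCut p r δ c₁) := by
  obtain ⟨L, -, B, -, h⟩ := critCut_gevrey hp
  exact contDiff_iff_contDiffAt.2 fun x =>
    (h L le_rfl (1 + 1 / p + 1) (by linarith) r δ c₁ x hδ hr).smooth

theorem baseAngle_smooth {p r δ ν c : ℝ} (c₁ : ℝ) (hp : 0 < p) (hδ : 0 < δ) (hr : r ≤ 1)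
    (hν : 0 < ν) (hc : 0 < c) (hc' : c < 1 / 1000) :
    ContDiff ℝ (⊤ : ℕ∞) (baseAngle p r δ ν c c₁) :=
  contDiff_const.add ((critCut_smooth c₁ hp hδ hr).mul
    ((phi0_smooth hν hc hc' c₁).sub contDiff_const))

theorem inv_phi0_le {ν c : ℝ} (hν : 0 < ν) (hc : 0 < c) (hc' : c < 1 / 1000) {c₁ x : ℝ}
    (hx : 0 < critDist c₁ x) :
    (phi0 ν c c₁ x)⁻¹ ≤ 2 * c⁻¹ * exp 3 * exp (3 * critDist c₁ x ^ (-ν)) := by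
  obtain ⟨L, hL, h⟩ := phi0_gevrey hν hc hc'
  have h1 := ((h L le_rfl c₁ x).2 hx).2.abs_apply_le
    (gevWeight_jetWeight hL (by linarith [one_div_pos.2 hν]))
  have h2 := sin_phi0_pos (ν := ν) hc hc' hx
  have h3 := sin_le (phi0_mem (ν := ν) hc hc' c₁ x).1
  have h4 : (phi0 ν c c₁ x)⁻¹ ≤ (sin (phi0 ν c c₁ x))⁻¹ := inv_anti₀ h2 h3
  have h5 : 0 ≤ c⁻¹ * (exp 3 * exp (3 * critDist c₁ x ^ (-ν))) := by positivity
  calc _ ≤ c⁻¹ * (exp 3 * exp (3 * critDist c₁ x ^ (-ν))) := h4.trans ((le_abs_self _).trans h1)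
    _ ≤ 2 * (c⁻¹ * (exp 3 * exp (3 * critDist c₁ x ^ (-ν)))) := by linarith
    _ = _ := by ring

theorem lamSeq_exponent_le {α : ℝ} (hα : Irrational α) (M γ : ℝ) (N n : ℕ) :
    (1 - (M ^ (100 : ℕ))⁻¹) * (cfDen α N ^ cfDen α N) -
      10 ^ 4 * ∑ k ∈ Finset.Icc (N + 1) n, cfDen α k ^ (γ - 1) ≤
    (1 - (M ^ (100 : ℕ))⁻¹) * (cfDen α N ^ cfDen α N) := by
  have : 0 ≤ ∑ k ∈ Finset.Icc (N + 1) n, cfDen α k ^ (γ - 1) :=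
    Finset.sum_nonneg fun k _ => rpow_nonneg (zero_le_one.trans (one_le_cfDen hα k)) _
  linarith

theorem exp_neg_le_lamSeq_rpow {α M γ a β : ℝ} {N n : ℕ} (hα : Irrational α) (hM : 1 ≤ M)
    (hℓ : 6 ≤ cfDen α N ^ cfDen α N) (ha : 1 ≤ a / 2 * cfDen α (n + 1) ^ (β - 1)) :
    4 * π ^ 2 / 3 * exp (-(a * cfDen α N ^ cfDen α N / (2 * cfDen α (n + 1) ^ (-β)))) ≤
      lamSeq α M γ N (n + 1) ^ (-(cfDen α n) / 100) := by
  have hX := lamSeq_exponent_le hα M γ N (n + 1)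
  unfold lamSeq
  set ℓ := cfDen α N ^ cfDen α N
  set X := (1 - (M ^ (100 : ℕ))⁻¹) * ℓ -
    10 ^ 4 * ∑ k ∈ Finset.Icc (N + 1) (n + 1), cfDen α k ^ (γ - 1)
  have hε : 0 ≤ (M ^ (100 : ℕ))⁻¹ := by positivity
  have hXℓ : X ≤ ℓ := by nlinarith
  have q' := one_le_cfDen hα n
  have q1 := one_le_cfDen hα (n + 1)
  have hq := cfDen_mono hα (Nat.le_succ n)
  set q := cfDen α (n + 1)
  have hq0 : 0 < q := by linarith
  have e1 : a * ℓ / (2 * q ^ (-β)) = ℓ * q * (a / 2 * q ^ (β - 1)) := by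
    rw [rpow_neg hq0.le, rpow_sub_one hq0.ne']
    field_simp
  have h1 : ℓ * q ≤ ℓ * q * (a / 2 * q ^ (β - 1)) :=
    le_mul_of_one_le_right (by positivity) ha
  have h2 : X * cfDen α n ≤ ℓ * q := mul_le_mul hXℓ hq (by linarith) (by linarith)
  have h3 : 6 ≤ ℓ * q := by nlinarith
  have h4 : 4 * π ^ 2 / 3 ≤ exp 3 := by
    have := exp_one_gt_d9
    have e : exp 3 = exp 1 ^ 3 := by rw [← exp_nat_mul]; norm_num
    have h5 : (2.7 : ℝ) ^ 3 ≤ exp 1 ^ 3 := by gcongr; linarith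
    have := pi_lt_d2
    have := pi_pos
    rw [e]
    nlinarith
  rw [← exp_mul, e1]
  calc _ ≤ exp 3 * exp (-(ℓ * q * (a / 2 * q ^ (β - 1)))) := by gcongr
    _ ≤ _ := by
      rw [← exp_add, exp_le_exp]
      linarith

/-- **Proposition 3.2: the degenerate perturbed sequence.**  In the setup of the paper,
for `q_N` sufficiently large there are `K, C > 0`, functions `φ_n` satisfying the
conclusions of Proposition 3.1, an exponent `1 + 1/ν' > 1 + 1/ν` (i.e. `0 < ν' < ν`),
and `2π`-periodic smooth functions `φ̃_n` (`n ≥ N`) such that, with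
`Ã_n = Λ R_{π/2 − φ̃_n}`, `s̃_n(x) = s((Ã_n)_{r_n^+}(x))`, `s̃_n′(x) = s((Ã_n)_{−r_n^−}(x))`:
(1) `|φ_n − φ̃_n|_{1+1/ν',K} ≤ C q_n^{−2}` for `n > N`;
(2) each block `Ã_n(x), …, Ã_n(T^{r_n^+(x)−1}x)`, `x ∈ I_n`, is `λ_n`-hyperbolic;
(3) `s̃_n = s̃_n′` on `(1/10)I_n`. -/
theorem degenerate_sequence
    (α M ν β c c₁ : ℝ) (hα : Irrational α) (hM : 1 ≤ M) (hbdd : BoundedType α M)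
    (hν : 0 < ν) (hν1 : ν < 1) (hβ : 1 < β) (hγ : ν * β < 1)
    (hc : 0 < c) (hc' : c < 1 / 1000) (hc₁ : c₁ ∈ Set.Ico (0 : ℝ) π) :
    ∃ Q₀ : ℝ, ∀ N : ℕ, Q₀ ≤ cfDen α N →
    ∃ K > (0 : ℝ), ∃ C > (0 : ℝ), ∃ ν' : ℝ, 0 < ν' ∧ ν' < ν ∧
    ∃ φ φt : ℕ → ℝ → ℝ, ∃ sd sd' td td' : ℕ → ℝ → ℝ,
      -- the functions `φ_n` of Proposition 3.1 and the perturbed functions `φ̃_n`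
      (∀ n, N ≤ n → ContDiff ℝ (⊤ : ℕ∞) (φ n) ∧ Function.Periodic (φ n) (2 * π)) ∧
      (∀ n, N ≤ n → ContDiff ℝ (⊤ : ℕ∞) (φt n) ∧ Function.Periodic (φt n) (2 * π)) ∧
      -- direction data: `sd, sd'` for `A_n` and `td, td'` for `Ã_n`
      (∀ n, N ≤ n → ∀ x ∈ critI α β c₁ n,
        IsContrDir (cocycleIter α (Amat (lam0 α N) (φ n))
          (minFwdRet α (critI α β c₁ n)) x) (sd n x) ∧
        IsContrDir (cocycleIterNeg α (Amat (lam0 α N) (φ n))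
          (minBwdRet α (critI α β c₁ n)) x) (sd' n x) ∧
        IsContrDir (cocycleIter α (Amat (lam0 α N) (φt n))
          (minFwdRet α (critI α β c₁ n)) x) (td n x) ∧
        IsContrDir (cocycleIterNeg α (Amat (lam0 α N) (φt n))
          (minBwdRet α (critI α β c₁ n)) x) (td' n x)) ∧
      -- Proposition 3.1 conclusions for `φ_n`
      (∀ n, N < n →
        gevreyNorm (1 + 1 / ν) K (fun x => φ n x - φ (n - 1) x) ≤
          ENNReal.ofReal (lamSeq α M (ν * β) N n ^ (-(cfDen α (n - 1)) / 100))) ∧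
      (∀ n, N ≤ n → ∀ x ∈ critI α β c₁ n,
        IsHypBlock (lam0 α N) (lamSeq α M (ν * β) N n) ((M ^ (100 : ℕ))⁻¹)
          (fwdRet α (critI α β c₁ n) x)
          (fun i => Amat (lam0 α N) (φ n) (x + 2 * π * i * α))) ∧
      (∀ n, N ≤ n → ∀ x ∈ critI10 α β c₁ n, sd n x - sd' n x = phi0 ν c c₁ x) ∧
      (∀ n, N ≤ n → ∀ x ∈ critI α β c₁ n, x ∉ critI10 α β c₁ n →
        (1 / 2) * |phi0 ν c c₁ x| ≤ |sd n x - sd' n x|) ∧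
      -- (1)ₙ: `|φ_n − φ̃_n|_{1+1/ν',K} ≤ C q_n^{−2}`
      (∀ n, N < n →
        gevreyNorm (1 + 1 / ν') K (fun x => φ n x - φt n x) ≤
          ENNReal.ofReal (C * cfDen α n ^ (-(2 : ℝ)))) ∧
      -- (2)ₙ: the blocks of `Ã_n` along first returns to `I_n` are `λ_n`-hyperbolic
      (∀ n, N ≤ n → ∀ x ∈ critI α β c₁ n,
        IsHypBlock (lam0 α N) (lamSeq α M (ν * β) N n) ((M ^ (100 : ℕ))⁻¹)
          (fwdRet α (critI α β c₁ n) x)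
          (fun i => Amat (lam0 α N) (φt n) (x + 2 * π * i * α))) ∧
      -- (3)ₙ: `s̃_n = s̃_n′` on `(1/10)I_n`
      (∀ n, N ≤ n → ∀ x ∈ critI10 α β c₁ n, td n x = td' n x) := by
  obtain ⟨a, ha, A, hA, B, ℓ₀, hℓ₀, l6, hS⟩ := exists_scheme c₁ hα hM hbdd hν hν1 hβ hc hc'
  have t1 : 0 ≤ A * (1 + 128 * M ^ 2) * M ^ (100 : ℕ) := by positivity
  have t2 : 0 ≤ (2 / a) ^ (1 / (β - 1)) := by positivity
  refine ⟨2 + ℓ₀ + A * (1 + 128 * M ^ 2) * M ^ (100 : ℕ) + (2 / a) ^ (1 / (β - 1)),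
    fun N hN => ?_⟩
  have hN1 : 1 ≤ N := by
    by_contra! h
    obtain rfl : N = 0 := by omega
    rw [cfDen_zero] at hN
    linarith
  have hqq : cfDen α N ≤ cfDen α N ^ cfDen α N :=
    (rpow_one (cfDen α N)).symm.le.trans
      (rpow_le_rpow_of_exponent_le (by linarith) (by linarith))
  have hq (n : ℕ) : 1 ≤ cfDen α n := one_le_cfDen hα n
  have hq0 (n : ℕ) : 0 < cfDen α n := zero_lt_one.trans_le (hq n)
  have hr0 (n : ℕ) : 0 < cfDen α n ^ (-β) := rpow_pos_of_pos (hq0 n) _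
  have hr1 (n : ℕ) : cfDen α n ^ (-β) ≤ 1 :=
    rpow_le_one_of_one_le_of_nonpos (hq n) (by linarith)
  have hδ (n : ℕ) : 0 < cfDen α n ^ (-β) / (M + 1) := div_pos (hr0 n) (by linarith)
  have hp : 0 < ν / (1 - ν) := div_pos hν (by linarith)
  obtain ⟨L₁, hL₁, hS⟩ := hS N hN1
  obtain ⟨L₂, hL₂, hgap⟩ := phi0_mul_critCut_gevrey hν hν1 hc hc' hM
  obtain ⟨C, hC, hgap⟩ := hgap (max L₁ L₂) (le_max_right _ _)
  have S := hS (max L₁ L₂) (le_max_left _ _) _ (show ℓ₀ ≤ cfDen α N ^ cfDen α N by linarith)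
  have hL : 0 < max L₁ L₂ := lt_max_of_lt_left hL₁
  set base := baseAngle (ν / (1 - ν)) (cfDen α N ^ (-β)) (cfDen α N ^ (-β) / (M + 1)) ν c c₁
  set χ : ℕ → ℝ → ℝ := fun j => critCut (ν / (1 - ν)) (cfDen α (N + j) ^ (-β))
    (cfDen α (N + j) ^ (-β) / (M + 1)) c₁ with hχdef
  set Rp : ℕ → ℕ := fun j => minFwdRet α (critI α β c₁ (N + j))
  set Rm : ℕ → ℕ := fun j => minBwdRet α (critI α β c₁ (N + j))
  set f : ℕ → ℝ → ℝ := phiSeq (exp (cfDen α N ^ cfDen α N)) α base χ Rp Rm with hf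
  set g : ℕ → ℝ → ℝ := fun j x => f j x - phi0 ν c c₁ x * χ j x with hg
  have I (j : ℕ) := S.inv j
  have hfs (j : ℕ) : ContDiff ℝ (⊤ : ℕ∞) (f j) :=
    (I j).contDiff (baseAngle_smooth c₁ hp (hδ N) (hr1 N) hν hc hc')
  have hχs (j : ℕ) : ContDiff ℝ (⊤ : ℕ∞) (χ j) := critCut_smooth c₁ hp (hδ _) (hr1 _)
  have hfp (j : ℕ) : Function.Periodic (f j) π :=
    phiSeq_periodic (baseAngle_periodic _ _ _ _ _ _) (fun _ => critCut_periodic _ _ _ _) j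
  have hgp (j : ℕ) : Function.Periodic (g j) π := fun x => by
    simp only [hg, hfp j x, phi0_periodic ν c c₁ x, hχdef,
      critCut_periodic _ _ _ c₁ x]
  have hff (j : ℕ) (z : ℝ) (_ : cfDen α (N + j) ^ (-β) < critDist c₁ z) : f j =ᶠ[nhds z] f j :=
    Filter.EventuallyEq.rfl
  have hgf (j : ℕ) (z : ℝ) (hz : cfDen α (N + j) ^ (-β) < critDist c₁ z) :
      g j =ᶠ[nhds z] f j := by
    filter_upwards [critCut_eventually_zero (p := ν / (1 - ν)) (hδ (N + j)) hz] with y hy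
    simp only [hg, hχdef, hy, mul_zero, sub_zero]
  have hε1 : (M ^ (100 : ℕ))⁻¹ ≤ 1 := inv_le_one_of_one_le₀ (one_le_pow₀ hM)
  have hAε : A * (1 + 128 * M ^ 2) ≤ (M ^ (100 : ℕ))⁻¹ * cfDen α N ^ cfDen α N := by
    rw [le_inv_mul_iff₀ (by positivity), mul_comm]
    linarith
  have hβq (n : ℕ) (hn : N ≤ n) : 1 ≤ a / 2 * cfDen α n ^ (β - 1) := by
    have h1 : (2 / a) ^ (1 / (β - 1)) ≤ cfDen α n := by linarith [cfDen_mono hα hn]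
    have h2 := rpow_le_rpow t2 h1 (by linarith : 0 ≤ β - 1)
    rw [← rpow_mul (by positivity), one_div_mul_cancel (by linarith), rpow_one] at h2
    have h3 := mul_le_mul_of_nonneg_left h2 (by positivity : 0 ≤ a / 2)
    have e : a / 2 * (2 / a) = 1 := by field_simp
    linarith
  have hcore (j : ℕ) (x : ℝ) (hx : critDist c₁ x ≤ cfDen α (N + j) ^ (-β) / 10) :
      critDist c₁ x ≤ cfDen α (N + j) ^ (-β) ∧ χ j x = 1 ∧
      f j x - dirSum (exp (cfDen α N ^ cfDen α N)) α (f j) (Rp j) (Rm j) x =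
        phi0 ν c c₁ x := by
    have h1 : ∀ n, cfDen α n ^ (-β) / 10 ≤ cfDen α n ^ (-β) - cfDen α n ^ (-β) / (M + 1) :=
      fun n => by
        have : cfDen α n ^ (-β) / (M + 1) ≤ cfDen α n ^ (-β) / 2 :=
          div_le_div_of_nonneg_left (hr0 n).le (by norm_num) (by linarith)
        linarith [hr0 n]
    have h2 : cfDen α (N + j) ^ (-β) ≤ cfDen α N ^ (-β) :=
      rpow_le_rpow_of_nonpos (hq0 _) (cfDen_mono hα (Nat.le_add_right N j)) (by linarith)
    have h3 : critDist c₁ x ≤ cfDen α (N + j) ^ (-β) := by linarith [hr0 (N + j)]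
    have h4 : χ j x = 1 := critCut_eq_one (hδ _) (hx.trans (h1 _))
    obtain ⟨t, -, e⟩ := (I j).dev x h3
    refine ⟨h3, h4, ?_⟩
    rw [e, h4, sub_self, zero_mul, sub_zero]
    exact baseAngle_of_le' (hδ _) (by linarith [h1 N])
  refine ⟨4 * max L₁ L₂, by positivity, 4 * π ^ 2 / 3 * C, by positivity, ν / 2, by positivity,
    by linarith, fun n => f (n - N), fun n => g (n - N),
    fun n x => f (n - N) x - fwdAngle (exp (cfDen α N ^ cfDen α N)) α (f (n - N)) (Rp (n - N)) x,
    fun n x => bwdAngle (exp (cfDen α N ^ cfDen α N)) α (f (n - N)) (Rm (n - N)) x,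
    fun n x => g (n - N) x - fwdAngle (exp (cfDen α N ^ cfDen α N)) α (g (n - N)) (Rp (n - N)) x,
    fun n x => bwdAngle (exp (cfDen α N ^ cfDen α N)) α (g (n - N)) (Rm (n - N)) x,
    ?_, ?_, ?_, ?_, ?_, ?_, ?_, ?_, ?_, ?_⟩
  · exact fun n _ => ⟨hfs _, by simpa using (hfp (n - N)).nat_mul 2⟩
  · exact fun n _ => ⟨(hfs _).sub ((phi0_smooth hν hc hc' c₁).mul (hχs _)),
      by simpa using (hgp (n - N)).nat_mul 2⟩
  · intro n hn x hx
    obtain ⟨j, rfl⟩ := Nat.exists_eq_add_of_le hn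
    simp only [Nat.add_sub_cancel_left]
    have h1 := S.isContrDir (I j) (hff j) (critDist_le_of_mem hx)
    have h2 := S.isContrDir (I j) (hgf j) (critDist_le_of_mem hx)
    exact ⟨h1.1, h1.2, h2.1, h2.2⟩
  · intro n hn
    obtain ⟨j, rfl⟩ := Nat.exists_eq_add_of_lt hn
    beta_reduce
    rw [show N + j + 1 - 1 = N + j by omega, show N + j + 1 - N = j + 1 by omega,
      Nat.add_sub_cancel_left]
    refine (gevreyNorm_le hL (by linarith [one_div_pos.2 hν]) fun x => ?_).trans
      (ENNReal.ofReal_le_ofReal (exp_neg_le_lamSeq_rpow hα hM (a := a) (β := β)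
        (by linarith [S.l1]) (hβq _ (by omega))))
    refine (S.step_bound (I j) x).congr (Filter.Eventually.of_forall fun z => ?_)
    simp only [hf, phiSeq, stepGap]
    ring
  · intro n hn x hx
    obtain ⟨j, rfl⟩ := Nat.exists_eq_add_of_le hn
    simp only [Nat.add_sub_cancel_left]
    exact S.isHypBlock (I j) (hff j) hα hbdd (by positivity) hε1
      (lamSeq_exponent_le hα M _ N _) hAε (critDist_le_of_mem hx)
  · intro n hn x hx
    obtain ⟨j, rfl⟩ := Nat.exists_eq_add_of_le hn
    beta_reduce
    rw [Nat.add_sub_cancel_left, sub_sub]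
    exact (hcore j x (critDist_le_of_mem hx)).2.2
  · intro n hn x hx hx'
    obtain ⟨j, rfl⟩ := Nat.exists_eq_add_of_le hn
    beta_reduce
    rw [Nat.add_sub_cancel_left, sub_sub]
    have hd := lt_critDist_of_notMem (hr1 _) (by linarith [hr0 (N + j), hr1 (N + j)]) hx hx'
    have hd0 : 0 < critDist c₁ x := by linarith [hr0 (N + j)]
    have h1 := phi0_mem (ν := ν) hc hc' c₁ x
    refine S.half_le_dev (I j) ?_ (critDist_le_of_mem hx) hd (critCut_mem hp _ _ _ _)
      ((sin_phi0_pos hc hc' hd0).trans_le (sin_le h1.1)) (baseAngle_mem hp hc hc' x).1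
      (inv_phi0_le hν hc hc' hd0)
    have : a * ℓ₀ ≤ a * cfDen α N ^ cfDen α N :=
      mul_le_mul_of_nonneg_left (by linarith) ha.le
    linarith
  · intro n hn
    obtain ⟨j, rfl⟩ := Nat.exists_eq_add_of_lt hn
    beta_reduce
    rw [show N + j + 1 - N = j + 1 by omega]
    refine (gevreyNorm_le (B := C * (cfDen α (N + (j + 1)) ^ (-β)) ^ 2) hL
      (by linarith [one_div_pos.2 (half_pos hν)]) fun x => ?_).trans
      (ENNReal.ofReal_le_ofReal ?_)
    · refine (hgap _ c₁ x (hr0 (N + (j + 1))) (hr1 _)).congr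
        (Filter.Eventually.of_forall fun z => ?_)
      simp only [hg, hχdef]
      ring
    · rw [← mul_assoc, ← add_assoc, ← rpow_mul_natCast (hq0 _).le]
      refine mul_le_mul_of_nonneg_left (rpow_le_rpow_of_exponent_le (hq _) ?_) (by positivity)
      push_cast
      linarith
  · intro n hn x hx
    obtain ⟨j, rfl⟩ := Nat.exists_eq_add_of_le hn
    simp only [Nat.add_sub_cancel_left]
    exact S.isHypBlock (I j) (hgf j) hα hbdd (by positivity) hε1
      (lamSeq_exponent_le hα M _ N _) hAε (critDist_le_of_mem hx)
  · intro n hn x hx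
    obtain ⟨j, rfl⟩ := Nat.exists_eq_add_of_le hn
    beta_reduce
    obtain ⟨h1, h2, h3⟩ := hcore j x (critDist_le_of_mem hx)
    have h4 := S.dirSum_congr (hgf j) h1
    rw [Nat.add_sub_cancel_left, sub_eq_iff_eq_add', ← dirSum, h4]
    simp only [hg, h2]
    linarith

end
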